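/- arXiv:1411.2451 — 4 statements merged into one kernel-verified Lean document; each statement's English description precedes it below -/
import Mathlib

section
/- Let D ≥ 2 and k ≥ 1. There exist constants c_1, c_2 > 0 depending only on k and D such that the following holds for every sufficiently small ε > 0: let y_1,...,y_k and z_1,...,z_k be two k-point configurations in ℝ^D scaled so that Σ_{i≠j} |y_i − y_j|² + Σ_{i≠j} |z_i − z_j|² = 1 and y_1 = z_1 = 0, and suppose that ||z_i − z_j| − |y_i − y_j|| < ε for all i ≠ j. Then there exists a Euclidean motion Φ_0 : x ↦ Tx + x_0 such that |z_i − Φ_0(y_i)| ≤ c_1 ε^{c_2} for each i = 1,...,k. If k ≤ D, then Φ_0 can be taken to be a proper Euclidean motion. -/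
open scoped BigOperators

open Matrix in
theorem qa_trace_sq {n : ℕ} (M : Matrix (Fin n) (Fin n) ℝ) (hM : Mᵀ = M) :
    (M * M).trace = ∑ i, ∑ j, M i j ^ 2 := by
  simp only [Matrix.trace, Matrix.diag, Matrix.mul_apply]
  refine Finset.sum_congr rfl fun i _ => Finset.sum_congr rfl fun j _ => ?_
  have : M j i = M i j := by rw [← Matrix.transpose_apply M, hM]
  rw [this]; ring

open Matrix in
theorem qa_key {D k : ℕ} (W Z : Matrix (Fin D) (Fin k) ℝ)
    (hs : (W * Zᵀ)ᵀ = W * Zᵀ) (hp : ∀ v : Fin D → ℝ, 0 ≤ v ⬝ᵥ ((W * Zᵀ) *ᵥ v)) (i : Fin k) :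
    (((W - Z)ᵀ * (W - Z)) i i) ^ 2 ≤ 2 * ∑ i, ∑ j, ((Wᵀ * W - Zᵀ * Z) i j) ^ 2 := by
  have hs' : Z * Wᵀ = W * Zᵀ := by rw [← hs]; simp
  obtain ⟨P, hP⟩ : ∃ P, P = W * Zᵀ := ⟨_, rfl⟩
  obtain ⟨A, hA⟩ : ∃ A, A = W * Wᵀ := ⟨_, rfl⟩
  obtain ⟨B, hB⟩ : ∃ B, B = Z * Zᵀ := ⟨_, rfl⟩
  obtain ⟨H, hH⟩ : ∃ H, H = W - Z := ⟨_, rfl⟩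
  rw [← hP] at hp
  have hHH : H * Hᵀ = A + B - 2 • P := by
    rw [hH, hA, hB, hP, transpose_sub, Matrix.sub_mul, Matrix.mul_sub, Matrix.mul_sub, hs']
    abel
  have e1 : ((Wᵀ * W - Zᵀ * Z) * (Wᵀ * W - Zᵀ * Z)).trace
      = (A * A).trace + (B * B).trace - 2 * (P * P).trace := by
    have a1 : (Wᵀ * W * (Wᵀ * W)).trace = (A * A).trace := by
      rw [hA, Matrix.mul_assoc, Matrix.trace_mul_comm]; simp only [Matrix.mul_assoc]
    have a2 : (Zᵀ * Z * (Zᵀ * Z)).trace = (B * B).trace := by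
      rw [hB, Matrix.mul_assoc, Matrix.trace_mul_comm]; simp only [Matrix.mul_assoc]
    have a3 : (Wᵀ * W * (Zᵀ * Z)).trace = (P * P).trace := by
      have : P * P = W * Zᵀ * (Z * Wᵀ) := by rw [hs', hP]
      rw [this, Matrix.mul_assoc, Matrix.trace_mul_comm]; simp only [Matrix.mul_assoc]
    have a4 : (Zᵀ * Z * (Wᵀ * W)).trace = (P * P).trace := by
      rw [Matrix.trace_mul_comm, a3]
    rw [Matrix.sub_mul, Matrix.mul_sub, Matrix.mul_sub]
    simp only [Matrix.trace_sub, a1, a2, a3, a4]; ring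
  have e2 : (Hᵀ * H * (Hᵀ * H)).trace = ((A + B - 2 • P) * (A + B - 2 • P)).trace := by
    rw [← hHH, Matrix.mul_assoc, Matrix.trace_mul_comm]; simp only [Matrix.mul_assoc]
  have e3 : 0 ≤ ((A + B - 2 • P) * P).trace := by
    have : ((A + B - 2 • P) * P).trace = ∑ j, (fun a => H a j) ⬝ᵥ (P *ᵥ (fun a => H a j)) := by
      rw [← hHH, Matrix.mul_assoc, Matrix.trace_mul_comm, Matrix.mul_assoc]
      simp only [Matrix.trace, Matrix.diag, Matrix.mul_apply, dotProduct, mulVec, transpose_apply]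
    rw [this]
    exact Finset.sum_nonneg fun j _ => hp _
  have e4 : 0 ≤ ((A - B) * (A - B)).trace := by
    rw [qa_trace_sq _ (by rw [hA, hB]; simp)]
    positivity
  have e5 := qa_trace_sq (Wᵀ * W - Zᵀ * Z) (by simp)
  have e6 := qa_trace_sq (Hᵀ * H) (by simp)
  have e7 : ((Hᵀ * H) i i) ^ 2 ≤ ∑ i, ∑ j, ((Hᵀ * H) i j) ^ 2 := by
    refine le_trans ?_ (Finset.single_le_sum (f := fun i => ∑ j, ((Hᵀ * H) i j) ^ 2)
      (fun _ _ => by positivity) (Finset.mem_univ i))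
    exact (Finset.single_le_sum (f := fun j => ((Hᵀ * H) i j) ^ 2)
      (fun _ _ => by positivity) (Finset.mem_univ i))
  rw [← hH]
  rw [← e5, e1]
  refine e7.trans ?_
  rw [← e6, e2]
  have c1 : (B * A).trace = (A * B).trace := Matrix.trace_mul_comm _ _
  have c2 : (P * A).trace = (A * P).trace := Matrix.trace_mul_comm _ _
  have c3 : (P * B).trace = (B * P).trace := Matrix.trace_mul_comm _ _
  simp only [Matrix.sub_mul, Matrix.mul_sub, Matrix.add_mul, Matrix.mul_add, Matrix.trace_sub,
    Matrix.trace_add, two_smul, c1, c2, c3] at e3 e4 ⊢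
  linarith

/-- Reflection matrix in the hyperplane orthogonal to `v`. -/
noncomputable def qaRefl {D : ℕ} (v : Fin D → ℝ) : Matrix (Fin D) (Fin D) ℝ :=
  1 - (2 / (v ⬝ᵥ v)) • Matrix.vecMulVec v v

open Matrix in
theorem qaRefl_orth {D : ℕ} (v : Fin D → ℝ) (hv : v ⬝ᵥ v ≠ 0) :
    qaRefl v ∈ Matrix.orthogonalGroup (Fin D) ℝ := by
  rw [Matrix.mem_orthogonalGroup_iff]
  have h1 : (qaRefl v)ᵀ = qaRefl v := by
    simp [qaRefl, Matrix.transpose_vecMulVec]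
  rw [h1, qaRefl]
  simp only [Matrix.sub_mul, Matrix.mul_sub, Matrix.one_mul, Matrix.mul_one, Matrix.smul_mul,
    Matrix.mul_smul, Matrix.vecMulVec_mul_vecMulVec]
  ext a b
  simp [Matrix.vecMulVec_apply]
  field_simp
  ring

open Matrix in
theorem qaRefl_trace {D : ℕ} (v : Fin D → ℝ) (P : Matrix (Fin D) (Fin D) ℝ) :
    (qaRefl v * P).trace = P.trace - (2 / (v ⬝ᵥ v)) * (v ⬝ᵥ (P *ᵥ v)) := by
  rw [qaRefl, Matrix.sub_mul, Matrix.one_mul, Matrix.trace_sub, Matrix.smul_mul, Matrix.trace_smul,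
    Matrix.vecMulVec_mul, Matrix.trace_vecMulVec, smul_eq_mul, dotProduct_comm v (v ᵥ* P),
    Matrix.dotProduct_mulVec]

open Matrix in
theorem qaRefl_det {D : ℕ} (v : Fin D → ℝ) (hv : v ⬝ᵥ v ≠ 0) : (qaRefl v).det = -1 := by
  have : qaRefl v = 1 + Matrix.vecMulVec (-(2 / (v ⬝ᵥ v)) • v) v := by
    rw [qaRefl, Matrix.smul_vecMulVec]; simp [sub_eq_add_neg]
  rw [this, Matrix.vecMulVec_eq Unit, Matrix.det_one_add_replicateCol_mul_replicateRow]
  simp; field_simp; norm_num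

open Matrix in
theorem qa_opt {D : ℕ} (P : Matrix (Fin D) (Fin D) ℝ)
    (h : ∀ R ∈ Matrix.orthogonalGroup (Fin D) ℝ, (R * P).trace ≤ P.trace) :
    Pᵀ = P ∧ ∀ v : Fin D → ℝ, 0 ≤ v ⬝ᵥ (P *ᵥ v) := by
  have hpos : ∀ v : Fin D → ℝ, 0 ≤ v ⬝ᵥ (P *ᵥ v) := by
    intro v
    by_cases hv : v ⬝ᵥ v = 0
    · have : v = 0 := by simpa using hv
      simp [this]
    have h1 := h _ (qaRefl_orth v hv)
    rw [qaRefl_trace] at h1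
    have h0 : 0 < v ⬝ᵥ v := lt_of_le_of_ne (by
      simp only [dotProduct]; exact Finset.sum_nonneg fun _ _ => mul_self_nonneg _) (Ne.symm hv)
    by_contra hc
    push Not at hc
    have : (2 / (v ⬝ᵥ v)) * (v ⬝ᵥ (P *ᵥ v)) < 0 := mul_neg_of_pos_of_neg (by positivity) hc
    linarith
  refine ⟨?_, hpos⟩
  have key : ∀ i j, i ≠ j → ∀ s : ℝ, s * (P i j - P j i) ≤ s ^ 2 * (P i i + P j j) := by
    intro i j hij s
    let u : Fin D → ℝ := Pi.single i 1
    let w : Fin D → ℝ := Pi.single j 1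
    let v := u + s • w
    have huu : u ⬝ᵥ u = 1 := by simp [u]
    have huw : u ⬝ᵥ w = 0 := by simp [u, w, hij]
    have hwu : w ⬝ᵥ u = 0 := by simp [u, w, hij.symm]
    have hww : w ⬝ᵥ w = 1 := by simp [w]
    have hvv : v ⬝ᵥ v = 1 + s ^ 2 := by
      simp only [v, add_dotProduct, dotProduct_add, smul_dotProduct, dotProduct_smul, huu, huw,
        hwu, hww, smul_eq_mul]; ring
    have hv0 : v ⬝ᵥ v ≠ 0 := by rw [hvv]; positivity
    have h1 := h _ (mul_mem (qaRefl_orth v hv0) (qaRefl_orth u (by rw [huu]; norm_num)))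
    rw [Matrix.mul_assoc, qaRefl_trace, qaRefl_trace, huu] at h1
    have h2 : v ⬝ᵥ ((qaRefl u * P) *ᵥ v) = v ⬝ᵥ (P *ᵥ v) - 2 * (v ⬝ᵥ u) * (u ⬝ᵥ (P *ᵥ v)) := by
      rw [qaRefl, huu, Matrix.sub_mul, Matrix.one_mul, Matrix.sub_mulVec, dotProduct_sub,
        Matrix.smul_mul, Matrix.smul_mulVec, dotProduct_smul, ← Matrix.mulVec_mulVec,
        Matrix.vecMulVec_mulVec]
      simp
      ring
    have hvu : v ⬝ᵥ u = 1 := by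
      simp only [v, add_dotProduct, smul_dotProduct, huu, hwu]; simp
    have puu : u ⬝ᵥ (P *ᵥ u) = P i i := by simp [u]
    have puw : u ⬝ᵥ (P *ᵥ w) = P i j := by simp [u, w]
    have pwu : w ⬝ᵥ (P *ᵥ u) = P j i := by simp [u, w]
    have pww : w ⬝ᵥ (P *ᵥ w) = P j j := by simp [w]
    have puv : u ⬝ᵥ (P *ᵥ v) = P i i + s * P i j := by
      simp only [v, Matrix.mulVec_add, Matrix.mulVec_smul, dotProduct_add, dotProduct_smul, puu,
        puw, smul_eq_mul]
    have pvv : v ⬝ᵥ (P *ᵥ v) = P i i + s * P i j + s * P j i + s ^ 2 * P j j := by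
      rw [show v ⬝ᵥ (P *ᵥ v) = u ⬝ᵥ (P *ᵥ v) + s * (w ⬝ᵥ (P *ᵥ v)) by
        conv_lhs => rw [show v = u + s • w from rfl, add_dotProduct, smul_dotProduct, smul_eq_mul],
        puv]
      simp only [v, Matrix.mulVec_add, Matrix.mulVec_smul, dotProduct_add, dotProduct_smul, pwu,
        pww, smul_eq_mul]
      ring
    rw [h2, hvu, puu, puv, pvv, hvv] at h1
    have h3 : 0 ≤ 2 * P i i + 2 / (1 + s ^ 2) *
      (P i i + s * P i j + s * P j i + s ^ 2 * P j j - 2 * 1 * (P i i + s * P i j)) := by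
      linarith
    have h4 := mul_nonneg (show (0:ℝ) ≤ 1 + s ^ 2 by positivity) h3
    have h5 : (1 + s ^ 2) * (2 * P i i + 2 / (1 + s ^ 2) *
      (P i i + s * P i j + s * P j i + s ^ 2 * P j j - 2 * 1 * (P i i + s * P i j)))
      = 2 * (s ^ 2 * (P i i + P j j) - s * (P i j - P j i)) := by
      field_simp; ring
    linarith
  have key2 : ∀ i j, i ≠ j → P i j ≤ P j i := by
    intro i j hij
    by_contra hc
    push Not at hc
    have hb : 0 ≤ P i i + P j j := by
      have := key i j hij 1
      have := key i j hij (-1)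
      linarith
    obtain ⟨b, hbd⟩ : ∃ b, b = P i i + P j j := ⟨_, rfl⟩
    obtain ⟨a, had⟩ : ∃ a, a = P i j - P j i := ⟨_, rfl⟩
    have ha : 0 < a := by linarith
    have := key i j hij (a / (b + 1))
    rw [← hbd, ← had] at this
    rw [← hbd] at hb
    have h6 : a / (b + 1) * a - (a / (b + 1)) ^ 2 * b = a ^ 2 / (b + 1) ^ 2 := by
      field_simp; ring
    have : 0 < a ^ 2 / (b + 1) ^ 2 := by positivity
    linarith
  ext i j
  rw [Matrix.transpose_apply]
  by_cases hij : i = j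
  · rw [hij]
  · exact le_antisymm (key2 j i (Ne.symm hij)) (key2 i j hij)

open Matrix in
theorem qa_exists_max {D : ℕ} (M : Matrix (Fin D) (Fin D) ℝ) :
    ∃ T ∈ Matrix.orthogonalGroup (Fin D) ℝ, ∀ R ∈ Matrix.orthogonalGroup (Fin D) ℝ,
      (R * M).trace ≤ (T * M).trace := by
  have hc : IsCompact ((Matrix.orthogonalGroup (Fin D) ℝ : Set (Matrix (Fin D) (Fin D) ℝ))) := by
    have hsub : ((Matrix.orthogonalGroup (Fin D) ℝ : Set (Matrix (Fin D) (Fin D) ℝ))) ⊆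
        Set.pi Set.univ (fun _ : Fin D => Set.pi Set.univ (fun _ : Fin D => Set.Icc (-1:ℝ) 1)) := by
      intro T hT i _ j _
      have := entry_norm_bound_of_unitary (𝕜 := ℝ) hT i j
      rw [Real.norm_eq_abs, abs_le] at this
      exact this
    refine IsCompact.of_isClosed_subset
      (isCompact_univ_pi fun _ => isCompact_univ_pi fun _ => isCompact_Icc) ?_ hsub
    have : ((Matrix.orthogonalGroup (Fin D) ℝ : Set (Matrix (Fin D) (Fin D) ℝ)))
        = {T | T * star T = 1} := by
      ext T; exact Matrix.mem_orthogonalGroup_iff (Fin D) ℝ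
    rw [this]
    refine isClosed_eq ?_ continuous_const
    exact continuous_id.matrix_mul (continuous_id.matrix_conjTranspose)
  obtain ⟨T, hT, hmax⟩ := hc.exists_isMaxOn ⟨1, one_mem _⟩
    (f := fun R : Matrix (Fin D) (Fin D) ℝ => (R * M).trace)
    ((continuous_id.matrix_mul continuous_const).matrix_trace).continuousOn
  exact ⟨T, hT, fun R hR => hmax hR⟩

theorem qa_sq_diff {a b ε : ℝ} (ha : 0 ≤ a) (ha1 : a ≤ 1) (hb : 0 ≤ b) (hb1 : b ≤ 1)
    (h : |a - b| ≤ ε) : |a ^ 2 - b ^ 2| ≤ 2 * ε := by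
  have : a ^ 2 - b ^ 2 = (a + b) * (a - b) := by ring
  rw [this, abs_mul, abs_of_nonneg (by linarith : 0 ≤ a + b)]
  exact mul_le_mul (by linarith) h (abs_nonneg _) (by norm_num)

open Matrix in
/-- A nonzero vector orthogonal to all points, when `k ≤ D` and one of the points is zero. -/
theorem qa_exists_perp {D k : ℕ} (hkD : k ≤ D) (y : Fin k → Fin D → ℝ) (i₀ : Fin k)
    (h0 : y i₀ = 0) : ∃ v : Fin D → ℝ, v ≠ 0 ∧ ∀ i, v ⬝ᵥ y i = 0 := by
  let N : Matrix {i : Fin k // i ≠ i₀} (Fin D) ℝ := fun i => y i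
  have hlt : Module.finrank ℝ ({i : Fin k // i ≠ i₀} → ℝ) < Module.finrank ℝ (Fin D → ℝ) := by
    have : Fintype.card {i : Fin k // i ≠ i₀} = k - 1 := by
      simp
    have := i₀.pos
    simp only [Module.finrank_fintype_fun_eq_card, Fintype.card_fin]
    omega
  have hker := LinearMap.ker_ne_bot_of_finrank_lt (f := N.mulVecLin) hlt
  obtain ⟨v, hv, hv0⟩ := Submodule.exists_mem_ne_zero_of_ne_bot hker
  refine ⟨v, hv0, fun i => ?_⟩
  by_cases hi : i = i₀
  · rw [hi, h0]; simp
  · have := congrFun (show N *ᵥ v = 0 from hv) ⟨i, hi⟩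
    rw [dotProduct_comm]
    exact this

open Matrix in
theorem qa_inner {D : ℕ} (a b : EuclideanSpace ℝ (Fin D)) :
    ∑ x, a x * b x = (‖a‖ ^ 2 + ‖b‖ ^ 2 - dist a b ^ 2) / 2 := by
  rw [EuclideanSpace.dist_eq, Real.sq_sqrt (by positivity), EuclideanSpace.norm_sq_eq,
    EuclideanSpace.norm_sq_eq, ← Finset.sum_add_distrib, ← Finset.sum_sub_distrib, Finset.sum_div]
  refine Finset.sum_congr rfl fun x _ => ?_
  rw [Real.dist_eq, sq_abs, Real.norm_eq_abs, Real.norm_eq_abs, sq_abs, sq_abs]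
  ring

open Matrix in
/-- Quantitative version of the alignment theorem: with the normalization
`Σ_{i≠j} |y_i−y_j|² + Σ_{i≠j} |z_i−z_j|² = 1`, `y_1 = z_1 = 0`, and pairwise distance
defects `< ε`, a Euclidean motion aligns the configurations to within `c₁ ε^{c₂}`;
proper if `k ≤ D`. -/
theorem quantitative_alignment
    (D k : ℕ) (hD : 2 ≤ D) (hk : 1 ≤ k) :
    ∃ c₁ > (0 : ℝ), ∃ c₂ > (0 : ℝ), ∃ ε₀ > (0 : ℝ), ∀ ε : ℝ, 0 < ε → ε < ε₀ →
      ∀ y z : Fin k → EuclideanSpace ℝ (Fin D),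
        Function.Injective y → Function.Injective z →
        y ⟨0, hk⟩ = 0 → z ⟨0, hk⟩ = 0 →
        ((∑ p ∈ Finset.univ.offDiag, dist (y p.1) (y p.2) ^ 2) +
          ∑ p ∈ Finset.univ.offDiag, dist (z p.1) (z p.2) ^ 2) = 1 →
        (∀ i j, i ≠ j → |dist (z i) (z j) - dist (y i) (y j)| < ε) →
        ∃ (T : Matrix (Fin D) (Fin D) ℝ) (x₀ : EuclideanSpace ℝ (Fin D)),
          T ∈ Matrix.orthogonalGroup (Fin D) ℝ ∧
          (∀ i, dist (z i) (Matrix.toEuclideanLin T (y i) + x₀) ≤ c₁ * ε ^ c₂) ∧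
          (k ≤ D → T.det = 1) := by
  have hk0 : (1 : ℝ) ≤ k := by exact_mod_cast hk
  refine ⟨5 * k, by positivity, 1 / 2, by norm_num, 1, by norm_num, ?_⟩
  intro ε hε _ y z _ _ hy0 hz0 hsum hd
  -- distances are at most one
  have hdy : ∀ i j, dist (y i) (y j) ≤ 1 := by
    intro i j
    by_cases hij : i = j
    · simp [hij]
    have h1 := Finset.single_le_sum (f := fun p : Fin k × Fin k => dist (y p.1) (y p.2) ^ 2)
      (s := Finset.univ.offDiag) (fun _ _ => by positivity) (a := (i, j)) (by simp [hij])
    have h2 : 0 ≤ ∑ p ∈ (Finset.univ : Finset (Fin k)).offDiag, dist (z p.1) (z p.2) ^ 2 := by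
      positivity
    have h3 : dist (y i) (y j) ^ 2 ≤ 1 := by simp only at h1; linarith
    exact (sq_le_one_iff₀ dist_nonneg).1 h3
  have hdz : ∀ i j, dist (z i) (z j) ≤ 1 := by
    intro i j
    by_cases hij : i = j
    · simp [hij]
    have h1 := Finset.single_le_sum (f := fun p : Fin k × Fin k => dist (z p.1) (z p.2) ^ 2)
      (s := Finset.univ.offDiag) (fun _ _ => by positivity) (a := (i, j)) (by simp [hij])
    have h2 : 0 ≤ ∑ p ∈ (Finset.univ : Finset (Fin k)).offDiag, dist (y p.1) (y p.2) ^ 2 := by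
      positivity
    have h3 : dist (z i) (z j) ^ 2 ≤ 1 := by simp only at h1; linarith
    exact (sq_le_one_iff₀ dist_nonneg).1 h3
  have hsq : ∀ i j, |dist (y i) (y j) ^ 2 - dist (z i) (z j) ^ 2| ≤ 2 * ε := by
    intro i j
    refine qa_sq_diff dist_nonneg (hdy i j) dist_nonneg (hdz i j) ?_
    by_cases hij : i = j
    · simp [hij, hε.le]
    · rw [abs_sub_comm]; exact (hd i j hij).le
  have hny : ∀ i, ‖y i‖ = dist (y i) (y ⟨0, hk⟩) := fun i => by rw [hy0, dist_zero_right]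
  have hnz : ∀ i, ‖z i‖ = dist (z i) (z ⟨0, hk⟩) := fun i => by rw [hz0, dist_zero_right]
  obtain ⟨Y, hY⟩ : ∃ Y : Matrix (Fin D) (Fin k) ℝ, ∀ a i, Y a i = y i a :=
    ⟨fun a i => y i a, fun _ _ => rfl⟩
  obtain ⟨Z, hZ⟩ : ∃ Z : Matrix (Fin D) (Fin k) ℝ, ∀ a i, Z a i = z i a :=
    ⟨fun a i => z i a, fun _ _ => rfl⟩
  have hgram : ∀ i j, |(Yᵀ * Y - Zᵀ * Z) i j| ≤ 3 * ε := by
    intro i j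
    have e1 : (Yᵀ * Y - Zᵀ * Z) i j = ∑ x, y i x * y j x - ∑ x, z i x * z j x := by
      simp [Matrix.mul_apply, hY, hZ]
    rw [e1, qa_inner, qa_inner, hny, hny, hnz, hnz]
    have a1 := abs_le.1 (hsq i ⟨0, hk⟩)
    have a2 := abs_le.1 (hsq j ⟨0, hk⟩)
    have a3 := abs_le.1 (hsq i j)
    rw [abs_le]
    constructor <;> linarith [a1.1, a1.2, a2.1, a2.2, a3.1, a3.2]
  obtain ⟨T, hT, hmax⟩ := qa_exists_max (Y * Zᵀ)
  have hTT : Tᵀ * T = 1 := by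
    have := (Matrix.mem_orthogonalGroup_iff' (Fin D) ℝ).1 hT
    simpa [Matrix.star_eq_conjTranspose, Matrix.conjTranspose_eq_transpose_of_trivial] using this
  obtain ⟨hs, hp⟩ := qa_opt (T * Y * Zᵀ) (by
    intro R hR
    have := hmax (R * T) (mul_mem hR hT)
    simpa only [Matrix.mul_assoc] using this)
  have hfin : ∀ i, dist (z i) (Matrix.toEuclideanLin T (y i)) ≤ 5 * k * ε ^ (1 / 2 : ℝ) := by
    intro i
    have h1 := qa_key (T * Y) Z hs hp i
    have hWW : (T * Y)ᵀ * (T * Y) = Yᵀ * Y := by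
      rw [Matrix.transpose_mul, Matrix.mul_assoc, ← Matrix.mul_assoc Tᵀ, hTT, Matrix.one_mul]
    rw [hWW] at h1
    have h2 : ((T * Y - Z)ᵀ * (T * Y - Z)) i i
        = dist (z i) (Matrix.toEuclideanLin T (y i)) ^ 2 := by
      rw [EuclideanSpace.dist_eq, Real.sq_sqrt (by positivity), Matrix.mul_apply]
      refine Finset.sum_congr rfl fun x _ => ?_
      rw [Real.dist_eq, sq_abs]
      have : (Matrix.toEuclideanLin T (y i)) x = (T * Y) x i := by
        simp [Matrix.mul_apply, Matrix.mulVec, dotProduct, hY]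
      rw [this]
      simp only [Matrix.transpose_apply, Matrix.sub_apply, hZ]
      ring
    rw [h2] at h1
    have h3 : ∑ i, ∑ j, ((Yᵀ * Y - Zᵀ * Z) i j) ^ 2 ≤ ∑ _i : Fin k, ∑ _j : Fin k, (3 * ε) ^ 2 :=
      Finset.sum_le_sum fun i _ => Finset.sum_le_sum fun j _ =>
        sq_le_sq' (abs_le.1 (hgram i j)).1 (abs_le.1 (hgram i j)).2
    simp only [Finset.sum_const, Finset.card_univ, Fintype.card_fin, nsmul_eq_mul] at h3
    have h4 : (ε ^ (1 / 2 : ℝ)) ^ 2 = ε := by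
      rw [← Real.sqrt_eq_rpow, Real.sq_sqrt hε.le]
    refine (sq_le_sq₀ (by positivity) (by positivity)).1 ?_
    refine (sq_le_sq₀ (by positivity) (by positivity)).1 ?_
    rw [mul_pow, h4]
    have hk2 : (1 : ℝ) ≤ (k : ℝ) ^ 2 := one_le_pow₀ hk0
    have : 18 * ((k:ℝ) ^ 2 * ε ^ 2) ≤ ((5 * (k:ℝ)) ^ 2 * ε) ^ 2 := by
      have : ((5 * (k:ℝ)) ^ 2 * ε) ^ 2 = 625 * (k:ℝ) ^ 2 * ((k:ℝ) ^ 2 * ε ^ 2) := by ring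
      rw [this]
      exact mul_le_mul_of_nonneg_right (by linarith) (by positivity)
    nlinarith
  by_cases hc : k ≤ D ∧ T.det ≠ 1
  · obtain ⟨v, hv0, hv⟩ := qa_exists_perp hc.1 (fun i => (y i : Fin D → ℝ)) ⟨0, hk⟩ (by
      rw [hy0]; rfl)
    have hvv : v ⬝ᵥ v ≠ 0 := by simpa using hv0
    refine ⟨T * qaRefl v, 0, mul_mem hT (qaRefl_orth v hvv), ?_, fun _ => ?_⟩
    · intro i
      have : Matrix.toEuclideanLin (T * qaRefl v) (y i) = Matrix.toEuclideanLin T (y i) := by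
        have h1 : qaRefl v *ᵥ (y i : Fin D → ℝ) = (y i : Fin D → ℝ) := by
          rw [qaRefl, Matrix.sub_mulVec, Matrix.one_mulVec, Matrix.smul_mulVec,
            Matrix.vecMulVec_mulVec, hv i]
          simp
        rw [Matrix.toLpLin_apply, Matrix.toLpLin_apply, ← Matrix.mulVec_mulVec, h1]
      rw [add_zero, this]
      exact hfin i
    · have h1 : T.det * T.det = 1 := by
        have := congrArg Matrix.det hTT
        rwa [Matrix.det_mul, Matrix.det_transpose, Matrix.det_one] at this
      have h2 : T.det = -1 := (mul_self_eq_one_iff.1 h1).resolve_left hc.2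
      rw [Matrix.det_mul, qaRefl_det v hvv, h2]; norm_num
  · refine ⟨T, 0, hT, fun i => by rw [add_zero]; exact hfin i, fun h => ?_⟩
    by_contra hne
    exact hc ⟨h, hne⟩
end

section
/- Let D ≥ 2, let 1 ≤ k ≤ D, and let ε > 0 be small enough (less than a constant depending only on D). Then there exists δ > 0 depending on ε, k, D such that the following holds: if y_1,...,y_k and z_1,...,z_k are two k-point configurations in ℝ^D satisfying (1+δ)^{-1} ≤ |z_i − z_j|/|y_i − y_j| ≤ 1+δ for all 1 ≤ i, j ≤ k with i ≠ j, then there exists a smooth bijection Φ : ℝ^D → ℝ^D with smooth inverse satisfying (1+ε)^{-1}|x − y| ≤ |Φ(x) − Φ(y)| ≤ (1+ε)|x − y| for all x, y ∈ ℝ^D, and Φ(y_i) = z_i for 1 ≤ i ≤ k. -/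
section BE
open scoped InnerProductSpace
variable {E : Type*} [NormedAddCommGroup E] [InnerProductSpace ℝ E]

/-- A smooth diffeomorphism with distortion at most `L`. -/
def BEGood (L : ℝ) (Φ : E → E) : Prop :=
  ContDiff ℝ (⊤ : ℕ∞) Φ ∧
  (∃ Ψ : E → E, ContDiff ℝ (⊤ : ℕ∞) Ψ ∧ Function.LeftInverse Ψ Φ ∧ Function.RightInverse Ψ Φ) ∧
  ∀ x y, L⁻¹ * dist x y ≤ dist (Φ x) (Φ y) ∧ dist (Φ x) (Φ y) ≤ L * dist x y

theorem BEGood.id : BEGood (E := E) 1 (fun x => x) :=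
  ⟨contDiff_id, ⟨fun x => x, contDiff_id, fun _ => rfl, fun _ => rfl⟩, fun x y => by simp⟩

theorem BEGood.mono {L L' : ℝ} (h1 : 0 < L) (h : L ≤ L') {Φ : E → E} (hΦ : BEGood L Φ) :
    BEGood L' Φ := by
  refine ⟨hΦ.1, hΦ.2.1, fun x y => ?_⟩
  obtain ⟨h3, h4⟩ := hΦ.2.2 x y
  constructor
  · refine le_trans ?_ h3
    gcongr
  · refine h4.trans ?_
    gcongr

theorem BEGood.comp {L L' : ℝ} (h1 : 0 < L) (h2 : 0 < L') {Φ Φ' : E → E}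
    (h : BEGood L Φ) (h' : BEGood L' Φ') : BEGood (L * L') (fun x => Φ (Φ' x)) := by
  obtain ⟨hs, ⟨Ψ, hΨ, hl, hr⟩, hd⟩ := h
  obtain ⟨hs', ⟨Ψ', hΨ', hl', hr'⟩, hd'⟩ := h'
  refine ⟨hs.comp hs', ⟨fun x => Ψ' (Ψ x), hΨ'.comp hΨ, fun x => ?_, fun x => ?_⟩, fun x y => ?_⟩
  · simp only [hl (Φ' x), hl' x]
  · simp only [hr' (Ψ x), hr x]
  · obtain ⟨a1, a2⟩ := hd (Φ' x) (Φ' y)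
    obtain ⟨b1, b2⟩ := hd' x y
    constructor
    · rw [mul_inv, mul_assoc]
      refine le_trans ?_ a1
      gcongr
    · rw [mul_assoc]
      refine a2.trans ?_
      gcongr

/-- Reflection in the hyperplane orthogonal to a unit vector. -/
noncomputable def berf (n z : E) : E := z - (2 * ⟪n, z⟫_ℝ) • n

theorem berf_sub (n x y : E) : berf n (x - y) = berf n x - berf n y := by
  simp only [berf, inner_sub_right]
  module

theorem berf_norm {n : E} (hn : ‖n‖ = 1) (z : E) : ‖berf n z‖ = ‖z‖ := by
  have h : ‖berf n z‖ ^ 2 = ‖z‖ ^ 2 := by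
    rw [berf, norm_sub_sq_real, norm_smul, inner_smul_right, real_inner_comm, hn, Real.norm_eq_abs,
      mul_one, sq_abs]
    ring
  exact (sq_eq_sq₀ (norm_nonneg _) (norm_nonneg _)).1 h

theorem berf_berf {n : E} (hn : ‖n‖ = 1) (z : E) : berf n (berf n z) = z := by
  simp only [berf, inner_sub_right, inner_smul_right, real_inner_self_eq_norm_sq, hn]
  module

theorem berf_of_orth {n z : E} (h : ⟪n, z⟫_ℝ = 0) : berf n z = z := by
  simp [berf, h]

theorem berf_neg (n z : E) : berf (-n) z = berf n z := by
  simp [berf]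

theorem berf_lip {n n' : E} (hn : ‖n‖ = 1) (hn' : ‖n'‖ = 1) (z : E) :
    ‖berf n z - berf n' z‖ ≤ 4 * ‖n - n'‖ * ‖z‖ := by
  have : berf n z - berf n' z = -((2 * ⟪n - n', z⟫_ℝ) • n + (2 * ⟪n', z⟫_ℝ) • (n - n')) := by
    simp only [berf, inner_sub_left]
    module
  rw [this, norm_neg]
  refine (norm_add_le _ _).trans ?_
  rw [norm_smul, norm_smul, hn, norm_mul, norm_mul]
  have h1 := norm_inner_le_norm (𝕜 := ℝ) (n - n') z
  have h2 := norm_inner_le_norm (𝕜 := ℝ) n' z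
  rw [hn', one_mul] at h2
  simp only [Real.norm_ofNat, mul_one]
  have := mul_le_mul_of_nonneg_right h2 (norm_nonneg (n - n'))
  nlinarith

/-- path of unit vectors -/
noncomputable def bepath (w u : E) (t : ℝ) : E :=
  ‖w + t • (u - w)‖⁻¹ • (w + t • (u - w))

theorem bepath_aux {w u : E} (hw : ‖w‖ = 1) (hu : ‖u‖ = 1) (h : 0 ≤ ⟪w, u⟫_ℝ) {t : ℝ}
    (h0 : 0 ≤ t) (h1 : t ≤ 1) : 1 / 2 ≤ ‖w + t • (u - w)‖ := by
  have e : ‖w + t • (u - w)‖ ^ 2 = (1 - t) ^ 2 + t ^ 2 + 2 * t * (1 - t) * ⟪w, u⟫_ℝ := by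
    have : w + t • (u - w) = (1 - t) • w + t • u := by module
    rw [this, norm_add_sq_real, norm_smul, norm_smul, inner_smul_left, inner_smul_right, hw, hu]
    simp only [Real.norm_eq_abs, mul_one, sq_abs, conj_trivial]
    ring
  have h2 : 0 ≤ 2 * t * (1 - t) * ⟪w, u⟫_ℝ := by
    have : 0 ≤ 1 - t := by linarith
    positivity
  nlinarith [norm_nonneg (w + t • (u - w)), sq_nonneg (2 * t - 1)]

theorem bepath_norm {w u : E} (hw : ‖w‖ = 1) (hu : ‖u‖ = 1) (h : 0 ≤ ⟪w, u⟫_ℝ) {t : ℝ}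
    (h0 : 0 ≤ t) (h1 : t ≤ 1) : ‖bepath w u t‖ = 1 := by
  have := bepath_aux hw hu h h0 h1
  rw [bepath, norm_smul, norm_inv, norm_norm, inv_mul_cancel₀]
  linarith

theorem bepath_lip {w u : E} (hw : ‖w‖ = 1) (hu : ‖u‖ = 1) (h : 0 ≤ ⟪w, u⟫_ℝ) {t t' : ℝ}
    (h0 : 0 ≤ t) (h1 : t ≤ 1) (h0' : 0 ≤ t') (h1' : t' ≤ 1) :
    ‖bepath w u t - bepath w u t'‖ ≤ 8 * |t - t'| := by
  have A := bepath_aux hw hu h h0 h1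
  have A' := bepath_aux hw hu h h0' h1'
  have e : (w + t • (u - w)) - (w + t' • (u - w)) = (t - t') • (u - w) := by module
  have hv : ‖(w + t • (u - w)) - (w + t' • (u - w))‖ ≤ 2 * |t - t'| := by
    rw [e, norm_smul, Real.norm_eq_abs]
    have : ‖u - w‖ ≤ 2 := (norm_sub_le _ _).trans (by rw [hw, hu]; norm_num)
    nlinarith [abs_nonneg (t - t')]
  unfold bepath
  generalize w + t • (u - w) = v at *
  generalize w + t' • (u - w) = v' at *
  have hp : 0 < ‖v‖ := by linarith
  have hp' : 0 < ‖v'‖ := by linarith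
  have : ‖v‖⁻¹ • v - ‖v'‖⁻¹ • v' = ‖v‖⁻¹ • ((v - v') + ((‖v'‖ - ‖v‖) * ‖v'‖⁻¹) • v') := by
    rw [smul_add, smul_smul, smul_sub]
    have : ‖v‖⁻¹ * ((‖v'‖ - ‖v‖) * ‖v'‖⁻¹) = ‖v‖⁻¹ - ‖v'‖⁻¹ := by
      field_simp
    rw [this]
    module
  rw [this, norm_smul, norm_inv, norm_norm]
  have h3 : ‖(v - v') + ((‖v'‖ - ‖v‖) * ‖v'‖⁻¹) • v'‖ ≤ 2 * ‖v - v'‖ := by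
    refine (norm_add_le _ _).trans ?_
    rw [norm_smul, norm_mul, norm_inv, norm_norm, mul_assoc, inv_mul_cancel₀ hp'.ne', mul_one,
      Real.norm_eq_abs]
    have := abs_norm_sub_norm_le v' v
    rw [norm_sub_rev v' v] at this
    linarith
  have h4 : ‖v‖⁻¹ ≤ 2 := by
    rw [inv_le_comm₀ hp (by norm_num)]
    linarith
  calc _ ≤ 2 * (2 * ‖v - v'‖) := by gcongr
    _ ≤ _ := by linarith

theorem be_smoothTransition_lip : ∃ C : ℝ, 0 < C ∧
    ∀ x y : ℝ, |Real.smoothTransition x - Real.smoothTransition y| ≤ C * |x - y| := by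
  have h : ContDiffOn ℝ 1 Real.smoothTransition (Set.Icc 0 1) :=
    (Real.smoothTransition.contDiff (n := 1)).contDiffOn
  obtain ⟨K, hK⟩ := h.exists_lipschitzOnWith one_ne_zero (convex_Icc 0 1) isCompact_Icc
  refine ⟨K + 1, by positivity, fun x y => ?_⟩
  have h1 := hK.dist_le_mul _ (Set.projIcc (0:ℝ) 1 zero_le_one x).2 _
    (Set.projIcc (0:ℝ) 1 zero_le_one y).2
  rw [Real.smoothTransition.projIcc, Real.smoothTransition.projIcc, Real.dist_eq] at h1
  refine h1.trans ?_
  have h2 : dist (Set.projIcc (0:ℝ) 1 zero_le_one x : ℝ) (Set.projIcc (0:ℝ) 1 zero_le_one y) ≤ |x - y| :=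
    Set.abs_projIcc_sub_projIcc zero_le_one
  have : (0:ℝ) ≤ K := K.2
  nlinarith [abs_nonneg (x - y)]

/-- the cutoff function. -/
noncomputable def becut (r M : ℝ) (x : E) : ℝ :=
  Real.smoothTransition (1 + (Real.log 2 - Real.log (1 + ‖x‖ ^ 2 / r ^ 2)) / M)

theorem becut_smooth (r M : ℝ) : ContDiff ℝ (⊤ : ℕ∞) (becut r M : E → ℝ) := by
  unfold becut
  refine Real.smoothTransition.contDiff.comp ?_
  refine contDiff_const.add (ContDiff.div_const (contDiff_const.sub (ContDiff.log ?_ ?_)) _)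
  · exact contDiff_const.add ((contDiff_norm_sq ℝ).div_const _)
  · intro x
    positivity

theorem belog_lip {r : ℝ} (hr : 0 < r) {s t : ℝ} (hs : 0 ≤ s) (hst : s ≤ t) :
    |Real.log (1 + t ^ 2 / r ^ 2) - Real.log (1 + s ^ 2 / r ^ 2)| * s ≤ 2 * (t - s) := by
  rcases hs.eq_or_lt with rfl | hs
  · simp; linarith
  have ht : 0 < t := by linarith
  have h1 : Real.log (1 + s ^ 2 / r ^ 2) ≤ Real.log (1 + t ^ 2 / r ^ 2) := by
    apply Real.log_le_log (by positivity)
    gcongr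
  rw [abs_of_nonneg (by linarith)]
  have h2 : Real.log (1 + t ^ 2 / r ^ 2) - Real.log (1 + s ^ 2 / r ^ 2) ≤ 2 * (t / s - 1) := by
    rw [← Real.log_div (by positivity) (by positivity)]
    calc _ ≤ Real.log ((t / s) ^ 2) := by
          apply Real.log_le_log (by positivity)
          rw [div_le_iff₀ (by positivity), div_pow]
          have : t ^ 2 / s ^ 2 * (1 + s ^ 2 / r ^ 2) = t ^ 2 / s ^ 2 + t ^ 2 / r ^ 2 := by
            field_simp
          rw [this]
          have : 1 ≤ t ^ 2 / s ^ 2 := by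
            rw [one_le_div (by positivity)]
            gcongr
          linarith
      _ = 2 * Real.log (t / s) := by
          rw [Real.log_pow]; norm_num
      _ ≤ _ := by
          have := Real.log_le_sub_one_of_pos (show 0 < t / s by positivity)
          linarith
  calc _ ≤ 2 * (t / s - 1) * s := by gcongr
    _ = _ := by field_simp

theorem becut_norm {r M : ℝ} {x y : E} (h : ‖x‖ = ‖y‖) : becut r M x = becut r M y := by
  simp [becut, h]

theorem becut_one {r M : ℝ} (hr : 0 < r) (hM : 1 ≤ M) {x : E} (h : ‖x‖ ≤ r) : becut r M x = 1 := by
  apply Real.smoothTransition.one_of_one_le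
  have : Real.log (1 + ‖x‖ ^ 2 / r ^ 2) ≤ Real.log 2 := by
    apply Real.log_le_log (by positivity)
    have : ‖x‖ ^ 2 / r ^ 2 ≤ 1 := by
      rw [div_le_one (by positivity)]
      gcongr
    linarith
  have : 0 ≤ (Real.log 2 - Real.log (1 + ‖x‖ ^ 2 / r ^ 2)) / M :=
    div_nonneg (by linarith) (by linarith)
  linarith

theorem becut_zero {r M : ℝ} (hr : 0 < r) (hM : 1 ≤ M) {x : E} (h : Real.exp M * r ≤ ‖x‖) :
    becut r M x = 0 := by
  apply Real.smoothTransition.zero_of_nonpos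
  have : Real.log 2 + M ≤ Real.log (1 + ‖x‖ ^ 2 / r ^ 2) := by
    have hlog : Real.log 2 + M = Real.log (2 * Real.exp M) := by
      rw [Real.log_mul (by norm_num) (Real.exp_pos _).ne', Real.log_exp M]
    rw [hlog]
    apply Real.log_le_log (by positivity)
    have : Real.exp M ^ 2 ≤ ‖x‖ ^ 2 / r ^ 2 := by
      rw [le_div_iff₀ (by positivity), ← mul_pow]
      gcongr
    nlinarith [sq_nonneg (Real.exp M - 1)]
  have : (Real.log 2 - Real.log (1 + ‖x‖ ^ 2 / r ^ 2)) / M ≤ -1 := by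
    rw [div_le_iff₀ (by linarith)]
    linarith
  linarith

theorem becut_mem {r M : ℝ} (x : E) : 0 ≤ becut r M x ∧ becut r M x ≤ 1 :=
  ⟨Real.smoothTransition.nonneg _, Real.smoothTransition.le_one _⟩

theorem becut_lip {C : ℝ} (hC : ∀ x y : ℝ, |Real.smoothTransition x - Real.smoothTransition y| ≤ C * |x - y|)
    (hC0 : 0 < C) {r M : ℝ} (hr : 0 < r) (hM : 1 ≤ M) {x y : E} (h : ‖y‖ ≤ ‖x‖) :
    |becut r M x - becut r M y| * ‖y‖ ≤ 2 * C / M * ‖x - y‖ := by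
  have h1 := hC (1 + (Real.log 2 - Real.log (1 + ‖x‖ ^ 2 / r ^ 2)) / M)
    (1 + (Real.log 2 - Real.log (1 + ‖y‖ ^ 2 / r ^ 2)) / M)
  have e : (1 + (Real.log 2 - Real.log (1 + ‖x‖ ^ 2 / r ^ 2)) / M) -
    (1 + (Real.log 2 - Real.log (1 + ‖y‖ ^ 2 / r ^ 2)) / M) =
    -(Real.log (1 + ‖x‖ ^ 2 / r ^ 2) - Real.log (1 + ‖y‖ ^ 2 / r ^ 2)) / M := by ring
  rw [e, abs_div, abs_neg, abs_of_pos (show 0 < M by linarith)] at h1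
  have h2 := belog_lip hr (norm_nonneg y) h
  have h3 : ‖x‖ - ‖y‖ ≤ ‖x - y‖ := norm_sub_norm_le x y
  have hM0 : 0 < M := by linarith
  calc _ ≤ C * (|Real.log (1 + ‖x‖ ^ 2 / r ^ 2) - Real.log (1 + ‖y‖ ^ 2 / r ^ 2)| / M) * ‖y‖ := by
        unfold becut
        gcongr
    _ = C / M * (|Real.log (1 + ‖x‖ ^ 2 / r ^ 2) - Real.log (1 + ‖y‖ ^ 2 / r ^ 2)| * ‖y‖) := by ring
    _ ≤ C / M * (2 * (‖x - y‖)) := by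
        have : 0 < C / M := by positivity
        exact mul_le_mul_of_nonneg_left (by linarith) this.le
    _ = _ := by ring

/-- slow twist at the origin -/
noncomputable def betw (w u : E) (r M : ℝ) (x : E) : E :=
  berf (bepath w u (becut r M x)) (berf w x)

noncomputable def betw' (w u : E) (r M : ℝ) (x : E) : E :=
  berf w (berf (bepath w u (becut r M x)) x)

theorem bepath_smooth {w u : E} (hw : ‖w‖ = 1) (hu : ‖u‖ = 1) (h : 0 ≤ ⟪w, u⟫_ℝ) (r M : ℝ) :
    ContDiff ℝ (⊤ : ℕ∞) (fun x : E => bepath w u (becut r M x)) := by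
  have hv : ContDiff ℝ (⊤ : ℕ∞) (fun x : E => w + (becut r M x) • (u - w)) :=
    contDiff_const.add ((becut_smooth r M).smul contDiff_const)
  have hne : ∀ x : E, w + (becut r M x) • (u - w) ≠ 0 := fun x => by
    have := bepath_aux hw hu h (becut_mem (r := r) (M := M) x).1 (becut_mem x).2
    rw [← norm_pos_iff]
    linarith
  unfold bepath
  exact (ContDiff.inv (hv.norm ℝ hne) (fun x => (norm_pos_iff.2 (hne x)).ne')).smul hv

theorem berf_smooth {f g : E → E} (hf : ContDiff ℝ (⊤ : ℕ∞) f) (hg : ContDiff ℝ (⊤ : ℕ∞) g) :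
    ContDiff ℝ (⊤ : ℕ∞) (fun x => berf (f x) (g x)) := by
  unfold berf
  exact hg.sub ((contDiff_const.mul (hf.inner ℝ hg)).smul hf)

theorem betw_lip {C : ℝ} (hC : ∀ x y : ℝ, |Real.smoothTransition x - Real.smoothTransition y| ≤ C * |x - y|)
    (hC0 : 0 < C) {r M : ℝ} (hr : 0 < r) (hM : 1 ≤ M)
    {w u : E} (hw : ‖w‖ = 1) (hu : ‖u‖ = 1) (h : 0 ≤ ⟪w, u⟫_ℝ) {x y : E} (hxy : ‖y‖ ≤ ‖x‖) :
    |‖betw w u r M x - betw w u r M y‖ - ‖x - y‖| ≤ 64 * C / M * ‖x - y‖ := by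
  have mx := becut_mem (r := r) (M := M) x
  have my := becut_mem (r := r) (M := M) y
  have nx := bepath_norm hw hu h mx.1 mx.2
  have ny := bepath_norm hw hu h my.1 my.2
  have e : betw w u r M x - betw w u r M y =
      berf (bepath w u (becut r M x)) (berf w (x - y)) +
      (berf (bepath w u (becut r M x)) (berf w y) - berf (bepath w u (becut r M y)) (berf w y)) := by
    simp only [betw, berf_sub]
    abel
  have n1 : ‖berf (bepath w u (becut r M x)) (berf w (x - y))‖ = ‖x - y‖ := by
    rw [berf_norm nx, berf_norm hw]
  have n2 := berf_lip nx ny (berf w y)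
  rw [berf_norm hw] at n2
  have n3 := bepath_lip hw hu h mx.1 mx.2 my.1 my.2
  have n4 := becut_lip hC hC0 hr hM hxy
  have n5 : ‖(berf (bepath w u (becut r M x)) (berf w y) - berf (bepath w u (becut r M y)) (berf w y))‖
      ≤ 64 * C / M * ‖x - y‖ := by
    refine n2.trans ?_
    calc _ ≤ 4 * (8 * |becut r M x - becut r M y|) * ‖y‖ := by gcongr
      _ = 32 * (|becut r M x - becut r M y| * ‖y‖) := by ring
      _ ≤ 32 * (2 * C / M * ‖x - y‖) := by gcongr
      _ = _ := by ring
  refine le_trans ?_ n5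
  rw [e, ← n1]
  refine (abs_norm_sub_norm_le _ _).trans ?_
  simp

/-- The slow twist lemma. -/
theorem be_twist (L : ℝ) (hL : 1 < L) : ∃ K : ℝ, 2 ≤ K ∧ ∀ (u w c : E) (r : ℝ), ‖u‖ = 1 → ‖w‖ = 1 →
    0 < r → ∃ Φ : E → E, BEGood L Φ ∧
      (∀ x, dist x c ≤ r → Φ x = c + berf u (berf w (x - c))) ∧
      (∀ x, K * r ≤ dist x c → Φ x = x) := by
  obtain ⟨C, hC0, hC⟩ := be_smoothTransition_lip
  have hLi : L⁻¹ < 1 := inv_lt_one_of_one_lt₀ hL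
  have hη : 0 < min (L - 1) (1 - L⁻¹) := lt_min (by linarith) (by linarith)
  set η := min (L - 1) (1 - L⁻¹) with hηd
  set M := max 1 (64 * C / η) with hMd
  have hM : 1 ≤ M := le_max_left _ _
  have hM2 : 64 * C / M ≤ η := by
    rw [div_le_iff₀ (by linarith), ← div_le_iff₀' hη]
    exact le_max_right _ _
  refine ⟨Real.exp M, by linarith [Real.add_one_le_exp M], fun u w c r hu hw hr => ?_⟩
  wlog h : 0 ≤ ⟪w, u⟫_ℝ generalizing u with H
  · obtain ⟨Φ, h1, h2, h3⟩ := H (-u) (by simpa using hu) (by rw [inner_neg_right]; linarith)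
    refine ⟨Φ, h1, fun x hx => ?_, h3⟩
    rw [h2 x hx, berf_neg]
  have hb : ∀ x : E, ‖bepath w u (becut r M x)‖ = 1 := fun x =>
    bepath_norm hw hu h (becut_mem x).1 (becut_mem x).2
  have hlip : ∀ x y, |‖betw w u r M x - betw w u r M y‖ - ‖x - y‖| ≤ η * ‖x - y‖ := by
    intro x y
    rcases le_total ‖y‖ ‖x‖ with hxy | hxy
    · refine (betw_lip hC hC0 hr hM hw hu h hxy).trans ?_
      gcongr
    · rw [norm_sub_rev, norm_sub_rev x y]
      refine (betw_lip hC hC0 hr hM hw hu h hxy).trans ?_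
      gcongr
  have hn : ∀ x, ‖betw w u r M x‖ = ‖x‖ := fun x => by
    rw [betw, berf_norm (hb x), berf_norm hw]
  have hn' : ∀ x, ‖betw' w u r M x‖ = ‖x‖ := fun x => by
    rw [betw', berf_norm hw, berf_norm (hb x)]
  have hl : ∀ x, betw' w u r M (betw w u r M x) = x := fun x => by
    rw [betw', becut_norm (hn x), betw, berf_berf (hb x), berf_berf hw]
  have hr' : ∀ x, betw w u r M (betw' w u r M x) = x := fun x => by
    rw [betw, becut_norm (hn' x), betw', berf_berf hw, berf_berf (hb x)]
  have hsub : ContDiff ℝ (⊤ : ℕ∞) (fun x : E => x - c) := contDiff_id.sub contDiff_const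
  have hs : ContDiff ℝ (⊤ : ℕ∞) (betw w u r M) :=
    berf_smooth (bepath_smooth hw hu h r M) (berf_smooth contDiff_const contDiff_id)
  have hs' : ContDiff ℝ (⊤ : ℕ∞) (betw' w u r M) :=
    berf_smooth contDiff_const (berf_smooth (bepath_smooth hw hu h r M) contDiff_id)
  refine ⟨fun x => c + betw w u r M (x - c), ⟨?_, ⟨fun x => c + betw' w u r M (x - c), ?_, ?_, ?_⟩, ?_⟩,
    ?_, ?_⟩
  · exact contDiff_const.add (hs.comp hsub)
  · exact contDiff_const.add (hs'.comp hsub)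
  · intro x
    simp [hl]
  · intro x
    simp [hr']
  · intro x y
    have h1 := hlip (x - c) (y - c)
    rw [sub_sub_sub_cancel_right, abs_le] at h1
    rw [dist_eq_norm, dist_eq_norm, add_sub_add_left_eq_sub]
    have e1 : η ≤ L - 1 := min_le_left _ _
    have e2 : η ≤ 1 - L⁻¹ := min_le_right _ _
    have e3 := mul_le_mul_of_nonneg_right e1 (norm_nonneg (x - y))
    have e4 := mul_le_mul_of_nonneg_right e2 (norm_nonneg (x - y))
    constructor <;> linarith [h1.1, h1.2]
  · intro x hx
    rw [dist_eq_norm] at hx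
    simp only [betw, becut_one hr hM hx]
    simp [bepath, hu]
  · intro x hx
    rw [dist_eq_norm] at hx
    simp only [betw, becut_zero hr hM hx]
    simp [bepath, hw, berf_berf]

theorem be_pigeon (X : Finset ℝ) (N : ℕ) (hX : X.card ≤ N) (l Λ : ℝ) (hl : 0 < l) (hΛ : 1 < Λ) :
    ∃ n ≤ N, ∀ x ∈ X, x ≤ l * Λ ^ n ∨ l * Λ ^ (n + 1) < x := by
  by_contra! H
  choose! f hf using H
  obtain ⟨i, hi, j, hj, hij, he⟩ := Finset.exists_ne_map_eq_of_card_lt_of_maps_to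
    (s := Finset.range (N + 1)) (t := X) (f := f) (by simp; omega)
    (fun n hn => (hf n (by simpa [Nat.lt_succ_iff] using hn)).1)
  have key : ∀ i j, i ≤ N → j ≤ N → i < j → f i < f j := by
    intro i j hi hj hij
    calc f i ≤ l * Λ ^ (i + 1) := (hf i hi).2.2
      _ ≤ l * Λ ^ j := by
        have := pow_le_pow_right₀ hΛ.le (show i + 1 ≤ j from hij)
        gcongr
      _ < f j := (hf j hj).2.1
  simp only [Finset.mem_range] at hi hj
  rcases lt_or_gt_of_ne hij with h | h
  · exact (key i j (by omega) (by omega) h).ne he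
  · exact (key j i (by omega) (by omega) h).ne he.symm

theorem be_orth [FiniteDimensional ℝ E] (S : Finset E) (h : S.card < Module.finrank ℝ E) :
    ∃ w : E, ‖w‖ = 1 ∧ ∀ x ∈ S, ⟪w, x⟫_ℝ = 0 := by
  have h1 : Submodule.span ℝ (S : Set E) ≠ ⊤ := by
    intro ht
    have := finrank_span_finset_le_card (R := ℝ) S
    rw [Set.finrank, ht, finrank_top] at this
    omega
  have h2 : (Submodule.span ℝ (S : Set E))ᗮ ≠ ⊥ := by
    rwa [Ne, Submodule.orthogonal_eq_bot_iff]
  obtain ⟨v, hv, hv0⟩ := Submodule.exists_mem_ne_zero_of_ne_bot h2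
  refine ⟨‖v‖⁻¹ • v, ?_, fun x hx => ?_⟩
  · rw [norm_smul, norm_inv, norm_norm, inv_mul_cancel₀ (norm_ne_zero_iff.2 hv0)]
  · rw [inner_smul_left, real_inner_comm, (Submodule.mem_orthogonal _ _).1 hv x (Submodule.subset_span hx),
      mul_zero]

theorem be_clusters (L : ℝ) (hL : 1 < L) (B : E → E) (e T : ℝ) (he : 0 < e) (hT : 0 ≤ T) (n : ℕ) :
    ∀ Q : Finset E, Q.card ≤ n →
    (∀ p ∈ Q, ∃ Ψ : E → E, BEGood L Ψ ∧ (∀ x, dist x p ≤ e → Ψ x = B x) ∧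
      ∀ x, T ≤ dist x p → Ψ x = x) →
    (∀ p ∈ Q, dist (B p) p ≤ 2 * e) →
    (∀ p ∈ Q, ∀ p' ∈ Q, dist p p' ≤ e ∨ T + 2 * e ≤ dist p p') →
    ∃ Ψ : E → E, BEGood (L ^ n) Ψ ∧ (∀ p ∈ Q, Ψ p = B p) ∧
      ∀ x, (∀ p ∈ Q, T ≤ dist x p) → Ψ x = x := by
  classical
  induction n with
  | zero =>
    intro Q hQ _ _ _
    have : Q = ∅ := by simpa using hQ
    subst this
    exact ⟨fun x => x, by simpa using BEGood.id, by simp, fun x _ => rfl⟩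
  | succ n ih =>
    intro Q hQ h1 h2 h3
    rcases Q.eq_empty_or_nonempty with rfl | ⟨p, hp⟩
    · exact ⟨fun x => x, BEGood.id.mono one_pos (one_le_pow₀ hL.le), by simp, fun x _ => rfl⟩
    set Q' := Q.filter (fun x => ¬ dist x p ≤ e) with hQ'
    have hsub : Q' ⊆ Q := Finset.filter_subset _ _
    have hlt : Q'.card < Q.card := by
      apply Finset.card_lt_card
      refine ⟨hsub, fun h => ?_⟩
      have := h hp
      simp only [hQ', Finset.mem_filter, dist_self] at this
      exact this.2 he.le
    obtain ⟨Ψ, g1, g2, g3⟩ := ih Q' (by omega) (fun p hp => h1 p (hsub hp))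
      (fun p hp => h2 p (hsub hp)) (fun p hp p' hp' => h3 p (hsub hp) p' (hsub hp'))
    obtain ⟨Ψ', f1, f2, f3⟩ := h1 p hp
    have hL0 : 0 < L := by linarith
    refine ⟨fun x => Ψ' (Ψ x), ?_, ?_, ?_⟩
    · rw [pow_succ']
      exact f1.comp hL0 (by positivity) g1
    · intro x hx
      by_cases hxp : dist x p ≤ e
      · have : Ψ x = x := by
          apply g3
          intro p' hp'
          have hp'2 := (Finset.mem_filter.1 hp').2
          have := (h3 p' (hsub hp') p hp).resolve_left hp'2
          have tri := dist_triangle p' x p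
          rw [dist_comm p' x] at tri
          linarith
        simp only [this]
        exact f2 x hxp
      · have hx' : x ∈ Q' := Finset.mem_filter.2 ⟨hx, hxp⟩
        simp only [g2 x hx']
        apply f3
        have := (h3 x hx p hp).resolve_left hxp
        have tri := dist_triangle x (B x) p
        rw [dist_comm x (B x)] at tri
        have := h2 x hx
        linarith
    · intro x hx
      simp only [g3 x (fun p' hp' => hx p' (hsub hp'))]
      exact f3 x (hx p hp)

/-- projection to the bisector of `a`, `b` -/
noncomputable def beproj (u q p : E) : E := p - ⟪u, p - q⟫_ℝ • u

theorem beproj_inner {u : E} (hu : ‖u‖ = 1) (q p : E) : ⟪u, beproj u q p - q⟫_ℝ = 0 := by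
  have : beproj u q p - q = (p - q) - ⟪u, p - q⟫_ℝ • u := by
    rw [beproj]; abel
  rw [this, inner_sub_right, inner_smul_right, real_inner_self_eq_norm_sq, hu]
  ring

theorem beproj_dist {u : E} (hu : ‖u‖ = 1) (q p : E) : dist p (beproj u q p) = |⟪u, p - q⟫_ℝ| := by
  rw [beproj, dist_eq_norm, sub_sub_cancel, norm_smul, hu, mul_one, Real.norm_eq_abs]

theorem be_inner_id (a b p : E) :
    2 * ⟪b - a, p - (1 / 2 : ℝ) • (a + b)⟫_ℝ = dist a p ^ 2 - dist b p ^ 2 := by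
  rw [dist_comm a, dist_comm b, dist_eq_norm, dist_eq_norm]
  have h1 : b - a = (p - a) - (p - b) := by abel
  have h2 : p - (1 / 2 : ℝ) • (a + b) = (1 / 2 : ℝ) • ((p - a) + (p - b)) := by module
  rw [h1, h2, inner_smul_right, inner_sub_left, inner_add_right, inner_add_right,
    real_inner_self_eq_norm_sq, real_inner_self_eq_norm_sq, real_inner_comm (p - a) (p - b)]
  ring

theorem be_move_small {D : ℕ} [FiniteDimensional ℝ E] (hD : Module.finrank ℝ E = D) (h2 : 2 ≤ D)
    {L K : ℝ} (hK2 : 2 ≤ K)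
    (hK : ∀ (u w c : E) (r : ℝ), ‖u‖ = 1 → ‖w‖ = 1 →
      0 < r → ∃ Φ : E → E, BEGood L Φ ∧
      (∀ x, dist x c ≤ r → Φ x = c + berf u (berf w (x - c))) ∧
      (∀ x, K * r ≤ dist x c → Φ x = x)) (P : Finset E) (a b : E) (hab : a ≠ b)
    (hP : ∀ p ∈ P, (K + 1) * dist a b < dist a p) :
    ∃ Φ : E → E, BEGood L Φ ∧ Φ a = b ∧ ∀ p ∈ P, Φ p = p := by
  classical
  have hρ : 0 < ‖b - a‖ := norm_pos_iff.2 (sub_ne_zero.2 hab.symm)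
  have hd : dist a b = ‖b - a‖ := by rw [dist_comm, dist_eq_norm]
  set u := ‖b - a‖⁻¹ • (b - a) with hud
  have hu : ‖u‖ = 1 := by
    rw [hud, norm_smul, norm_inv, norm_norm, inv_mul_cancel₀ hρ.ne']
  have hba : b - a = ‖b - a‖ • u := by
    rw [hud, smul_smul, mul_inv_cancel₀ hρ.ne', one_smul]
  obtain ⟨w, hw, hwo⟩ := be_orth ({u} : Finset E) (by simp; omega)
  have hwu : ⟪w, u⟫_ℝ = 0 := hwo u (by simp)
  set q := (1 / 2 : ℝ) • (a + b) with hq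
  obtain ⟨Φ, f1, f2, f3⟩ := hK u w q (‖b - a‖ / 2) hu hw (by positivity)
  have haq : a - q = (-(‖b - a‖ / 2)) • u := by
    have : a - q = (-(1 / 2 : ℝ)) • (b - a) := by rw [hq]; module
    rw [this, hba]
    simp only [norm_smul, hu]
    rw [smul_smul]
    congr 1
    simp
    ring
  have hdq : dist a q = ‖b - a‖ / 2 := by
    rw [dist_eq_norm, haq, norm_smul, hu, norm_neg, mul_one, Real.norm_of_nonneg (by positivity)]
  refine ⟨Φ, f1, ?_, fun p hp => ?_⟩
  · rw [f2 a hdq.le, berf_of_orth (n := w)]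
    · rw [haq, berf, inner_smul_right, real_inner_self_eq_norm_sq, hu]
      have : b = a + ‖b - a‖ • u := by rw [← hba]; abel
      have hq2 : q = a + (‖b - a‖ / 2) • u := by
        have := haq
        rw [sub_eq_iff_eq_add] at this
        rw [eq_comm, ← sub_eq_zero]
        nth_rewrite 1 [this]
        module
      rw [hq2]
      nth_rewrite 4 [this]
      module
    · rw [haq, inner_smul_right, hwu, mul_zero]
  · apply f3
    have := hP p hp
    have tri := dist_triangle a q p
    rw [hdq, dist_comm q p] at tri
    rw [hd] at this
    nlinarith

theorem be_arith {x y d ρ Rm K δ s : ℝ} (hx : 0 ≤ x) (hy : 0 ≤ y) (hd0 : 0 ≤ d) (hs : 0 ≤ s)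
    (hδ0 : 0 ≤ δ) (hδ1 : δ ≤ 1) (hK : 0 < K + 1)
    (r1 : x ≤ (1 + δ) * y) (r2 : y ≤ (1 + δ) * x) (i2 : x ≤ (Rm + 1) * d)
    (hδ2 : 3 * (K + 1) * (Rm + 1) ^ 2 * δ ≤ s) (hρd : d ≤ (K + 1) * ρ) :
    |x ^ 2 - y ^ 2| / 2 ≤ ρ * (s * d) := by
  have i3 : y ≤ 2 * x := by nlinarith
  have i4 : |x - y| ≤ 2 * δ * x := by
    rw [abs_le]; constructor <;> nlinarith
  have i5 : |x ^ 2 - y ^ 2| ≤ 6 * δ * x ^ 2 := by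
    have : x ^ 2 - y ^ 2 = (x - y) * (x + y) := by ring
    rw [this, abs_mul, abs_of_nonneg (show 0 ≤ x + y by positivity)]
    calc _ ≤ (2 * δ * x) * (3 * x) := by
          apply mul_le_mul i4 (by linarith) (by positivity) (by positivity)
      _ = _ := by ring
  have i7 : |x ^ 2 - y ^ 2| ≤ 6 * δ * ((Rm + 1) * d) ^ 2 :=
    i5.trans (by gcongr)
  have i8 : 3 * (K + 1) * (Rm + 1) ^ 2 * δ * d ^ 2 ≤ s * d ^ 2 := by
    gcongr
  have i9 : s * d * d ≤ s * d * ((K + 1) * ρ) := by gcongr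
  have i10 : (K + 1) * (3 * δ * ((Rm + 1) * d) ^ 2) ≤ (K + 1) * (ρ * (s * d)) := by
    linarith
  have := le_of_mul_le_mul_left i10 hK
  linarith

set_option maxHeartbeats 1600000 in
theorem be_move [FiniteDimensional ℝ E] (D : ℕ) (hD : Module.finrank ℝ E = D) (h2 : 2 ≤ D)
    (L : ℝ) (hL : 1 < L) : ∃ δ > (0 : ℝ), ∀ P : Finset E, P.card + 1 ≤ D → ∀ a b : E, a ∉ P →
      (∀ p ∈ P, dist a p ≤ (1 + δ) * dist b p ∧ dist b p ≤ (1 + δ) * dist a p) →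
      ∃ Φ : E → E, BEGood L Φ ∧ Φ a = b ∧ ∀ p ∈ P, Φ p = p := by
  classical
  obtain ⟨L1, hL1, hL1p⟩ : ∃ L1 : ℝ, 1 < L1 ∧ L1 ^ D ≤ L := by
    refine ⟨L ^ ((D : ℝ)⁻¹), Real.one_lt_rpow hL (by positivity), ?_⟩
    rw [Real.rpow_inv_natCast_pow (by linarith) (by omega)]
  obtain ⟨K, hK2, hK⟩ := be_twist (E := E) L1 hL1
  set Λ := 4 * K with hΛd
  have hΛ : 1 < Λ := by linarith
  have hΛ0 : 0 < Λ := by linarith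
  set N := D * D with hN
  set s0 : ℝ := (Λ ^ (N + 1))⁻¹ with hs0
  have hs0p : 0 < s0 := by positivity
  set Rm : ℝ := 4 * Λ ^ N with hRm
  have hRm0 : 0 < Rm := by positivity
  set δ := min 1 (s0 / (3 * (K + 1) * (Rm + 1) ^ 2)) with hδ
  have hδ1 : δ ≤ 1 := min_le_left _ _
  have hδ2 : 3 * (K + 1) * (Rm + 1) ^ 2 * δ ≤ s0 := by
    have : δ ≤ s0 / (3 * (K + 1) * (Rm + 1) ^ 2) := min_le_right _ _
    rw [le_div_iff₀ (by positivity)] at this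
    linarith
  have hδ0 : 0 < δ := lt_min one_pos (by positivity)
  clear_value δ
  refine ⟨δ, hδ0, fun P hP a b haP hr => ?_⟩
  by_cases hab : a = b
  · subst hab
    exact ⟨fun x => x, BEGood.id.mono one_pos hL.le, rfl, fun _ _ => rfl⟩
  have hLL : L1 ≤ L := le_trans (by simpa using pow_le_pow_right₀ hL1.le (show 1 ≤ D by omega)) hL1p
  by_cases hsm : ∀ p ∈ P, (K + 1) * dist a b < dist a p
  · obtain ⟨Φ, f1, f2⟩ := be_move_small hD h2 hK2 hK P a b hab hsm
    exact ⟨Φ, f1.mono (by linarith) hLL, f2⟩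
  push Not at hsm
  obtain ⟨p0, hp0, hp0d⟩ := hsm
  obtain ⟨p1, hp1, hmin⟩ := P.exists_min_image (fun p => dist a p) ⟨p0, hp0⟩
  set d := dist a p1 with hd
  have hd0 : 0 < d := dist_pos.2 (fun h => haP (h ▸ hp1))
  have hρd : d ≤ (K + 1) * dist a b := (hmin p0 hp0).trans hp0d
  have hρ : 0 < ‖b - a‖ := norm_pos_iff.2 (sub_ne_zero.2 (Ne.symm hab))
  have hdab : dist a b = ‖b - a‖ := by rw [dist_comm, dist_eq_norm]
  rw [hdab] at hρd
  -- the scales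
  set X := (P ×ˢ P).image (fun pq => dist pq.1 pq.2 / d) with hX
  have hXc : X.card ≤ N := by
    refine Finset.card_image_le.trans ?_
    rw [Finset.card_product]
    exact Nat.mul_le_mul (by omega) (by omega)
  have hXm : ∀ p ∈ P, ∀ p' ∈ P, dist p p' / d ∈ X := fun p hp p' hp' =>
    Finset.mem_image.2 ⟨(p, p'), Finset.mem_product.2 ⟨hp, hp'⟩, rfl⟩
  obtain ⟨n1, hn1, hs⟩ := be_pigeon X N hXc s0 Λ hs0p hΛ
  obtain ⟨n2, hn2, hR⟩ := be_pigeon X N hXc 4 Λ (by norm_num) hΛ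
  have es : s0 * Λ ^ (n1 + 1) = Λ * (s0 * Λ ^ n1) := by ring
  have eR : 4 * Λ ^ (n2 + 1) = Λ * (4 * Λ ^ n2) := by ring
  rw [es] at hs
  rw [eR] at hR
  have hs0s : s0 ≤ s0 * Λ ^ n1 := by
    have := one_le_pow₀ hΛ.le (n := n1)
    nlinarith
  have hs1 : Λ * (s0 * Λ ^ n1) ≤ 1 := by
    rw [← es, hs0, inv_mul_le_one₀ (by positivity)]
    exact pow_le_pow_right₀ hΛ.le (by omega)
  have hR4 : 4 ≤ 4 * Λ ^ n2 := by
    have := one_le_pow₀ hΛ.le (n := n2)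
    linarith
  have hRRm : 4 * Λ ^ n2 ≤ Rm := by
    have := pow_le_pow_right₀ hΛ.le hn2
    linarith
  generalize s0 * Λ ^ n1 = s at hs hs0s hs1
  generalize 4 * Λ ^ n2 = R at hR hR4 hRRm
  clear es eR
  have hs' : ∀ p ∈ P, ∀ p' ∈ P, dist p p' ≤ s * d ∨ Λ * s * d < dist p p' := by
    intro p hp p' hp'
    rcases hs _ (hXm p hp p' hp') with h | h
    · left; rwa [div_le_iff₀ hd0] at h
    · right; rwa [lt_div_iff₀ hd0] at h
  have hR' : ∀ p ∈ P, dist p p1 ≤ R * d ∨ Λ * R * d < dist p p1 := by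
    intro p hp
    rcases hR _ (hXm p hp p1 hp1) with h | h
    · left; rwa [div_le_iff₀ hd0] at h
    · right; rwa [lt_div_iff₀ hd0] at h
  clear_value s0 Rm
  have hsp : 0 < s := by linarith
  set u := ‖b - a‖⁻¹ • (b - a) with hud
  have hu : ‖u‖ = 1 := by
    rw [hud, norm_smul, norm_inv, norm_norm, inv_mul_cancel₀ hρ.ne']
  have hba : b - a = ‖b - a‖ • u := by
    rw [hud, smul_smul, mul_inv_cancel₀ hρ.ne', one_smul]
  set q := (1 / 2 : ℝ) • (a + b) with hq
  set h : E → E := beproj u q with hh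
  set e := s * d with he
  have he0 : 0 < e := by positivity
  have hnear : ∀ p ∈ P, dist p p1 ≤ R * d → dist p (h p) ≤ e := by
    intro p hp hpR
    rw [hh, beproj_dist hu]
    obtain ⟨r1, r2⟩ := hr p hp
    have i1 : ⟪u, p - q⟫_ℝ = ‖b - a‖⁻¹ * ((dist a p ^ 2 - dist b p ^ 2) / 2) := by
      rw [← be_inner_id, hud, inner_smul_left, ← hq, mul_div_cancel_left₀ _ (two_ne_zero' ℝ)]
      rfl
    have i2 : dist a p ≤ (Rm + 1) * d := by
      have := dist_triangle a p1 p
      rw [dist_comm p1 p, ← hd] at this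
      have h9 : R * d ≤ Rm * d := by gcongr
      linarith
    rw [i1, abs_mul, abs_div, abs_of_pos (inv_pos.2 hρ), inv_mul_le_iff₀ hρ, abs_two]
    exact be_arith dist_nonneg dist_nonneg hd0.le hsp.le hδ0.le hδ1 (by linarith) r1 r2 i2
      (hδ2.trans hs0s) hρd
  set Q := P.filter (fun p => dist p p1 ≤ R * d) with hQ
  have hQP : Q ⊆ P := Finset.filter_subset _ _
  have hp1Q : p1 ∈ Q := Finset.mem_filter.2 ⟨hp1, by simp; positivity⟩
  have hQn : ∀ p ∈ Q, dist p (h p) ≤ e := fun p hp =>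
    hnear p (hQP hp) (Finset.mem_filter.1 hp).2
  set o := h p1 with ho
  obtain ⟨w, hw, hwo⟩ := be_orth (insert (a - o) ((Q.erase p1).image (fun p => h p - o))) (by
    refine lt_of_le_of_lt (Finset.card_insert_le _ _) ?_
    have c1 : ((Q.erase p1).image (fun p => h p - o)).card ≤ (Q.erase p1).card := Finset.card_image_le
    have c2 := Finset.card_erase_add_one hp1Q
    have c3 := Finset.card_le_card hQP
    omega)
  have hwa : ⟪w, a - o⟫_ℝ = 0 := hwo _ (Finset.mem_insert_self _ _)
  have hwp : ∀ p ∈ Q, ⟪w, h p - o⟫_ℝ = 0 := by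
    intro p hp
    by_cases hpp : p = p1
    · rw [hpp, ← ho, sub_self, inner_zero_right]
    · exact hwo _ (Finset.mem_insert_of_mem (Finset.mem_image_of_mem _ (Finset.mem_erase.2 ⟨hpp, hp⟩)))
  have hup : ∀ p, ⟪u, h p - o⟫_ℝ = 0 := by
    intro p
    have : h p - o = (h p - q) - (h p1 - q) := by rw [ho]; abel
    rw [this, inner_sub_right, hh, beproj_inner hu, beproj_inner hu, sub_zero]
  have hua : ⟪u, a - o⟫_ℝ = -(‖b - a‖ / 2) := by
    have : a - o = (a - q) - (h p1 - q) := by rw [ho]; abel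
    rw [this, inner_sub_right, hh, beproj_inner hu, sub_zero, hud, inner_smul_left]
    have := be_inner_id a b a
    rw [dist_self, dist_comm b, hdab] at this
    rw [hq]
    have h3 : ⟪b - a, a - (1 / 2 : ℝ) • (a + b)⟫_ℝ = - ‖b - a‖ ^ 2 / 2 := by linarith
    rw [h3]
    simp
    field_simp
  set B : E → E := fun x => o + berf w (berf u (x - o)) with hB
  have hBh : ∀ p ∈ Q, ∀ x, B x = h p + berf w (berf u (x - h p)) := by
    intro p hp x
    have : x - h p = (x - o) - (h p - o) := by abel
    rw [this, berf_sub, berf_sub, berf_of_orth (hup p), berf_of_orth (hwp p hp), hB]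
    simp only
    abel
  have hBd : ∀ p ∈ Q, dist (B p) p ≤ 2 * e := by
    intro p hp
    have n1 : dist (B p) (h p) = dist p (h p) := by
      rw [hBh p hp, dist_eq_norm, add_sub_cancel_left, berf_norm hw, berf_norm hu, dist_eq_norm]
    have := dist_triangle (B p) (h p) p
    rw [n1, dist_comm (h p) p] at this
    linarith [hQn p hp]
  have hKe : 2 * e ≤ K * e := by gcongr
  obtain ⟨Ψ, g1, g2, g3⟩ := be_clusters L1 hL1 B e ((2 * K + 1) * e) he0 (by positivity) Q.card Q le_rfl
    (by
      intro p hp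
      obtain ⟨Ψ, k1, k2, k3⟩ := hK w u (h p) (2 * e) hw hu (by positivity)
      refine ⟨Ψ, k1, fun x hx => ?_, fun x hx => ?_⟩
      · rw [hBh p hp]
        apply k2
        linarith [dist_triangle x p (h p), hQn p hp]
      · apply k3
        have := dist_triangle x (h p) p
        rw [dist_comm (h p) p] at this
        linarith [hQn p hp]) hBd
    (by
      intro p hp p' hp'
      rcases hs' p (hQP hp) p' (hQP hp') with hc | hc
      · exact Or.inl hc
      · right
        have : Λ * s * d = 4 * (K * e) := by rw [hΛd, he]; ring
        linarith)
  have hed : (2 * K + 1) * e ≤ d := by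
    have : Λ * s * d ≤ 1 * d := by gcongr
    have h4 : Λ * s * d = 4 * (K * e) := by rw [hΛd, he]; ring
    linarith
  have hep : e ≤ d := by linarith
  obtain ⟨Φ, f1, f2, f3⟩ := hK u w o ((R + 2) * d) hu hw (by positivity)
  have hop1 : dist p1 o ≤ e := hQn p1 hp1Q
  have hRd : 4 * d ≤ R * d := by gcongr
  refine ⟨fun x => Φ (Ψ x), ?_, ?_, ?_⟩
  · refine BEGood.mono (by positivity) ?_ (f1.comp (by linarith) (by positivity) g1)
    rw [← pow_succ']
    refine le_trans (pow_le_pow_right₀ hL1.le ?_) hL1p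
    have c3 := Finset.card_le_card hQP
    omega
  · have : Ψ a = a := g3 a (fun p hp => hed.trans (hmin p (hQP hp)))
    simp only [this]
    rw [f2 a (by linarith [dist_triangle a p1 o]), berf_of_orth hwa, berf, hua]
    have : b = a + ‖b - a‖ • u := by rw [← hba]; abel
    nth_rewrite 2 [this]
    module
  · intro p hp
    by_cases hpQ : p ∈ Q
    · simp only [g2 p hpQ]
      rw [f2]
      · simp only [hB, add_sub_cancel_left, berf_berf hw, berf_berf hu]
        abel
      · rw [hB, dist_eq_norm, add_sub_cancel_left, berf_norm hw, berf_norm hu, ← dist_eq_norm]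
        have := (Finset.mem_filter.1 hpQ).2
        linarith [dist_triangle p p1 o]
    · have hfar : Λ * R * d < dist p p1 :=
        (hR' p hp).resolve_left (fun hc => hpQ (Finset.mem_filter.2 ⟨hp, hc⟩))
      have h4 : Λ * R * d = 4 * (K * (R * d)) := by rw [hΛd]; ring
      have h5 : 2 * (R * d) ≤ K * (R * d) := by gcongr
      have h6 : K * (4 * d) ≤ K * (R * d) := by gcongr
      have : Ψ p = p := by
        apply g3
        intro p' hp'
        have := (Finset.mem_filter.1 hp').2
        have tri := dist_triangle p p' p1
        linarith
      simp only [this]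
      apply f3
      have tri := dist_triangle p o p1
      rw [dist_comm o p1] at tri
      linarith

theorem be_main [FiniteDimensional ℝ E] (D : ℕ) (hD : Module.finrank ℝ E = D) (h2 : 2 ≤ D) (k : ℕ) :
    k ≤ D → ∀ L : ℝ, 1 < L → ∃ δ > (0 : ℝ), ∀ y z : Fin k → E, Function.Injective z →
      (∀ i j, dist (y i) (y j) ≤ (1 + δ) * dist (z i) (z j) ∧
        dist (z i) (z j) ≤ (1 + δ) * dist (y i) (y j)) →
      ∃ Φ : E → E, BEGood L Φ ∧ ∀ i, Φ (y i) = z i := by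
  classical
  induction k with
  | zero =>
    intro _ L hL
    exact ⟨1, one_pos, fun y z _ _ => ⟨fun x => x, BEGood.id.mono one_pos hL.le, fun i => i.elim0⟩⟩
  | succ k ih =>
    intro hk L hL
    have hsq : 1 < √L := by rw [Real.lt_sqrt] <;> linarith
    obtain ⟨δ1, hδ1, H⟩ := be_move (E := E) D hD h2 (√L) hsq
    have hsq1 : 1 < √(1 + δ1) := by rw [Real.lt_sqrt] <;> linarith
    set L2 := min (√L) (√(1 + δ1)) with hL2
    have hL2' : 1 < L2 := lt_min hsq hsq1
    obtain ⟨δ2, hδ2, H2⟩ := ih (by omega) L2 hL2'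
    set δ := min δ2 (√(1 + δ1) - 1) with hδ
    have hδ0 : 0 < δ := lt_min hδ2 (by linarith)
    have ha : δ ≤ δ2 := min_le_left _ _
    have hb : 1 + δ ≤ √(1 + δ1) := by linarith [min_le_right δ2 (√(1 + δ1) - 1)]
    have hc : L2 ≤ √(1 + δ1) := min_le_right _ _
    have hprod : L2 * (1 + δ) ≤ 1 + δ1 := by
      calc _ ≤ √(1 + δ1) * √(1 + δ1) := by gcongr
        _ = _ := Real.mul_self_sqrt (by linarith)
    refine ⟨δ, hδ0, fun y z hz hyz => ?_⟩
    obtain ⟨Φ, f1, f2⟩ := H2 (fun i => y i.castSucc) (fun i => z i.castSucc)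
      (hz.comp (Fin.castSucc_injective k)) (fun i j => by
        obtain ⟨q1, q2⟩ := hyz i.castSucc j.castSucc
        constructor
        · refine q1.trans ?_
          gcongr
        · refine q2.trans ?_
          gcongr)
    have hL20 : 0 < L2 := by linarith
    have hyne : ∀ i : Fin k, y (Fin.last k) ≠ y i.castSucc := by
      intro i h
      have := (hyz (Fin.last k) i.castSucc).2
      rw [h, dist_self, mul_zero] at this
      have h3 := hz (dist_le_zero.1 this)
      exact absurd h3 (Fin.castSucc_lt_last i).ne'
    obtain ⟨Φ', g1, g2, g3⟩ := H (Finset.univ.image (fun i : Fin k => z i.castSucc))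
      (by
        have : (Finset.univ.image (fun i : Fin k => z i.castSucc)).card ≤ _ := Finset.card_image_le
        simp at this
        omega)
      (Φ (y (Fin.last k))) (z (Fin.last k))
      (by
        intro h
        obtain ⟨i, -, hi⟩ := Finset.mem_image.1 h
        rw [← f2 i] at hi
        obtain ⟨Ψ, -, hl, -⟩ := f1.2.1
        exact hyne i (hl.injective hi).symm)
      (by
        intro p hp
        obtain ⟨i, -, rfl⟩ := Finset.mem_image.1 hp
        obtain ⟨q1, q2⟩ := hyz (Fin.last k) i.castSucc
        obtain ⟨t1, t2⟩ := f1.2.2 (y (Fin.last k)) (y i.castSucc)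
        rw [f2 i] at t1 t2
        rw [inv_mul_le_iff₀ hL20] at t1
        constructor
        · calc _ ≤ L2 * ((1 + δ) * dist (z (Fin.last k)) (z i.castSucc)) := t2.trans (by gcongr)
            _ = (L2 * (1 + δ)) * dist (z (Fin.last k)) (z i.castSucc) := by ring
            _ ≤ _ := by gcongr
        · calc _ ≤ (1 + δ) * (L2 * dist (Φ (y (Fin.last k))) (z i.castSucc)) := q2.trans (by gcongr)
            _ = (L2 * (1 + δ)) * dist (Φ (y (Fin.last k))) (z i.castSucc) := by ring
            _ ≤ _ := by gcongr)
    refine ⟨fun x => Φ' (Φ x), ?_, ?_⟩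
    · refine BEGood.mono (by positivity) ?_ (g1.comp (by linarith) hL20 f1)
      calc √L * L2 ≤ √L * √L := by gcongr; exact min_le_left _ _
        _ = L := Real.mul_self_sqrt (by linarith)
    · intro i
      refine Fin.lastCases ?_ (fun i => ?_) i
      · exact g2
      · simp only [f2 i]
        exact g3 _ (Finset.mem_image_of_mem _ (Finset.mem_univ i))

end BE

/-- For `1 ≤ k ≤ D` and small `ε > 0` there is `δ > 0` such that any two
k-point configurations with pairwise distance ratios in `[(1+δ)⁻¹, 1+δ]` are matched
by a smooth diffeomorphism of `ℝ^D` that distorts all distances by at most `1+ε`. -/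
theorem bilipschitz_extension
    (D : ℕ) (hD : 2 ≤ D) :
    ∃ ε₀ > (0 : ℝ), ∀ ε : ℝ, 0 < ε → ε < ε₀ →
      ∀ k : ℕ, 1 ≤ k → k ≤ D →
        ∃ δ > (0 : ℝ), ∀ y z : Fin k → EuclideanSpace ℝ (Fin D),
          Function.Injective y → Function.Injective z →
          (∀ i j, i ≠ j →
            (1 + δ)⁻¹ ≤ dist (z i) (z j) / dist (y i) (y j) ∧
            dist (z i) (z j) / dist (y i) (y j) ≤ 1 + δ) →
          ∃ Φ : EuclideanSpace ℝ (Fin D) → EuclideanSpace ℝ (Fin D),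
            Function.Bijective Φ ∧
            ContDiff ℝ (⊤ : ℕ∞) Φ ∧
            ContDiff ℝ (⊤ : ℕ∞) (Function.invFun Φ) ∧
            (∀ x x' : EuclideanSpace ℝ (Fin D),
              (1 + ε)⁻¹ * dist x x' ≤ dist (Φ x) (Φ x') ∧
              dist (Φ x) (Φ x') ≤ (1 + ε) * dist x x') ∧
            (∀ i, Φ (y i) = z i) := by
  refine ⟨1, one_pos, fun ε hε _ k _ hk => ?_⟩
  obtain ⟨δ, hδ, H⟩ := be_main (E := EuclideanSpace ℝ (Fin D)) D (by simp) hD k hk (1 + ε) (by linarith)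
  refine ⟨δ, hδ, fun y z hy hz hyz => ?_⟩
  obtain ⟨Φ, ⟨h1, ⟨Ψ, h2, h3, h4⟩, h5⟩, h6⟩ := H y z hz (by
    intro i j
    by_cases hij : i = j
    · simp [hij]
    · obtain ⟨q1, q2⟩ := hyz i j hij
      have hp : 0 < dist (y i) (y j) := dist_pos.2 (fun h => hij (hy h))
      rw [div_le_iff₀ hp] at q2
      rw [le_div_iff₀ hp, inv_mul_le_iff₀ (by linarith)] at q1
      exact ⟨q1, q2⟩)
  have hbij : Function.Bijective Φ := ⟨h3.injective, h4.surjective⟩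
  refine ⟨Φ, hbij, h1, ?_, h5, h6⟩
  have : Function.invFun Φ = Ψ := by
    funext x
    apply h3.injective
    rw [Function.rightInverse_invFun h4.surjective x, h4 x]
  rw [this]
  exact h2
end

section
/- Let D ≥ 2, let ε > 0 be small enough (less than a constant depending only on D), let k with 1 ≤ k ≤ D, and let m be a positive integer. Then there exists λ_0 > 0 depending only on ε, m, D and, for each 0 < λ < λ_0, there exists δ > 0 depending only on λ, ε, m, D, such that the following holds: let y_1,...,y_k and z_1,...,z_k be k-point configurations in ℝ^D with y_1 = z_1, satisfying |y_i − y_j| ≥ λ^m · diam{y_1,...,y_k} for i ≠ j and (1+δ)^{-1} ≤ |z_i − z_j|/|y_i − y_j| ≤ 1+δ for i ≠ j. Then there exists an ε-distorted diffeomorphism Φ : ℝ^D → ℝ^D with Φ(y_i) = z_i for 1 ≤ i ≤ k and Φ(x) = x whenever |x − y_1| ≥ λ^{-1/2} · diam{y_1,...,y_k}. -/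
/-- A diffeomorphism `Φ : ℝ^D → ℝ^D` is `ε`-distorted if it is a smooth bijection with
smooth inverse and `(1+ε)⁻¹ I ≤ (DΦ(x))ᵀ (DΦ(x)) ≤ (1+ε) I` as quadratic forms, i.e.
`(1+ε)⁻¹ ‖v‖² ≤ ‖DΦ(x) v‖² ≤ (1+ε) ‖v‖²` for all `x, v`. -/
def IsDistorted (D : ℕ) (ε : ℝ)
    (Φ : EuclideanSpace ℝ (Fin D) → EuclideanSpace ℝ (Fin D)) : Prop :=
  Function.Bijective Φ ∧
  ContDiff ℝ (⊤ : ℕ∞) Φ ∧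
  ContDiff ℝ (⊤ : ℕ∞) (Function.invFun Φ) ∧
  ∀ (x v : EuclideanSpace ℝ (Fin D)),
    (1 + ε)⁻¹ * ‖v‖ ^ 2 ≤ ‖fderiv ℝ Φ x v‖ ^ 2 ∧
    ‖fderiv ℝ Φ x v‖ ^ 2 ≤ (1 + ε) * ‖v‖ ^ 2

open scoped NNReal

/-- Diffeomorphism, with it and its inverse `K`-Lipschitz. -/
def EAGood {E : Type*} [NormedAddCommGroup E] [NormedSpace ℝ E] (K : ℝ≥0) (Φ : E → E) : Prop :=
  ∃ Ψ : E → E, Function.LeftInverse Ψ Φ ∧ Function.RightInverse Ψ Φ ∧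
    ContDiff ℝ (⊤ : ℕ∞) Φ ∧ ContDiff ℝ (⊤ : ℕ∞) Ψ ∧ LipschitzWith K Φ ∧ LipschitzWith K Ψ

theorem EAGood.comp {E : Type*} [NormedAddCommGroup E] [NormedSpace ℝ E] {K L : ℝ≥0} {Φ Φ' : E → E}
    (h : EAGood K Φ) (h' : EAGood L Φ') : EAGood (K * L) (Φ ∘ Φ') := by
  obtain ⟨Ψ, a, b, c, d, e, f⟩ := h
  obtain ⟨Ψ', a', b', c', d', e', f'⟩ := h'
  exact ⟨Ψ' ∘ Ψ, a.comp a', b.comp b', c.comp c', d'.comp d, e.comp e', by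
    rw [mul_comm]; exact f'.comp f⟩

theorem EAGood.mono {E : Type*} [NormedAddCommGroup E] [NormedSpace ℝ E] {K L : ℝ≥0} {Φ : E → E}
    (h : EAGood K Φ) (hK : K ≤ L) : EAGood L Φ := by
  obtain ⟨Ψ, a, b, c, d, e, f⟩ := h
  exact ⟨Ψ, a, b, c, d, e.weaken hK, f.weaken hK⟩

theorem EAGood.id {E : Type*} [NormedAddCommGroup E] [NormedSpace ℝ E] :
    EAGood 1 (fun x : E => x) :=
  ⟨fun x => x, fun _ => rfl, fun _ => rfl, contDiff_id, contDiff_id,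
    LipschitzWith.id, LipschitzWith.id⟩

theorem EAGood.isDistorted {D : ℕ} {ε : ℝ} (hε : 0 < ε) {K : ℝ≥0}
    {Φ : EuclideanSpace ℝ (Fin D) → EuclideanSpace ℝ (Fin D)}
    (h : EAGood K Φ) (hK : (K : ℝ) ^ 2 ≤ 1 + ε) : IsDistorted D ε Φ := by
  obtain ⟨Ψ, a, b, c, d, e, f⟩ := h
  have hinv : Function.invFun Φ = Ψ := by
    funext x
    apply a.injective
    rw [b x]
    exact Function.invFun_eq ⟨Ψ x, b x⟩
  refine ⟨⟨a.injective, b.surjective⟩, c, hinv ▸ d, fun x v => ?_⟩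
  have h1 : ‖fderiv ℝ Φ x v‖ ≤ K * ‖v‖ :=
    (ContinuousLinearMap.le_opNorm _ _).trans
      (by gcongr; exact norm_fderiv_le_of_lipschitz ℝ e)
  have h2 : ‖v‖ ≤ K * ‖fderiv ℝ Φ x v‖ := by
    have : fderiv ℝ Ψ (Φ x) (fderiv ℝ Φ x v) = v := by
      have hc : fderiv ℝ (Ψ ∘ Φ) x = (fderiv ℝ Ψ (Φ x)).comp (fderiv ℝ Φ x) :=
        fderiv_comp x (d.differentiable (by simp) _) (c.differentiable (by simp) _)
      have hid : Ψ ∘ Φ = _root_.id := funext a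
      rw [hid, fderiv_id] at hc
      have := congrArg (fun T => T v) hc
      simpa using this.symm
    calc ‖v‖ = ‖fderiv ℝ Ψ (Φ x) (fderiv ℝ Φ x v)‖ := by rw [this]
      _ ≤ _ := (ContinuousLinearMap.le_opNorm _ _).trans
        (by gcongr; exact norm_fderiv_le_of_lipschitz ℝ f)
  have hv := norm_nonneg v
  have hw := norm_nonneg (fderiv ℝ Φ x v)
  constructor
  · rw [inv_mul_le_iff₀ (by linarith)]
    calc ‖v‖ ^ 2 ≤ (K * ‖fderiv ℝ Φ x v‖) ^ 2 := by gcongr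
      _ = (K : ℝ) ^ 2 * ‖fderiv ℝ Φ x v‖ ^ 2 := by ring
      _ ≤ _ := by gcongr
  · calc ‖fderiv ℝ Φ x v‖ ^ 2 ≤ (K * ‖v‖) ^ 2 := by gcongr
      _ = (K : ℝ) ^ 2 * ‖v‖ ^ 2 := by ring
      _ ≤ _ := by gcongr

theorem EAGood.conj {E : Type*} [NormedAddCommGroup E] [NormedSpace ℝ E] {K : ℝ≥0} {Φ : E → E}
    (h : EAGood K Φ) (a : E) {d : ℝ} (hd : 0 < d) :
    EAGood K (fun x => a + d • Φ (d⁻¹ • (x - a))) := by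
  obtain ⟨Ψ, l, r, c, c', e, f⟩ := h
  have key : ∀ F : E → E, LipschitzWith K F →
      LipschitzWith K (fun x => a + d • F (d⁻¹ • (x - a))) := by
    intro F hF
    refine LipschitzWith.of_dist_le_mul fun x y => ?_
    have := hF.dist_le_mul (d⁻¹ • (x - a)) (d⁻¹ • (y - a))
    rw [dist_smul₀, dist_sub_right] at this
    rw [dist_add_left, dist_smul₀]
    simp only [Real.norm_eq_abs, abs_of_pos hd, abs_of_pos (inv_pos.2 hd)] at *
    calc _ ≤ d * (K * (d⁻¹ * dist x y)) := mul_le_mul_of_nonneg_left this hd.le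
      _ = K * dist x y * (d * d⁻¹) := by ring
      _ = _ := by rw [mul_inv_cancel₀ hd.ne', mul_one]
  refine ⟨fun x => a + d • Ψ (d⁻¹ • (x - a)), fun x => ?_, fun x => ?_, ?_, ?_, key _ e, key _ f⟩
  · simp [smul_smul, hd.ne', l _]
  · simp [smul_smul, hd.ne', r _]
  · fun_prop
  · fun_prop

/-- Perturbation of the identity. -/
theorem EAGood.id_add {E : Type*} [NormedAddCommGroup E] [NormedSpace ℝ E] [CompleteSpace E]
    {c : ℝ≥0} (hc : c < 1)
    {f : E → E} (hf : ContDiff ℝ (⊤ : ℕ∞) f) (hl : LipschitzWith c f) :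
    EAGood (1 - c)⁻¹ (fun x => x + f x) := by
  rcases subsingleton_or_nontrivial E with hE | hE
  · exact ⟨fun x => x, fun _ => Subsingleton.elim _ _, fun _ => Subsingleton.elim _ _,
      contDiff_of_subsingleton, contDiff_of_subsingleton,
      LipschitzWith.of_dist_le_mul fun x y => by simp [Subsingleton.elim x y],
      LipschitzWith.of_dist_le_mul fun x y => by simp [Subsingleton.elim x y]⟩
  have hd : ContDiff ℝ (⊤ : ℕ∞) (fun x => x + f x) := by fun_prop
  have hA : ApproximatesLinearOn (fun x => x + f x)
      ((ContinuousLinearEquiv.refl ℝ E : E ≃L[ℝ] E) : E →L[ℝ] E) Set.univ c := by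
    intro x _ y _
    have := hl.dist_le_mul x y
    rw [dist_eq_norm, dist_eq_norm] at this
    simpa [add_sub_add_comm] using this
  have hN : ‖((ContinuousLinearEquiv.refl ℝ E).symm : E →L[ℝ] E)‖₊ = 1 := by
    have : ((ContinuousLinearEquiv.refl ℝ E).symm : E →L[ℝ] E) = ContinuousLinearMap.id ℝ E := rfl
    rw [this]; simp
  have hc' : Subsingleton E ∨ c < ‖((ContinuousLinearEquiv.refl ℝ E).symm : E →L[ℝ] E)‖₊⁻¹ :=
    Or.inr (by rw [hN]; simpa using hc)
  let H : E ≃ₜ E := ApproximatesLinearOn.toHomeomorph _ hA hc'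
  have hHf : ∀ x, H x = x + f x := fun x => rfl
  have hcl : (c : ℝ) < 1 := by exact_mod_cast hc
  have hanti : ∀ x y, (1 - (c : ℝ)) * dist x y ≤ dist (x + f x) (y + f y) := by
    intro x y
    have h1 := hl.dist_le_mul x y
    have h2 : dist x y ≤ dist (x + f x) (y + f y) + dist (f x) (f y) := by
      simp only [dist_eq_norm]
      calc ‖x - y‖ = ‖(x + f x - (y + f y)) - (f x - f y)‖ := by congr 1; abel
        _ ≤ _ := norm_sub_le _ _
    linarith
  have hcoe : (((1 - c)⁻¹ : ℝ≥0) : ℝ) = (1 - (c : ℝ))⁻¹ := by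
    rw [NNReal.coe_inv, NNReal.coe_sub hc.le]; simp
  have hpos : 0 < 1 - (c : ℝ) := by linarith
  refine ⟨H.symm, fun x => ?_, fun x => ?_, hd, ?_, ?_, ?_⟩
  · exact H.symm_apply_apply x
  · change H _ = x
    exact H.apply_symm_apply x
  · have hinj : ∀ x, Function.Bijective (fderiv ℝ (fun x => x + f x) x) := by
      intro x
      have e1 : fderiv ℝ (fun x => x + f x) x = ContinuousLinearMap.id ℝ E + fderiv ℝ f x := by
        have := (hf.differentiable (by simp) x)
        rw [fderiv_fun_add differentiableAt_fun_id this]; simp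
      have hlt : ‖-(fderiv ℝ f x)‖ < 1 := by
        rw [norm_neg]
        exact (norm_fderiv_le_of_lipschitz ℝ hl).trans_lt hcl
      have hu : IsUnit (1 - (-(fderiv ℝ f x))) := isUnit_one_sub_of_norm_lt_one hlt
      rw [sub_neg_eq_add] at hu
      rw [e1]
      exact (ContinuousLinearMap.isUnit_iff_bijective).1 hu
    let F : E → E ≃L[ℝ] E := fun x =>
      ContinuousLinearEquiv.ofBijective (fderiv ℝ (fun x => x + f x) x)
        (LinearMap.ker_eq_bot.2 (hinj x).1) (LinearMap.range_eq_top.2 (hinj x).2)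
    refine H.contDiff_symm (f₀' := F) (fun x => ?_) hd
    exact (hd.differentiable (by simp) x).hasFDerivAt
  · refine LipschitzWith.of_dist_le_mul fun x y => ?_
    have h1 := hl.dist_le_mul x y
    have h2 := dist_add_add_le x (f x) y (f y)
    rw [hcoe]
    have : 1 + (c : ℝ) ≤ (1 - (c : ℝ))⁻¹ := by
      rw [← one_div, le_div_iff₀ hpos]; nlinarith [sq_nonneg (c : ℝ)]
    calc _ ≤ (1 + (c : ℝ)) * dist x y := by linarith
      _ ≤ _ := by gcongr
  · refine LipschitzWith.of_dist_le_mul fun x y => ?_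
    rw [hcoe, ← div_eq_inv_mul, le_div_iff₀ hpos, mul_comm]
    have := hanti (H.symm x) (H.symm y)
    rw [← hHf, ← hHf, H.apply_symm_apply, H.apply_symm_apply] at this
    exact this

/-- Existence of a linear isometry matching two configurations. -/
theorem ea_exists_isometry {E : Type*} [NormedAddCommGroup E] [InnerProductSpace ℝ E]
    [FiniteDimensional ℝ E] {k : ℕ} (y z : Fin k → E) (i0 : Fin k) (hy : y i0 = 0) (hz : z i0 = 0)
    (h : ∀ i j, dist (z i) (z j) = dist (y i) (y j)) :
    ∃ A : E ≃ₗᵢ[ℝ] E, ∀ i, A (y i) = z i := by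
  have hn : ∀ i, ‖z i‖ = ‖y i‖ := fun i => by
    have := h i i0
    simpa [hy, hz] using this
  have hin : ∀ i j, inner ℝ (z i) (z j) = inner ℝ (y i) (y j) := by
    intro i j
    have h1 := norm_sub_sq_real (z i) (z j)
    have h2 := norm_sub_sq_real (y i) (y j)
    have h3 := h i j
    rw [dist_eq_norm, dist_eq_norm] at h3
    rw [h3, hn, hn] at h1
    linarith
  let f : (Fin k → ℝ) →ₗ[ℝ] E := Fintype.linearCombination ℝ y
  let g : (Fin k → ℝ) →ₗ[ℝ] E := Fintype.linearCombination ℝ z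
  have hfg : ∀ c, ‖g c‖ = ‖f c‖ := by
    intro c
    rw [← sq_eq_sq₀ (norm_nonneg _) (norm_nonneg _), ← real_inner_self_eq_norm_sq,
      ← real_inner_self_eq_norm_sq]
    simp only [f, g, Fintype.linearCombination_apply, sum_inner, inner_sum, inner_smul_left,
      inner_smul_right, hin]
  obtain ⟨s, hs⟩ := LinearMap.exists_rightInverse_of_surjective f.rangeRestrict
    f.range_rangeRestrict
  have hs' : ∀ x, f (s x) = (x : E) := fun x => by
    have := congrArg (fun T => ((T x : LinearMap.range f) : E)) hs
    simpa using this
  let L : (LinearMap.range f) →ₗᵢ[ℝ] E := ⟨g ∘ₗ s, fun x => by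
    simp only [LinearMap.comp_apply]
    rw [hfg, hs']; rfl⟩
  refine ⟨L.extend.toLinearIsometryEquiv rfl, fun i => ?_⟩
  have hyi : f (Pi.single i 1) = y i := by simp [f]
  have hzi : g (Pi.single i 1) = z i := by simp [g]
  have h1 : L.extend (y i) = L ⟨y i, ⟨_, hyi⟩⟩ := L.extend_apply ⟨y i, ⟨_, hyi⟩⟩
  have h2 : L ⟨y i, ⟨_, hyi⟩⟩ = g (s ⟨y i, ⟨_, hyi⟩⟩) := rfl
  change L.extend (y i) = z i
  rw [h1, h2, ← hzi, ← sub_eq_zero, ← map_sub, ← norm_eq_zero, hfg, map_sub, hs', hyi]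
  simp

/-- Reflection in the hyperplane orthogonal to `w`. -/
noncomputable def earef {E : Type*} [NormedAddCommGroup E] [InnerProductSpace ℝ E]
    (w : E) : E ≃ₗᵢ[ℝ] E := (ℝ ∙ w)ᗮ.reflection

theorem earef_apply {E : Type*} [NormedAddCommGroup E] [InnerProductSpace ℝ E]
    (w x : E) : earef w x = x - (2 * (inner ℝ w x / ‖w‖ ^ 2)) • w := by
  rw [earef, Submodule.reflection_orthogonal_apply, Submodule.reflection_singleton_apply]
  simp only [two_smul, two_mul, add_smul, RCLike.ofReal_real_eq_id, id_eq]
  abel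

theorem earef_zero {E : Type*} [NormedAddCommGroup E] [InnerProductSpace ℝ E] :
    earef (0 : E) = 1 := by
  ext x; simp [earef_apply]

theorem earef_list_filter {E : Type*} [NormedAddCommGroup E] [InnerProductSpace ℝ E]
    (l : List E) : ∃ l' : List E, l'.length ≤ l.length ∧ (∀ v ∈ l', v ≠ 0) ∧
      (l'.map earef).prod = (l.map earef).prod := by
  induction l with
  | nil => exact ⟨[], by simp⟩
  | cons a l ih =>
    obtain ⟨l', h1, h2, h3⟩ := ih
    by_cases ha : a = 0
    · refine ⟨l', by simp; omega, h2, ?_⟩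
      simp [ha, earef_zero, h3]
    · refine ⟨a :: l', by simp; omega, ?_, by simp [h3]⟩
      intro v hv
      rcases List.mem_cons.1 hv with rfl | hv
      · exact ha
      · exact h2 v hv

/-- An isometry which is a product of at most `n` pairs of reflections. -/
def EARot {E : Type*} [NormedAddCommGroup E] [InnerProductSpace ℝ E] (n : ℕ)
    (A : E ≃ₗᵢ[ℝ] E) : Prop :=
  ∃ l : List (E × E), l.length ≤ n ∧ (∀ p ∈ l, p.1 ≠ 0 ∧ p.2 ≠ 0) ∧
    (l.map fun p => earef p.1 * earef p.2).prod = A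

theorem earef_list_pairs {E : Type*} [NormedAddCommGroup E] [InnerProductSpace ℝ E] :
    ∀ l : List E, Even l.length → (∀ v ∈ l, v ≠ 0) → EARot l.length (l.map earef).prod
  | [], _, _ => ⟨[], by simp⟩
  | [a], h, _ => by simp at h
  | a :: b :: l, h, h' => by
    obtain ⟨L, h1, h2, h3⟩ := earef_list_pairs l (by
      simp only [List.length_cons] at h
      rcases h with ⟨r, hr⟩
      exact ⟨r - 1, by omega⟩) (fun v hv => h' v (by simp [hv]))
    refine ⟨(a, b) :: L, by simp; omega, ?_, ?_⟩
    · intro p hp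
      rcases List.mem_cons.1 hp with rfl | hp
      · exact ⟨h' _ (by simp), h' _ (by simp)⟩
      · exact h2 p hp
    · simp [h3, mul_assoc]

theorem ea_exists_rot {E : Type*} [NormedAddCommGroup E] [InnerProductSpace ℝ E]
    [FiniteDimensional ℝ E] {k : ℕ} (hk : k ≤ Module.finrank ℝ E)
    (y z : Fin k → E) (i0 : Fin k) (hy : y i0 = 0) (hz : z i0 = 0)
    (h : ∀ i j, dist (z i) (z j) = dist (y i) (y j)) :
    ∃ A : E ≃ₗᵢ[ℝ] E, EARot (Module.finrank ℝ E + 1) A ∧ ∀ i, A (y i) = z i := by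
  obtain ⟨A, hA⟩ := ea_exists_isometry y z i0 hy hz h
  obtain ⟨l0, hl0, hAl0⟩ := A.reflections_generate_dim
  obtain ⟨l, h1, h2, h3⟩ := earef_list_filter l0
  have hAl : (l.map earef).prod = A := by rw [h3, hAl0]; rfl
  have mono : ∀ {n m : ℕ} {B : E ≃ₗᵢ[ℝ] E}, n ≤ m → EARot n B → EARot m B := by
    rintro n m B hnm ⟨L, a, b⟩
    exact ⟨L, a.trans hnm, b⟩
  by_cases he : Even l.length
  · exact ⟨A, mono (by omega) (hAl ▸ earef_list_pairs l he h2), hA⟩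
  · obtain ⟨w, hw0, hw⟩ : ∃ w : E, w ≠ 0 ∧ ∀ i, inner ℝ w (y i) = 0 := by
      let b : {i : Fin k // i ≠ i0} → E := fun i => y i
      have hb : (Set.range b).finrank ℝ ≤ _ := finrank_range_le_card b
      have hcard : Fintype.card {i : Fin k // i ≠ i0} = k - 1 := by
        simp [Fintype.card_subtype_compl]
      have hkpos : 0 < k := i0.pos
      have hne : (Submodule.span ℝ (Set.range b))ᗮ ≠ ⊥ := by
        intro hbot
        rw [Submodule.orthogonal_eq_bot_iff] at hbot
        rw [Set.finrank, hbot, finrank_top, hcard] at hb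
        omega
      obtain ⟨w, hw, hw0⟩ := Submodule.exists_mem_ne_zero_of_ne_bot hne
      refine ⟨w, hw0, fun i => ?_⟩
      by_cases hi : i = i0
      · simp [hi, hy]
      · exact (Submodule.mem_orthogonal' _ _).1 hw (y i)
          (Submodule.subset_span ⟨⟨i, hi⟩, rfl⟩)
    refine ⟨A * earef w, ?_, fun i => ?_⟩
    · have := earef_list_pairs (l ++ [w]) (by
        simp only [List.length_append, List.length_cons, List.length_nil]
        exact (Nat.not_even_iff_odd.1 he).add_one) (by
        intro v hv
        rcases List.mem_append.1 hv with hv | hv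
        · exact h2 v hv
        · simp at hv; exact hv ▸ hw0)
      have e : ((l ++ [w]).map earef).prod = A * earef w := by simp [hAl]
      rw [e] at this
      refine mono ?_ this
      simp; omega
    · have : earef w (y i) = y i := by rw [earef_apply, hw i]; simp
      change A (earef w (y i)) = _
      rw [this, hA]

/-- Approximate version by compactness. -/
theorem ea_approx {E : Type*} [NormedAddCommGroup E] [InnerProductSpace ℝ E]
    [FiniteDimensional ℝ E] {k : ℕ} (hk : k ≤ Module.finrank ℝ E) (i0 : Fin k)
    {η : ℝ} (hη : 0 < η) :
    ∃ δ > (0 : ℝ), ∀ y z : Fin k → E, y i0 = 0 → z i0 = 0 → (∀ i, ‖y i‖ ≤ 1) → (∀ i, ‖z i‖ ≤ 2) →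
      (∀ i j, |dist (z i) (z j) - dist (y i) (y j)| < δ) →
      ∃ A : E ≃ₗᵢ[ℝ] E, EARot (Module.finrank ℝ E + 1) A ∧ ∀ i, ‖z i - A (y i)‖ < η := by
  let S : Set ((Fin k → E) × (Fin k → E)) :=
    {p | p.1 i0 = 0 ∧ p.2 i0 = 0 ∧ (∀ i, ‖p.1 i‖ ≤ 1) ∧ (∀ i, ‖p.2 i‖ ≤ 2) ∧
      ∀ A : E ≃ₗᵢ[ℝ] E, EARot (Module.finrank ℝ E + 1) A → ∃ i, η ≤ ‖p.2 i - A (p.1 i)‖}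
  have hSclosed : IsClosed S := by
    refine (isClosed_eq (by fun_prop) (by fun_prop)).inter
      ((isClosed_eq (by fun_prop) (by fun_prop)).inter (IsClosed.inter ?_ (IsClosed.inter ?_ ?_)))
    · change IsClosed {p : (Fin k → E) × (Fin k → E) | ∀ i, ‖p.1 i‖ ≤ 1}
      simp only [Set.ofPred_forall]
      exact isClosed_iInter fun i => isClosed_le (by fun_prop) (by fun_prop)
    · change IsClosed {p : (Fin k → E) × (Fin k → E) | ∀ i, ‖p.2 i‖ ≤ 2}
      simp only [Set.ofPred_forall]
      exact isClosed_iInter fun i => isClosed_le (by fun_prop) (by fun_prop)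
    · change IsClosed {p : (Fin k → E) × (Fin k → E) | ∀ A : E ≃ₗᵢ[ℝ] E,
        EARot (Module.finrank ℝ E + 1) A → ∃ i, η ≤ ‖p.2 i - A (p.1 i)‖}
      simp only [Set.ofPred_forall, Set.ofPred_exists]
      refine isClosed_iInter fun A => isClosed_iInter fun _ => isClosed_iUnion_of_finite fun i => ?_
      have := A.continuous
      exact isClosed_le (by fun_prop) (by fun_prop)
  have hScpt : IsCompact S := by
    refine IsCompact.of_isClosed_subset (isCompact_closedBall (0 : (Fin k → E) × (Fin k → E)) 2)
      hSclosed ?_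
    rintro ⟨y, z⟩ ⟨-, -, h1, h2, -⟩
    rw [mem_closedBall_zero_iff, Prod.norm_def, max_le_iff,
      pi_norm_le_iff_of_nonneg (by norm_num), pi_norm_le_iff_of_nonneg (by norm_num)]
    exact ⟨fun i => (h1 i).trans (by norm_num), h2⟩
  let F : (Fin k → E) × (Fin k → E) → ℝ :=
    fun p => ∑ i, ∑ j, |dist (p.2 i) (p.2 j) - dist (p.1 i) (p.1 j)|
  have hF : Continuous F := by fun_prop
  have hFpos : ∀ p ∈ S, 0 < F p := by
    rintro ⟨y, z⟩ ⟨hy, hz, -, -, h5⟩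
    have h0 : 0 ≤ F (y, z) := Finset.sum_nonneg fun i _ => Finset.sum_nonneg fun j _ => abs_nonneg _
    refine lt_of_le_of_ne h0 fun h => ?_
    have hd : ∀ i j, dist (z i) (z j) = dist (y i) (y j) := by
      intro i j
      have h1 := (Finset.sum_eq_zero_iff_of_nonneg
        (fun i _ => Finset.sum_nonneg fun j _ => abs_nonneg _)).1 h.symm i (Finset.mem_univ _)
      have h2 := (Finset.sum_eq_zero_iff_of_nonneg
        (fun j _ => abs_nonneg _)).1 h1 j (Finset.mem_univ _)
      exact sub_eq_zero.1 (abs_eq_zero.1 h2)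
    obtain ⟨A, hA, hA'⟩ := ea_exists_rot hk y z i0 hy hz hd
    obtain ⟨i, hi⟩ := h5 A hA
    simp [hA'] at hi
    linarith
  obtain ⟨μ, hμ, hμS⟩ : ∃ μ > (0 : ℝ), ∀ p ∈ S, μ ≤ F p := by
    rcases S.eq_empty_or_nonempty with he | hne
    · exact ⟨1, one_pos, fun p hp => by simp [he] at hp⟩
    · obtain ⟨p, hp, hmin⟩ := hScpt.exists_isMinOn hne hF.continuousOn
      exact ⟨F p, hFpos p hp, fun q hq => hmin hq⟩
  have hkpos : (0 : ℝ) < k := by exact_mod_cast i0.pos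
  refine ⟨μ / (k * k), by positivity, fun y z hy hz h1 h2 h3 => ?_⟩
  by_contra hcon
  push Not at hcon
  have hle := hμS (y, z) ⟨hy, hz, h1, h2, hcon⟩
  have hlt : F (y, z) < ∑ i : Fin k, ∑ j : Fin k, μ / (k * k) := by
    have : Nonempty (Fin k) := ⟨i0⟩
    refine Finset.sum_lt_sum_of_nonempty Finset.univ_nonempty fun i _ =>
      Finset.sum_lt_sum_of_nonempty Finset.univ_nonempty fun j _ => h3 i j
  have : ∑ i : Fin k, ∑ j : Fin k, μ / ((k : ℝ) * k) = μ := by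
    simp; field_simp
  linarith

theorem earef_smul {E : Type*} [NormedAddCommGroup E] [InnerProductSpace ℝ E]
    {c : ℝ} (hc : c ≠ 0) (w : E) : earef (c • w) = earef w := by
  ext x
  by_cases hw : w = 0
  · simp [hw]
  have hn : ‖w‖ ≠ 0 := norm_ne_zero_iff.2 hw
  rw [earef_apply, earef_apply, inner_smul_left, norm_smul, smul_smul, mul_pow,
    Real.norm_eq_abs, sq_abs]
  congr 2
  simp only [conj_trivial]
  field_simp

theorem earef_earef {E : Type*} [NormedAddCommGroup E] [InnerProductSpace ℝ E]
    (w x : E) : earef w (earef w x) = x := Submodule.reflection_reflection _ _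

theorem earef_lip {E : Type*} [NormedAddCommGroup E] [InnerProductSpace ℝ E]
    (w w' x : E) (hw : 1 / 2 ≤ ‖w‖) (hw' : 1 / 2 ≤ ‖w'‖) :
    ‖earef w x - earef w' x‖ ≤ 16 * ‖w - w'‖ * ‖x‖ := by
  have p : 0 < ‖w‖ := by linarith
  have p' : 0 < ‖w'‖ := by linarith
  rw [← earef_smul (inv_ne_zero p.ne') w, ← earef_smul (inv_ne_zero p'.ne') w']
  have hdist : ‖‖w‖⁻¹ • w - ‖w'‖⁻¹ • w'‖ ≤ 4 * ‖w - w'‖ := by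
    have e : ‖w‖⁻¹ • w - ‖w'‖⁻¹ • w' = ‖w‖⁻¹ • (w - w') + (‖w‖⁻¹ - ‖w'‖⁻¹) • w' := by
      module
    have h1 : ‖(‖w‖⁻¹ - ‖w'‖⁻¹) • w'‖ ≤ ‖w‖⁻¹ * ‖w - w'‖ := by
      rw [norm_smul, Real.norm_eq_abs]
      have : ‖w‖⁻¹ - ‖w'‖⁻¹ = (‖w'‖ - ‖w‖) * (‖w‖⁻¹ * ‖w'‖⁻¹) := by field_simp
      rw [this, abs_mul, abs_of_pos (by positivity : 0 < ‖w‖⁻¹ * ‖w'‖⁻¹)]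
      calc |‖w'‖ - ‖w‖| * (‖w‖⁻¹ * ‖w'‖⁻¹) * ‖w'‖ = ‖w‖⁻¹ * |‖w'‖ - ‖w‖| := by field_simp
        _ ≤ ‖w‖⁻¹ * ‖w - w'‖ := by
          gcongr
          rw [abs_sub_comm]
          exact abs_norm_sub_norm_le w w'
    have h2 : ‖w‖⁻¹ ≤ 2 := by
      rw [inv_le_comm₀ p (by norm_num)]; linarith
    rw [e]
    refine (norm_add_le _ _).trans ?_
    rw [norm_smul, norm_inv, norm_norm]
    have := mul_le_mul_of_nonneg_right h2 (norm_nonneg (w - w'))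
    linarith
  have n1 : ‖‖w‖⁻¹ • w‖ = 1 := by rw [norm_smul, norm_inv, norm_norm]; field_simp
  have n2 : ‖‖w'‖⁻¹ • w'‖ = 1 := by rw [norm_smul, norm_inv, norm_norm]; field_simp
  generalize ‖w‖⁻¹ • w = a at *
  generalize ‖w'‖⁻¹ • w' = b at *
  rw [earef_apply, earef_apply, n1, n2]
  have e : x - (2 * (inner ℝ a x / 1 ^ 2)) • a - (x - (2 * (inner ℝ b x / 1 ^ 2)) • b)
      = (2 * inner ℝ b x) • (b - a) + (2 * inner ℝ (b - a) x) • a := by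
    rw [inner_sub_left]
    simp only [one_pow, div_one]
    module
  rw [e]
  have i1 : |inner ℝ b x| ≤ ‖x‖ := by simpa [n2] using abs_real_inner_le_norm b x
  have i2 : |inner ℝ (b - a) x| ≤ ‖b - a‖ * ‖x‖ := abs_real_inner_le_norm _ _
  rw [norm_sub_rev] at hdist
  have hx := norm_nonneg x
  have hba := norm_nonneg (b - a)
  calc _ ≤ _ := norm_add_le _ _
    _ = 2 * |inner ℝ b x| * ‖b - a‖ + 2 * |inner ℝ (b - a) x| := by
      rw [norm_smul, norm_smul, n1]; simp
    _ ≤ 2 * ‖x‖ * ‖b - a‖ + 2 * (‖b - a‖ * ‖x‖) := by gcongr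
    _ = 4 * ‖b - a‖ * ‖x‖ := by ring
    _ ≤ 4 * (4 * ‖w - w'‖) * ‖x‖ := by gcongr
    _ = _ := by ring

theorem ea_smoothTransition_lip : ∃ C : ℝ≥0, LipschitzWith C Real.smoothTransition := by
  have h1 : ContDiff ℝ 1 Real.smoothTransition := Real.smoothTransition.contDiff (n := 1)
  obtain ⟨C, hC⟩ := (h1.locallyLipschitz.locallyLipschitzOn
    (s := Set.Icc 0 1)).exists_lipschitzOnWith_of_compact isCompact_Icc
  refine ⟨C, LipschitzWith.of_dist_le_mul fun x y => ?_⟩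
  rw [← Real.smoothTransition.projIcc (x := x), ← Real.smoothTransition.projIcc (x := y)]
  refine (hC.dist_le_mul _ (Subtype.prop _) _ (Subtype.prop _)).trans ?_
  have := (LipschitzWith.projIcc (zero_le_one (α := ℝ))).dist_le_mul x y
  rw [NNReal.coe_one, one_mul] at this
  gcongr
  exact this

/-- the logarithmic cutoff -/
noncomputable def eacut {E : Type*} [NormedAddCommGroup E] (L : ℝ) (x : E) : ℝ :=
  Real.smoothTransition ((Real.log (1 + ‖x‖ ^ 2) - Real.log 2) / L)

theorem eacut_lip_aux {E : Type*} [NormedAddCommGroup E] {C : ℝ≥0}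
    (hC : LipschitzWith C Real.smoothTransition) {L : ℝ} (hL : 0 < L) (x y : E) (h : ‖y‖ ≤ ‖x‖) :
    |eacut L x - eacut L y| * ‖y‖ ≤ 2 * C / L * ‖x - y‖ := by
  rcases (norm_nonneg y).eq_or_lt with h0 | h0
  · rw [← h0, mul_zero]; positivity
  have hx : 0 < ‖x‖ := h0.trans_le h
  have h1 := hC.dist_le_mul ((Real.log (1 + ‖x‖ ^ 2) - Real.log 2) / L)
    ((Real.log (1 + ‖y‖ ^ 2) - Real.log 2) / L)
  rw [Real.dist_eq, Real.dist_eq, ← sub_div, sub_sub_sub_cancel_right, abs_div, abs_of_pos hL] at h1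
  have hlog : |Real.log (1 + ‖x‖ ^ 2) - Real.log (1 + ‖y‖ ^ 2)| ≤ 2 * (‖x - y‖ / ‖y‖) := by
    rw [abs_of_nonneg (sub_nonneg.2 (Real.log_le_log (by positivity) (by gcongr))),
      ← Real.log_div (by positivity) (by positivity)]
    have a1 : (1 + ‖x‖ ^ 2) / (1 + ‖y‖ ^ 2) ≤ (‖x‖ / ‖y‖) ^ 2 := by
      rw [div_pow, div_le_div_iff₀ (by positivity) (by positivity)]
      have : ‖y‖ ^ 2 ≤ ‖x‖ ^ 2 := by gcongr
      nlinarith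
    calc _ ≤ Real.log ((‖x‖ / ‖y‖) ^ 2) := Real.log_le_log (by positivity) a1
      _ = 2 * Real.log (‖x‖ / ‖y‖) := by rw [Real.log_pow]; norm_num
      _ ≤ 2 * (‖x‖ / ‖y‖ - 1) := by gcongr; exact Real.log_le_sub_one_of_pos (by positivity)
      _ = 2 * ((‖x‖ - ‖y‖) / ‖y‖) := by field_simp
      _ ≤ _ := by gcongr; exact norm_sub_norm_le x y
  calc _ ≤ (C * (|Real.log (1 + ‖x‖ ^ 2) - Real.log (1 + ‖y‖ ^ 2)| / L)) * ‖y‖ := by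
        gcongr; exact h1
    _ ≤ (C * ((2 * (‖x - y‖ / ‖y‖)) / L)) * ‖y‖ := by gcongr
    _ = _ := by field_simp

theorem ea_twist_core {E : Type*} [NormedAddCommGroup E] [InnerProductSpace ℝ E] {C : ℝ≥0}
    (hC : LipschitzWith C Real.smoothTransition) {L : ℝ} (hL : 0 < L) {κ : ℝ≥0}
    (hκ : 1 + 64 * C / L ≤ κ) {u v : E} (hu : ‖u‖ = 1) (hv : ‖v‖ = 1) (huv : 0 ≤ inner ℝ u v) :
    ∃ T : E → E, EAGood κ T ∧ (∀ x, ‖T x‖ = ‖x‖) ∧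
      (∀ x, ‖x‖ ≤ 1 → T x = earef u (earef v x)) ∧
      (∀ x, L ≤ Real.log (1 + ‖x‖ ^ 2) - Real.log 2 → T x = x) := by
  let w : ℝ → E := fun t => (1 - t) • v + t • u
  have hw : ∀ t, 0 ≤ t → t ≤ 1 → 1 / 2 ≤ ‖w t‖ := by
    intro t h0 h1
    have e : ‖w t‖ ^ 2 = (1 - t) ^ 2 + t ^ 2 + 2 * (t * (1 - t)) * inner ℝ u v := by
      simp only [w]
      rw [norm_add_sq_real, norm_smul, norm_smul, inner_smul_left, inner_smul_right, hu, hv,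
        real_inner_comm]
      simp
      ring
    have : 0 ≤ (t * (1 - t)) * inner ℝ u v :=
      mul_nonneg (mul_nonneg h0 (by linarith)) huv
    nlinarith [norm_nonneg (w t), sq_nonneg (2 * t - 1)]
  let f : E → ℝ := eacut L
  have hf0 : ∀ x, 0 ≤ f x := fun x => Real.smoothTransition.nonneg _
  have hf1 : ∀ x, f x ≤ 1 := fun x => Real.smoothTransition.le_one _
  have hfn : ∀ x y : E, ‖x‖ = ‖y‖ → f x = f y := fun x y h => by simp only [f, eacut, h]
  let Ψ : E → E := fun x => earef (w (f x)) x
  have hΨn : ∀ x, ‖Ψ x‖ = ‖x‖ := fun x => LinearIsometryEquiv.norm_map _ _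
  have hΨΨ : ∀ x, Ψ (Ψ x) = x := by
    intro x
    have : f (Ψ x) = f x := hfn _ _ (hΨn x)
    change earef (w (f (Ψ x))) (Ψ x) = x
    rw [this]
    exact earef_earef _ _
  have hfs : ContDiff ℝ (⊤ : ℕ∞) f := by
    refine (Real.smoothTransition.contDiff (n := ⊤)).comp ?_
    refine ContDiff.div_const (ContDiff.sub (ContDiff.log ?_ ?_) contDiff_const) _
    · exact contDiff_const.add (contDiff_norm_sq ℝ)
    · intro x; positivity
  have hΨs : ContDiff ℝ (⊤ : ℕ∞) Ψ := by
    have e : Ψ = fun x => x - (2 * (inner ℝ (w (f x)) x / ‖w (f x)‖ ^ 2)) • w (f x) :=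
      funext fun x => earef_apply _ _
    have hws : ContDiff ℝ (⊤ : ℕ∞) (fun x => w (f x)) := by
      simp only [w]; fun_prop
    rw [e]
    refine contDiff_id.sub (ContDiff.smul (contDiff_const.mul (ContDiff.div
      (hws.inner ℝ contDiff_id) (hws.norm_sq ℝ) ?_)) hws)
    intro x
    have := hw _ (hf0 x) (hf1 x)
    positivity
  have hlip1 : ∀ x y, ‖y‖ ≤ ‖x‖ → dist (Ψ x) (Ψ y) ≤ κ * dist x y := by
    intro x y hxy
    have h1 : dist (earef (w (f x)) x) (earef (w (f x)) y) = dist x y :=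
      (earef (w (f x))).dist_map x y
    have h2 : dist (earef (w (f x)) y) (earef (w (f y)) y) ≤ 64 * C / L * dist x y := by
      rw [dist_eq_norm, dist_eq_norm]
      refine (earef_lip _ _ y (hw _ (hf0 x) (hf1 x)) (hw _ (hf0 y) (hf1 y))).trans ?_
      have e : w (f x) - w (f y) = (f x - f y) • (u - v) := by simp only [w]; module
      have huv2 : ‖u - v‖ ≤ 2 := (norm_sub_le _ _).trans (by rw [hu, hv]; norm_num)
      rw [e, norm_smul, Real.norm_eq_abs]
      have h3 := eacut_lip_aux hC hL x y hxy
      calc 16 * (|f x - f y| * ‖u - v‖) * ‖y‖ ≤ 16 * (|f x - f y| * 2) * ‖y‖ := by gcongr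
        _ = 32 * (|eacut L x - eacut L y| * ‖y‖) := by simp only [f]; ring
        _ ≤ 32 * (2 * C / L * ‖x - y‖) := by gcongr
        _ = _ := by ring
    calc _ ≤ _ := dist_triangle _ (earef (w (f x)) y) _
      _ ≤ dist x y + 64 * C / L * dist x y := add_le_add h1.le h2
      _ = (1 + 64 * C / L) * dist x y := by ring
      _ ≤ _ := by gcongr
  have hlip : LipschitzWith κ Ψ := by
    refine LipschitzWith.of_dist_le_mul fun x y => ?_
    rcases le_total ‖y‖ ‖x‖ with h | h
    · exact hlip1 x y h
    · rw [dist_comm, dist_comm x]; exact hlip1 y x h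
  have hG : EAGood κ Ψ := ⟨Ψ, hΨΨ, hΨΨ, hΨs, hΨs, hlip, hlip⟩
  have hr : EAGood 1 (earef u) := ⟨earef u, earef_earef u, earef_earef u,
    (earef u).contDiff, (earef u).contDiff, (earef u).lipschitz, (earef u).lipschitz⟩
  refine ⟨earef u ∘ Ψ, by simpa using hr.comp hG, fun x => ?_, fun x hx => ?_, fun x hx => ?_⟩
  · simp [hΨn]
  · have : f x = 0 := by
      refine Real.smoothTransition.zero_of_nonpos (div_nonpos_of_nonpos_of_nonneg ?_ hL.le)
      rw [sub_nonpos]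
      refine Real.log_le_log (by positivity) ?_
      nlinarith [norm_nonneg x]
    simp [Ψ, this, w]
  · have : f x = 1 := by
      refine Real.smoothTransition.one_of_one_le ?_
      rw [le_div_iff₀ hL]; linarith
    simp [Ψ, this, w, earef_earef]

theorem ea_twist {E : Type*} [NormedAddCommGroup E] [InnerProductSpace ℝ E] {κ : ℝ≥0}
    (hκ : 1 < κ) :
    ∃ R0 : ℝ, ∀ R ≥ R0, ∀ u v : E, u ≠ 0 → v ≠ 0 →
    ∃ T : E → E, EAGood κ T ∧ (∀ x, ‖T x‖ = ‖x‖) ∧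
      (∀ x, ‖x‖ ≤ 1 → T x = earef u (earef v x)) ∧ (∀ x, R ≤ ‖x‖ → T x = x) := by
  obtain ⟨C, hC⟩ := ea_smoothTransition_lip
  have hκ' : (1 : ℝ) < κ := by exact_mod_cast hκ
  have hp : 0 < (κ : ℝ) - 1 := by linarith
  let L : ℝ := (64 * C + 1) / (κ - 1)
  have hL : 0 < L := by positivity
  refine ⟨Real.exp (L + Real.log 2), fun R hR u v hu hv => ?_⟩
  have hκL : 1 + 64 * C / L ≤ κ := by
    have : 64 * C / L ≤ (κ : ℝ) - 1 := by
      rw [div_le_iff₀ hL]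
      simp only [L]
      rw [mul_div_cancel₀ _ hp.ne']; linarith
    linarith
  have hout : ∀ x : E, R ≤ ‖x‖ → L ≤ Real.log (1 + ‖x‖ ^ 2) - Real.log 2 := by
    intro x hx
    rw [le_sub_iff_add_le, Real.le_log_iff_exp_le (by positivity)]
    have := hR.le.trans hx
    nlinarith [sq_nonneg (‖x‖ - 1)]
  have hu' : ‖u‖ ≠ 0 := norm_ne_zero_iff.2 hu
  have hv' : ‖v‖ ≠ 0 := norm_ne_zero_iff.2 hv
  obtain ⟨c, hc, hcv, hcuv⟩ : ∃ c : ℝ, c ≠ 0 ∧ ‖c • v‖ = 1 ∧ 0 ≤ inner ℝ (‖u‖⁻¹ • u) (c • v) := by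
    rcases le_total 0 (inner ℝ (‖u‖⁻¹ • u) (‖v‖⁻¹ • v)) with h | h
    · exact ⟨‖v‖⁻¹, inv_ne_zero hv', by rw [norm_smul]; simp [hv'], h⟩
    · refine ⟨-‖v‖⁻¹, neg_ne_zero.2 (inv_ne_zero hv'), by rw [norm_smul]; simp [hv'], ?_⟩
      rw [neg_smul, inner_neg_right]; linarith
  obtain ⟨T, h1, h2, h3, h4⟩ := ea_twist_core hC hL hκL
    (u := ‖u‖⁻¹ • u) (v := c • v) (by rw [norm_smul]; simp [hu']) hcv hcuv
  rw [earef_smul hc, earef_smul (inv_ne_zero hu')] at h3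
  exact ⟨T, h1, h2, h3, fun x hx => h4 x (hout x hx)⟩

theorem ea_rot_twist {E : Type*} [NormedAddCommGroup E] [InnerProductSpace ℝ E] {κ : ℝ≥0}
    (hκ : 1 < κ) :
    ∃ R0 : ℝ, ∀ R ≥ R0, ∀ (n : ℕ) (A : E ≃ₗᵢ[ℝ] E), EARot n A →
    ∃ T : E → E, EAGood (κ ^ n) T ∧ (∀ x, ‖T x‖ = ‖x‖) ∧
      (∀ x, ‖x‖ ≤ 1 → T x = A x) ∧ (∀ x, R ≤ ‖x‖ → T x = x) := by
  obtain ⟨R0, hR0⟩ := ea_twist (E := E) hκ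
  refine ⟨R0, fun R hR n A hA => ?_⟩
  obtain ⟨l, hl, hne, rfl⟩ := hA
  suffices h : ∃ T : E → E, EAGood (κ ^ l.length) T ∧ (∀ x, ‖T x‖ = ‖x‖) ∧
      (∀ x, ‖x‖ ≤ 1 → T x = (l.map fun p => earef p.1 * earef p.2).prod x) ∧
      (∀ x, R ≤ ‖x‖ → T x = x) by
    obtain ⟨T, h1, h2⟩ := h
    exact ⟨T, h1.mono (pow_le_pow_right₀ hκ.le hl), h2⟩
  clear hl
  induction l with
  | nil => exact ⟨fun x => x, by simpa using EAGood.id, by simp, by simp, by simp⟩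
  | cons p l ih =>
    obtain ⟨T, h1, h2, h3, h4⟩ := ih fun q hq => hne q (by simp [hq])
    obtain ⟨S, g1, g2, g3, g4⟩ := hR0 R hR p.1 p.2 (hne p (by simp)).1 (hne p (by simp)).2
    refine ⟨S ∘ T, ?_, fun x => ?_, fun x hx => ?_, fun x hx => ?_⟩
    · have := g1.comp h1
      rwa [List.length_cons, pow_succ']
    · simp [g2, h2]
    · rw [Function.comp_apply, g3 _ (by rw [h2]; exact hx), h3 x hx]
      simp
    · rw [Function.comp_apply, h4 x hx, g4 x hx]

theorem ea_correct {E : Type*} [NormedAddCommGroup E] [InnerProductSpace ℝ E]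
    [FiniteDimensional ℝ E] {κ : ℝ≥0} (hκ : 1 < κ) (k : ℕ) {s : ℝ} (hs : 0 < s) (hs1 : s ≤ 1) :
    ∃ η > (0 : ℝ), ∀ p z : Fin k → E, (∀ i j, i ≠ j → s ≤ dist (p i) (p j)) →
      (∀ i, ‖p i‖ ≤ 1) → (∀ i, ‖z i - p i‖ < η) →
      ∃ Θ : E → E, EAGood κ Θ ∧ (∀ i, Θ (p i) = z i) ∧ ∀ x, 2 ≤ ‖x‖ → Θ x = x := by
  let b : ContDiffBump (0 : E) := ⟨1 / 2, 1, by norm_num, by norm_num⟩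
  obtain ⟨C, hC⟩ := ContDiff.lipschitzWith_of_hasCompactSupport b.hasCompactSupport
    (b.contDiff (n := ⊤)) (by simp)
  have hκ' : (1 : ℝ) < κ := by exact_mod_cast hκ
  let c : ℝ≥0 := 1 - κ⁻¹
  have hκinv : κ⁻¹ < 1 := inv_lt_one_of_one_lt₀ hκ
  have hc0 : 0 < c := tsub_pos_of_lt hκinv
  have hc1 : c < 1 := tsub_lt_self one_pos (by positivity)
  have hcκ : (1 - c)⁻¹ = κ := by
    simp only [c]
    rw [tsub_tsub_cancel_of_le hκinv.le, inv_inv]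
  refine ⟨c * s / (k * C + 1), by positivity, fun p z hp hp1 hz => ?_⟩
  let f : E → E := fun x => ∑ i, b (s⁻¹ • (x - p i)) • (z i - p i)
  have hbz : ∀ x : E, 1 ≤ ‖x‖ → b x = 0 := fun x hx => b.zero_of_le_dist (by simpa using hx)
  have hb0 : b 0 = 1 := b.one_of_mem_closedBall (by simp [b])
  have hfs : ContDiff ℝ (⊤ : ℕ∞) f := by
    refine ContDiff.sum fun i _ => ContDiff.smul (b.contDiff.comp ?_) contDiff_const
    fun_prop
  have hfl : LipschitzWith c f := by
    refine LipschitzWith.of_dist_le_mul fun x y => ?_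
    rw [dist_eq_norm]
    simp only [f]
    rw [← Finset.sum_sub_distrib]
    have hterm : ∀ i, ‖b (s⁻¹ • (x - p i)) • (z i - p i) - b (s⁻¹ • (y - p i)) • (z i - p i)‖
        ≤ C * (s⁻¹ * dist x y) * (c * s / (k * C + 1)) := by
      intro i
      rw [← sub_smul, norm_smul]
      have h1 := hC.dist_le_mul (s⁻¹ • (x - p i)) (s⁻¹ • (y - p i))
      rw [dist_smul₀, dist_sub_right, Real.norm_eq_abs, abs_of_pos (inv_pos.2 hs),
        Real.dist_eq] at h1
      rw [Real.norm_eq_abs]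
      exact mul_le_mul h1 (hz i).le (norm_nonneg _) (by positivity)
    refine (norm_sum_le _ _).trans ((Finset.sum_le_sum fun i _ => hterm i).trans ?_)
    rw [Finset.sum_const, Finset.card_univ, Fintype.card_fin, nsmul_eq_mul]
    have : (k : ℝ) * (C * (s⁻¹ * dist x y) * (c * s / (k * C + 1)))
        = (k * C / (k * C + 1)) * (c * dist x y) := by field_simp
    rw [this]
    refine mul_le_of_le_one_left (by positivity) ?_
    rw [div_le_one (by positivity)]; linarith
  refine ⟨fun x => x + f x, hcκ ▸ EAGood.id_add hc1 hfs hfl, fun i => ?_, fun x hx => ?_⟩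
  · have : f (p i) = z i - p i := by
      simp only [f]
      rw [Finset.sum_eq_single i]
      · simp [hb0]
      · intro j _ hj
        rw [hbz, zero_smul]
        rw [norm_smul, norm_inv, Real.norm_eq_abs, abs_of_pos hs, ← dist_eq_norm,
          ← div_eq_inv_mul, one_le_div hs]
        exact hp i j hj.symm
      · simp
    simp only [this]; abel
  · have : f x = 0 := by
      refine Finset.sum_eq_zero fun i _ => ?_
      rw [hbz, zero_smul]
      rw [norm_smul, norm_inv, Real.norm_eq_abs, abs_of_pos hs, ← div_eq_inv_mul, one_le_div hs]
      have := norm_sub_norm_le x (p i)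
      linarith [hp1 i]
    simp only [this, add_zero]

theorem ea_main_k {E : Type*} [NormedAddCommGroup E] [InnerProductSpace ℝ E]
    [FiniteDimensional ℝ E] {κ : ℝ≥0} (hκ : 1 < κ) :
    ∃ R0 : ℝ, ∀ R ≥ R0, ∀ s : ℝ, 0 < s → s ≤ 1 → ∀ k : ℕ, k ≤ Module.finrank ℝ E →
    ∃ δ0 > (0 : ℝ), ∀ δ : ℝ, 0 < δ → δ ≤ δ0 → ∀ i0 : Fin k, ∀ y z : Fin k → E,
      i0.val = 0 → Function.Injective y →
      y i0 = z i0 →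
      (∀ i j, i ≠ j → s * Metric.diam (Set.range y) ≤ dist (y i) (y j)) →
      (∀ i j, i ≠ j →
        (1 + δ)⁻¹ ≤ dist (z i) (z j) / dist (y i) (y j) ∧
        dist (z i) (z j) / dist (y i) (y j) ≤ 1 + δ) →
      ∃ Φ : E → E, EAGood (κ ^ (Module.finrank ℝ E + 2)) Φ ∧ (∀ i, Φ (y i) = z i) ∧
        ∀ x, R * Metric.diam (Set.range y) ≤ dist x (y i0) → Φ x = x := by
  obtain ⟨R1, hR1⟩ := ea_rot_twist (E := E) hκ
  refine ⟨max R1 2, fun R hR s hs hs1 k hk => ?_⟩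
  have hRR1 : R1 ≤ R := (le_max_left _ _).trans hR
  have hR2 : 2 ≤ R := (le_max_right _ _).trans hR
  rcases Nat.eq_zero_or_pos k with rfl | hkpos
  · exact ⟨1, one_pos, fun δ _ _ i0 => i0.elim0⟩
  obtain ⟨η, hη, hcor⟩ := ea_correct (E := E) hκ k hs hs1
  obtain ⟨δ', hδ', happ⟩ := ea_approx hk (⟨0, hkpos⟩ : Fin k) hη
  refine ⟨min 1 (δ' / 2), by positivity, fun δ hδ hδle i0 y z hi0 hyinj hyz hsep hrat => ?_⟩
  obtain rfl : i0 = ⟨0, hkpos⟩ := Fin.ext hi0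
  generalize (⟨0, hkpos⟩ : Fin k) = i0 at *
  have hδ1 : δ ≤ 1 := hδle.trans (min_le_left _ _)
  have hδ2 : δ < δ' := by
    have := hδle.trans (min_le_right _ _)
    linarith
  have hdd : ∀ i j, dist (y i) (y j) ≤ Metric.diam (Set.range y) := fun i j =>
    Metric.dist_le_diam_of_mem (Set.finite_range y).isBounded ⟨i, rfl⟩ ⟨j, rfl⟩
  generalize Metric.diam (Set.range y) = d at *
  have hd0 : 0 ≤ d := dist_nonneg.trans (hdd i0 i0)
  have hK1 : (1 : ℝ≥0) ≤ κ ^ (Module.finrank ℝ E + 2) := one_le_pow₀ hκ.le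
  rcases hd0.eq_or_lt with hd | hd
  · refine ⟨fun x => x, EAGood.id.mono hK1, fun i => ?_, fun x _ => rfl⟩
    have : i = i0 := hyinj (dist_le_zero.1 ((hdd i i0).trans hd.symm.le))
    rw [this, hyz]
  let y' : Fin k → E := fun i => d⁻¹ • (y i - y i0)
  let z' : Fin k → E := fun i => d⁻¹ • (z i - y i0)
  have hy'd : ∀ i j, dist (y' i) (y' j) = d⁻¹ * dist (y i) (y j) := fun i j => by
    simp only [y']
    rw [dist_smul₀, dist_sub_right, Real.norm_eq_abs, abs_of_pos (inv_pos.2 hd)]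
  have hz'd : ∀ i j, dist (z' i) (z' j) = d⁻¹ * dist (z i) (z j) := fun i j => by
    simp only [z']
    rw [dist_smul₀, dist_sub_right, Real.norm_eq_abs, abs_of_pos (inv_pos.2 hd)]
  have hy'0 : y' i0 = 0 := by simp [y']
  have hz'0 : z' i0 = 0 := by simp [z', hyz]
  have hy'1 : ∀ i j, dist (y' i) (y' j) ≤ 1 := fun i j => by
    rw [hy'd, ← div_eq_inv_mul, div_le_one hd]; exact hdd i j
  have hdiff : ∀ i j, |dist (z' i) (z' j) - dist (y' i) (y' j)| ≤ δ := by
    intro i j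
    by_cases hij : i = j
    · simp [hij, hδ.le]
    have hpos : 0 < dist (y i) (y j) := dist_pos.2 (hyinj.ne hij)
    obtain ⟨h1, h2⟩ := hrat i j hij
    rw [le_div_iff₀ hpos] at h1
    rw [div_le_iff₀ hpos] at h2
    have h3 : 1 - δ ≤ (1 + δ)⁻¹ := by
      rw [← one_div, le_div_iff₀ (by linarith)]; nlinarith
    have h4 : (1 - δ) * dist (y i) (y j) ≤ dist (z i) (z j) :=
      (mul_le_mul_of_nonneg_right h3 hpos.le).trans h1
    have h5 := hy'1 i j
    have h6 : |dist (z i) (z j) - dist (y i) (y j)| ≤ δ * dist (y i) (y j) := by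
      rw [abs_le]; constructor <;> linarith
    rw [hz'd, hy'd, ← mul_sub, abs_mul, abs_of_pos (inv_pos.2 hd)]
    calc _ ≤ d⁻¹ * (δ * dist (y i) (y j)) := by gcongr
      _ = δ * dist (y' i) (y' j) := by rw [hy'd]; ring
      _ ≤ δ * 1 := by gcongr
      _ = δ := mul_one _
  have hy'n : ∀ i, ‖y' i‖ ≤ 1 := fun i => by simpa [hy'0] using hy'1 i i0
  have hz'n : ∀ i, ‖z' i‖ ≤ 2 := fun i => by
    have h1 := (abs_le.1 (hdiff i i0)).2
    have h2 := hy'n i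
    simp only [hy'0, hz'0, dist_zero_right] at h1
    linarith
  obtain ⟨A, hA, hAη⟩ := happ y' z' hy'0 hz'0 hy'n hz'n fun i j => (hdiff i j).trans_lt hδ2
  obtain ⟨T, t1, t2, t3, t4⟩ := hR1 R hRR1 _ A hA
  obtain ⟨Θ, g1, g2, g3⟩ := hcor (fun i => A (y' i)) z' (fun i j hij => by
      rw [A.dist_map, hy'd, ← div_eq_inv_mul, le_div_iff₀ hd]; exact hsep i j hij)
    (fun i => by rw [A.norm_map]; exact hy'n i) hAη
  refine ⟨fun x => y i0 + d • (Θ ∘ T) (d⁻¹ • (x - y i0)), ?_, fun i => ?_, fun x hx => ?_⟩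
  · have := (g1.comp t1).conj (y i0) hd
    rwa [← pow_succ'] at this
  · have h1 : T (d⁻¹ • (y i - y i0)) = A (y' i) := t3 _ (hy'n i)
    simp only [Function.comp_apply, h1, g2]
    simp [z', smul_smul, hd.ne']
  · have hxn : R ≤ ‖d⁻¹ • (x - y i0)‖ := by
      rw [norm_smul, norm_inv, Real.norm_eq_abs, abs_of_pos hd, ← dist_eq_norm,
        ← div_eq_inv_mul, le_div_iff₀ hd]
      exact hx
    simp only [Function.comp_apply, t4 _ hxn, g3 _ (hR2.trans hxn)]
    simp [smul_smul, hd.ne']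

/-- Special case of the extension theorem. For small `ε`, a positive
integer `m`, a sufficiently small `λ` (depending on `ε, m, D`) and sufficiently small
`δ` (depending on `λ, ε, m, D`): any two k-point configurations (`k ≤ D`, `y_1 = z_1`)
that are `λ^m diam`-separated and have distance ratios within `1+δ` are matched by an
`ε`-distorted diffeomorphism that is the identity outside the ball of radius
`λ^{-1/2} diam{y_1,...,y_k}` about `y_1`. -/
theorem exact_alignment_separated
    (D : ℕ) (hD : 2 ≤ D) :
    ∃ ε₀ > (0 : ℝ), ∀ ε : ℝ, 0 < ε → ε < ε₀ →
      ∀ m : ℕ, 1 ≤ m →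
        ∃ lam₀ > (0 : ℝ), ∀ lam : ℝ, 0 < lam → lam < lam₀ →
          ∃ δ > (0 : ℝ), ∀ (k : ℕ) (hk : 1 ≤ k), k ≤ D →
            ∀ y z : Fin k → EuclideanSpace ℝ (Fin D),
              Function.Injective y → Function.Injective z →
              y ⟨0, hk⟩ = z ⟨0, hk⟩ →
              (∀ i j, i ≠ j →
                lam ^ m * Metric.diam (Set.range y) ≤ dist (y i) (y j)) →
              (∀ i j, i ≠ j →
                (1 + δ)⁻¹ ≤ dist (z i) (z j) / dist (y i) (y j) ∧
                dist (z i) (z j) / dist (y i) (y j) ≤ 1 + δ) →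
              ∃ Φ : EuclideanSpace ℝ (Fin D) → EuclideanSpace ℝ (Fin D),
                IsDistorted D ε Φ ∧
                (∀ i, Φ (y i) = z i) ∧
                (∀ x, lam ^ (-(1 : ℝ) / 2) * Metric.diam (Set.range y)
                    ≤ dist x (y ⟨0, hk⟩) → Φ x = x) := by
  refine ⟨1, one_pos, fun ε hε _ m hm => ?_⟩
  have hfr : Module.finrank ℝ (EuclideanSpace ℝ (Fin D)) = D := by simp
  obtain ⟨κ, hκ, hκε⟩ : ∃ κ : ℝ≥0, 1 < κ ∧ ((κ ^ (D + 2) : ℝ≥0) : ℝ) ^ 2 ≤ 1 + ε := by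
    have h1 : (1 : ℝ) < (1 + ε) ^ (((((D + 2) * 2 : ℕ) : ℝ))⁻¹) :=
      Real.one_lt_rpow (by linarith) (by positivity)
    obtain ⟨κ, hκ⟩ : ∃ κ : ℝ≥0, (κ : ℝ) = (1 + ε) ^ (((((D + 2) * 2 : ℕ) : ℝ))⁻¹) :=
      ⟨Real.toNNReal _, Real.coe_toNNReal _ (by linarith)⟩
    refine ⟨κ, ?_, ?_⟩
    · rw [← NNReal.coe_lt_coe, hκ]; exact h1
    · rw [NNReal.coe_pow, ← pow_mul, hκ]
      exact (Real.rpow_inv_natCast_pow (by linarith) (by omega)).le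
  obtain ⟨R0, hR0⟩ := ea_main_k (E := EuclideanSpace ℝ (Fin D)) hκ
  let M : ℝ := max R0 1
  have hM1 : 1 ≤ M := le_max_right _ _
  have hM0 : 0 < M := by linarith
  refine ⟨(M ^ 2)⁻¹, by positivity, fun lam hlam hlt => ?_⟩
  have hlam1 : lam ≤ 1 := hlt.le.trans (inv_le_one_of_one_le₀ (one_le_pow₀ hM1))
  have hR : lam ^ (-(1 : ℝ) / 2) ≥ R0 := by
    refine le_trans (le_max_left R0 1 : R0 ≤ M) ?_
    have e : lam ^ (-(1 : ℝ) / 2) = (Real.sqrt lam)⁻¹ := by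
      rw [Real.sqrt_eq_rpow, ← Real.rpow_neg hlam.le]; norm_num
    rw [e, le_inv_comm₀ hM0 (Real.sqrt_pos.2 hlam), Real.sqrt_le_iff]
    exact ⟨by positivity, by rw [inv_pow]; exact hlt.le⟩
  have hs : 0 < lam ^ m := by positivity
  have hs1 : lam ^ m ≤ 1 := pow_le_one₀ hlam.le hlam1
  have key := hR0 _ hR (lam ^ m) hs hs1
  rw [hfr] at key
  choose! g hg hg' using key
  have hne : (Finset.range (D + 1)).Nonempty := ⟨0, by simp⟩
  have hpos : 0 < (Finset.range (D + 1)).inf' hne g := by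
    rw [Finset.lt_inf'_iff]
    intro k hk
    exact hg k (by simpa [Nat.lt_succ_iff] using hk)
  refine ⟨(Finset.range (D + 1)).inf' hne g, hpos, ?_⟩
  intro k hk hkD y z hy _ hyz hsep hrat
  have hmem : k ∈ Finset.range (D + 1) := by simp; omega
  obtain ⟨Φ, h1, h2, h3⟩ := hg' k hkD _ hpos (Finset.inf'_le g hmem) ⟨0, hk⟩ y z rfl hy
    hyz hsep hrat
  exact ⟨Φ, h1.isDistorted hε hκε, h2, h3⟩
end

section
/- Let D ≥ 2 and let ε > 0 be small enough (less than a constant depending only on D). Then there exist η > 0 and δ > 0 depending on ε and D such that the following holds: if y_1,...,y_k and z_1,...,z_k are k-point configurations in ℝ^D with 1 ≤ k ≤ D, y_1 = z_1, and (1+δ)^{-1} ≤ |z_i − z_j|/|y_i − y_j| ≤ 1+δ for all i ≠ j, then there exists an ε-distorted diffeomorphism Φ : ℝ^D → ℝ^D such that Φ(y_i) = z_i for each i = 1,...,k and Φ(x) = x whenever |x − y_1| ≥ η^{-1} · diam{y_1,...,y_k}. -/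
set_option linter.unusedSectionVars false

namespace DistortExt

open Function
open scoped ContDiff


variable {E : Type*} [NormedAddCommGroup E] [InnerProductSpace ℝ E]

/-- smooth bi-Lipschitz diffeomorphisms with constant `K`. -/
structure Good (K : ℝ) (Φ : E ≃ E) : Prop where
  c1 : ContDiff ℝ (⊤ : ℕ∞) Φ
  c2 : ContDiff ℝ (⊤ : ℕ∞) Φ.symm
  l1 : ∀ x y, dist (Φ x) (Φ y) ≤ K * dist x y
  l2 : ∀ x y, dist x y ≤ K * dist (Φ x) (Φ y)

theorem Good.comp {K L : ℝ} {Φ Ψ : E ≃ E} (hK : 0 ≤ K) (hL : 0 ≤ L) (h1 : Good K Φ) (h2 : Good L Ψ) :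
    Good (K * L) (Ψ.trans Φ) where
  c1 := h1.c1.comp h2.c1
  c2 := h2.c2.comp h1.c2
  l1 x y := by
    have a := h1.l1 (Ψ x) (Ψ y)
    have b := mul_le_mul_of_nonneg_left (h2.l1 x y) hK
    simp only [Equiv.trans_apply]
    linarith
  l2 x y := by
    have a := mul_le_mul_of_nonneg_left (h1.l2 (Ψ x) (Ψ y)) hL
    have b := (h2.l2 x y)
    simp only [Equiv.trans_apply]
    linarith

theorem Good.mono {K L : ℝ} {Φ : E ≃ E} (h : K ≤ L) (h1 : Good K Φ) : Good L Φ where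
  c1 := h1.c1
  c2 := h1.c2
  l1 x y := (h1.l1 x y).trans (mul_le_mul_of_nonneg_right h dist_nonneg)
  l2 x y := (h1.l2 x y).trans (mul_le_mul_of_nonneg_right h dist_nonneg)

theorem good_refl {K : ℝ} (h : 1 ≤ K) : Good K (Equiv.refl E) where
  c1 := contDiff_id
  c2 := contDiff_id
  l1 _ _ := le_mul_of_one_le_left dist_nonneg h
  l2 _ _ := le_mul_of_one_le_left dist_nonneg h

/-- conjugation by the similarity `x ↦ p + M x`. -/
theorem Good.conj {K : ℝ} {Φ : E ≃ E} (h : Good K Φ) (p : E) {M : ℝ} (hM : 0 < M) :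
    ∃ Ψ : E ≃ E, Good K Ψ ∧ ∀ x, Ψ x = p + M • Φ (M⁻¹ • (x - p)) := by
  have hM' : M ≠ 0 := hM.ne'
  refine ⟨⟨fun x => p + M • Φ (M⁻¹ • (x - p)), fun x => p + M • Φ.symm (M⁻¹ • (x - p)), ?_, ?_⟩,
    ⟨?_, ?_, ?_, ?_⟩, fun x => rfl⟩
  · intro x; simp [smul_smul, hM']
  · intro x; simp [smul_smul, hM']
  · exact contDiff_const.add (contDiff_const.smul (h.c1.comp (contDiff_const.smul (contDiff_id.sub contDiff_const))))
  · exact contDiff_const.add (contDiff_const.smul (h.c2.comp (contDiff_const.smul (contDiff_id.sub contDiff_const))))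
  · intro x y
    have := mul_le_mul_of_nonneg_left (h.l1 (M⁻¹ • (x - p)) (M⁻¹ • (y - p))) hM.le
    simp only [Equiv.coe_fn_mk, dist_add_left, dist_smul₀, dist_sub_right, Real.norm_eq_abs, abs_inv,
      abs_of_pos hM] at this ⊢
    refine this.trans (le_of_eq ?_)
    field_simp
  · intro x y
    have := mul_le_mul_of_nonneg_left (h.l2 (M⁻¹ • (x - p)) (M⁻¹ • (y - p))) hM.le
    simp only [Equiv.coe_fn_mk, dist_add_left, dist_smul₀, dist_sub_right, Real.norm_eq_abs, abs_inv,
      abs_of_pos hM] at this ⊢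
    refine le_trans (le_of_eq ?_) (this.trans (le_of_eq ?_))
    · field_simp
    · ring

variable [FiniteDimensional ℝ E]

/-- perturbations of the identity -/
theorem perturb (g : E → E) (hg : ContDiff ℝ (⊤ : ℕ∞) g) (c κ : ℝ) (hc0 : 0 ≤ c) (hc : c < 1)
    (hgl : ∀ x y, dist (g x) (g y) ≤ c * dist x y) (hκ : 1 ≤ κ * (1 - c)) :
    ∃ Φ : E ≃ E, Good κ Φ ∧ ∀ x, Φ x = x + g x := by
  lift c to NNReal using hc0
  have hc0 : (0 : ℝ) ≤ c := c.2
  have hκ1 : 0 < κ := by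
    by_contra h
    nlinarith
  have low : ∀ x y, (1 - c) * dist x y ≤ dist (x + g x) (y + g y) := by
    intro x y
    have h1 : dist x y ≤ dist (x + g x) (y + g y) + dist (g x) (g y) := by
      have := dist_sub_sub_le (x + g x) (g x) (y + g y) (g y)
      simpa using this
    have := hgl x y
    linarith
  have up : ∀ x y, dist (x + g x) (y + g y) ≤ κ * dist x y := by
    intro x y
    have h1 := dist_add_add_le x (g x) y (g y)
    have h2 := hgl x y
    have h3 : 1 + c ≤ κ := by nlinarith [mul_nonneg hκ1.le hc0, mul_nonneg hκ1.le (mul_self_nonneg c)]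
    nlinarith [@dist_nonneg _ _ x y]
  have hf : ContDiff ℝ (⊤ : ℕ∞) (fun x => x + g x) := contDiff_id.add hg
  have happ : ApproximatesLinearOn (fun x => x + g x) ((ContinuousLinearEquiv.refl ℝ E : E ≃L[ℝ] E) : E →L[ℝ] E)
      Set.univ c := by
    intro x _ y _
    have := hgl x y
    simp only [dist_eq_norm] at this
    simp
    have e : x + g x - (y + g y) - (x - y) = g x - g y := by abel
    rw [e]
    exact this
  have hcond : Subsingleton E ∨ c <
      ‖((ContinuousLinearEquiv.refl ℝ E).symm : E →L[ℝ] E)‖₊⁻¹ := by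
    rcases subsingleton_or_nontrivial E with h | h
    · exact Or.inl h
    · right
      have : ‖((ContinuousLinearEquiv.refl ℝ E).symm : E →L[ℝ] E)‖₊ = 1 := by
        ext; simp
      rw [this]
      rw [← NNReal.coe_lt_coe]; simpa using hc
  let H : E ≃ₜ E := ApproximatesLinearOn.toHomeomorph _ happ hcond
  have hH : ∀ x, H x = x + g x := fun x => rfl
  have hH' : ContDiff ℝ (⊤ : ℕ∞) H := hf
  have hderiv : ∀ x, ∃ L : E ≃L[ℝ] E, HasFDerivAt H (L : E →L[ℝ] E) x := by
    intro x
    have hd : HasFDerivAt H (ContinuousLinearMap.id ℝ E + fderiv ℝ g x) x :=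
      (hasFDerivAt_id x).add ((hg.differentiable (by simp)) x).hasFDerivAt
    have hn : ‖fderiv ℝ g x‖ ≤ c := by
      have : LipschitzWith c g := LipschitzWith.of_dist_le_mul hgl
      exact norm_fderiv_le_of_lipschitz ℝ this
    have hinj : Injective (ContinuousLinearMap.id ℝ E + fderiv ℝ g x : E →L[ℝ] E) := by
      rw [injective_iff_map_eq_zero]
      intro v hv
      have h1 : v = - (fderiv ℝ g x v) := by
        have : v + fderiv ℝ g x v = 0 := by simpa using hv
        exact eq_neg_of_add_eq_zero_left this
      have h2 : ‖v‖ ≤ c * ‖v‖ := by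
        calc ‖v‖ = ‖fderiv ℝ g x v‖ := by conv_lhs => rw [h1, norm_neg]
          _ ≤ _ := ContinuousLinearMap.le_of_opNorm_le _ hn v
      have h3 : ‖v‖ = 0 := by nlinarith [norm_nonneg v]
      simpa using h3
    let L0 := LinearEquiv.ofInjectiveEndo (ContinuousLinearMap.id ℝ E + fderiv ℝ g x : E →L[ℝ] E).toLinearMap hinj
    refine ⟨L0.toContinuousLinearEquiv, ?_⟩
    convert hd using 1
    ext v
    rfl
  choose L hL using hderiv
  refine ⟨H.toEquiv, ⟨hH', H.contDiff_symm hL hH', up, ?_⟩, hH⟩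
  intro x y
  have := low x y
  change _ ≤ κ * dist (x + g x) (y + g y)
  have h2 := mul_le_mul_of_nonneg_left this hκ1.le
  nlinarith [@dist_nonneg _ _ x y]

/-- moving a point by a small vector. -/
theorem push (κ : ℝ) (hκ : 1 < κ) : ∃ θ > 0, ∀ (p w : E) (t : ℝ), 0 < t → ‖w‖ ≤ θ * t →
    ∃ Φ : E ≃ E, Good κ Φ ∧ (∀ x, dist x p ≤ t → Φ x = x + w) ∧ (∀ x, 2 * t ≤ dist x p → Φ x = x) := by
  let χ : ContDiffBump (0 : E) := ⟨1, 2, by norm_num, by norm_num⟩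
  have hχ : ContDiff ℝ (⊤ : ℕ∞) χ := χ.contDiff
  obtain ⟨C, hC⟩ := (χ.contDiff (n := 1)).lipschitzWith_of_hasCompactSupport χ.hasCompactSupport (by simp)
  have hC0 : (0 : ℝ) ≤ C := C.2
  set c : ℝ := 1 - κ⁻¹ with hcdef
  have hk1 : κ⁻¹ < 1 := inv_lt_one_of_one_lt₀ hκ
  have hk0 : 0 < κ⁻¹ := by positivity
  have hc0 : 0 < c := by linarith
  refine ⟨c / (C + 1), by positivity, ?_⟩
  intro p w t ht hw
  have hw' : (C + 1) * ‖w‖ ≤ c * t := by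
    have := mul_le_mul_of_nonneg_left hw (by positivity : (0 : ℝ) ≤ C + 1)
    refine this.trans (le_of_eq ?_)
    field_simp
  obtain ⟨Φ, h1, h2⟩ := perturb (fun x => χ (t⁻¹ • (x - p)) • w)
    ((hχ.comp (contDiff_const.smul (contDiff_id.sub contDiff_const))).smul contDiff_const)
    c κ hc0.le (by linarith) (by
      intro x y
      have := hC.dist_le_mul (t⁻¹ • (x - p)) (t⁻¹ • (y - p))
      rw [dist_smul₀, dist_sub_right, Real.norm_eq_abs, abs_of_pos (by positivity)] at this
      rw [dist_eq_norm, ← sub_smul, norm_smul, ← dist_eq_norm]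
      calc _ ≤ C * (t⁻¹ * dist x y) * ‖w‖ := by gcongr
        _ = (C * ‖w‖) * (t⁻¹ * dist x y) := by ring
        _ ≤ (c * t) * (t⁻¹ * dist x y) := by
          apply mul_le_mul_of_nonneg_right _ (by positivity)
          nlinarith [norm_nonneg w]
        _ = _ := by field_simp) (by
      have : κ * (1 - c) = 1 := by simp [hcdef]; field_simp
      linarith)
  refine ⟨Φ, h1, ?_, ?_⟩
  · intro x hx
    have : χ (t⁻¹ • (x - p)) = 1 := by
      apply χ.one_of_mem_closedBall
      rw [mem_closedBall_zero_iff, norm_smul, Real.norm_eq_abs, abs_of_pos (by positivity), ← dist_eq_norm]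
      change t⁻¹ * dist x p ≤ 1
      rw [inv_mul_le_iff₀ ht]; simpa using hx
    rw [h2, this, one_smul]
  · intro x hx
    have : χ (t⁻¹ • (x - p)) = 0 := by
      apply χ.zero_of_le_dist
      rw [dist_zero_right, norm_smul, Real.norm_eq_abs, abs_of_pos (by positivity), ← dist_eq_norm]
      change 2 ≤ t⁻¹ * dist x p
      rw [le_inv_mul_iff₀ ht]; linarith
    rw [h2, this, zero_smul, add_zero]

/-- curve on the unit sphere -/
theorem sphere_curve (u e : E) (hu : ‖u‖ = 1) (he : ‖e‖ = 1) :
    ∃ γ γ' : ℝ → E, ContDiff ℝ (⊤ : ℕ∞) γ ∧ (∀ t, HasDerivAt γ (γ' t) t) ∧ (∀ t, ‖γ' t‖ ≤ 8) ∧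
      (∀ t, ‖γ t‖ = 1) ∧ γ 0 = u ∧ (∀ x, inner ℝ (γ 1) x • γ 1 = inner ℝ e x • e) := by
  set c := inner ℝ u e with hc
  set e' := e - c • u with he'
  have huu : inner ℝ u u = (1 : ℝ) := by rw [real_inner_self_eq_norm_sq, hu]; norm_num
  have hee : inner ℝ e e = (1 : ℝ) := by rw [real_inner_self_eq_norm_sq, he]; norm_num
  have hue' : inner ℝ u e' = 0 := by
    rw [he', inner_sub_right, inner_smul_right, huu, ← hc]; ring
  have hn : ‖e'‖ ^ 2 = 1 - c ^ 2 := by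
    rw [← real_inner_self_eq_norm_sq]
    conv_lhs => rw [he']
    simp only [inner_sub_right, inner_sub_left, inner_smul_left, inner_smul_right, hee, huu, real_inner_comm u e, ← hc,
      conj_trivial]
    ring
  have hc1 : c ^ 2 ≤ 1 := by nlinarith [sq_nonneg ‖e'‖]
  by_cases h0 : e' = 0
  · have hcc : c * c = 1 := by rw [h0] at hn; simp at hn; linarith
    have h1 : e = c • u := by rwa [he', sub_eq_zero] at h0
    refine ⟨fun _ => u, fun _ => 0, contDiff_const, fun t => hasDerivAt_const t u, by simp, fun _ => hu, rfl, ?_⟩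
    intro x
    rw [h1, inner_smul_left, smul_smul]
    simp only [conj_trivial]
    rw [mul_right_comm, hcc, one_mul]
  · have hpos : 0 < ‖e'‖ := norm_pos_iff.mpr h0
    set f := ‖e'‖⁻¹ • e' with hf
    have hff : inner ℝ f f = (1 : ℝ) := by
      rw [real_inner_self_eq_norm_sq, hf, norm_smul, norm_inv, norm_norm, inv_mul_cancel₀ hpos.ne']; norm_num
    have hnf : ‖f‖ = 1 := by
      rw [hf, norm_smul, norm_inv, norm_norm, inv_mul_cancel₀ hpos.ne']
    have huf : inner ℝ u f = 0 := by rw [hf, inner_smul_right, hue', mul_zero]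
    set a := Real.arccos c with ha
    have ha0 : 0 ≤ a := Real.arccos_nonneg c
    have ha4 : a ≤ 4 := (Real.arccos_le_pi c).trans Real.pi_le_four
    have hca : Real.cos a = c := Real.cos_arccos (by nlinarith) (by nlinarith)
    have hsa : Real.sin a = ‖e'‖ := by
      rw [ha, Real.sin_arccos, ← hn, Real.sqrt_sq hpos.le]
    refine ⟨fun t => Real.cos (a * t) • u + Real.sin (a * t) • f,
      fun t => (-Real.sin (a * t) * a) • u + (Real.cos (a * t) * a) • f, ?_, ?_, ?_, ?_, ?_, ?_⟩
    · exact ((Real.contDiff_cos.comp (contDiff_const.mul contDiff_id)).smul contDiff_const).add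
        ((Real.contDiff_sin.comp (contDiff_const.mul contDiff_id)).smul contDiff_const)
    · intro t
      have h1 : HasDerivAt (fun t => a * t) a t := by simpa using (hasDerivAt_id t).const_mul a
      exact (h1.cos.smul_const u).add (h1.sin.smul_const f)
    · intro t
      refine (norm_add_le _ _).trans ?_
      rw [norm_smul, norm_smul, hu, hnf, norm_mul, norm_mul, norm_neg]
      simp only [Real.norm_eq_abs, abs_of_nonneg ha0]
      nlinarith [Real.abs_sin_le_one (a * t), Real.abs_cos_le_one (a * t)]
    · intro t
      have : ‖Real.cos (a * t) • u + Real.sin (a * t) • f‖ ^ 2 = 1 := by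
        rw [← real_inner_self_eq_norm_sq]
        simp only [inner_add_left, inner_add_right, inner_smul_left, inner_smul_right, huu, hff, huf,
          conj_trivial]
        rw [real_inner_comm, huf] 
        nlinarith [Real.sin_sq_add_cos_sq (a * t)]
      have h2 := norm_nonneg (Real.cos (a * t) • u + Real.sin (a * t) • f)
      nlinarith
    · simp
    · intro x
      have : Real.cos (a * 1) • u + Real.sin (a * 1) • f = e := by
        rw [mul_one, hca, hsa, hf, smul_smul, mul_inv_cancel₀ hpos.ne', one_smul, he']
        abel
      simp only [this]

theorem transition_deriv : ∃ C > 0, ∀ x, |deriv Real.smoothTransition x| ≤ C := by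
  have hcd : ContDiff ℝ 1 Real.smoothTransition := Real.smoothTransition.contDiff (n := 1)
  have hcont : Continuous (deriv Real.smoothTransition) := hcd.continuous_deriv (by simp)
  obtain ⟨C, hC⟩ := (isCompact_Icc (a := (-1 : ℝ)) (b := 2)).exists_bound_of_continuousOn hcont.continuousOn
  refine ⟨|C| + 1, by positivity, fun x => ?_⟩
  by_cases hx : x ∈ Set.Icc (-1 : ℝ) 2
  · have := hC x hx
    rw [Real.norm_eq_abs] at this
    linarith [le_abs_self C]
  · have : deriv Real.smoothTransition x = 0 := by
      rw [Set.mem_Icc, not_and_or, not_le, not_le] at hx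
      rcases hx with hx | hx
      · have : Real.smoothTransition =ᶠ[nhds x] fun _ => 0 := by
          filter_upwards [Iio_mem_nhds hx] with y hy
          exact Real.smoothTransition.zero_of_nonpos (by have : y < -1 := hy; linarith)
        rw [this.deriv_eq]; simp
      · have : Real.smoothTransition =ᶠ[nhds x] fun _ => 1 := by
          filter_upwards [Ioi_mem_nhds hx] with y hy
          exact Real.smoothTransition.one_of_one_le (by have : 2 < y := hy; linarith)
        rw [this.deriv_eq]; simp
    rw [this, abs_zero]; positivity

/-- the reflection along `u` (for a unit vector) -/
def refl (u x : E) : E := x - (2 * inner ℝ u x) • u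

theorem norm_refl (u x : E) (hu : ‖u‖ = 1) : ‖refl u x‖ = ‖x‖ := by
  have : ‖refl u x‖ ^ 2 = ‖x‖ ^ 2 := by
    rw [refl, norm_sub_sq_real, norm_smul, hu, inner_smul_right, real_inner_comm x u, mul_one, Real.norm_eq_abs,
      sq_abs]
    ring
  exact (sq_eq_sq₀ (norm_nonneg _) (norm_nonneg _)).mp this

theorem refl_refl (u x : E) (hu : ‖u‖ = 1) : refl u (refl u x) = x := by
  have huu : inner ℝ u u = (1 : ℝ) := by rw [real_inner_self_eq_norm_sq, hu]; norm_num
  simp only [refl, inner_sub_right, inner_smul_right, huu]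
  module

theorem refl_twist (κ : ℝ) (hκ : 1 < κ) : ∃ R ≥ 2, ∀ u e : E, ‖u‖ = 1 → ‖e‖ = 1 →
    ∃ F : E ≃ E, Good κ F ∧ (∀ x, ‖F x‖ = ‖x‖) ∧ (∀ x, ‖x‖ ≤ 2 → F x = refl u x) ∧
      (∀ x, R ≤ ‖x‖ → F x = refl e x) := by
  obtain ⟨C, hC0, hC⟩ := transition_deriv
  set a : ℝ := (κ - 1) / (64 * C) with ha
  have ha0 : 0 < a := div_pos (by linarith) (by positivity)
  have hlog5 : 0 ≤ Real.log 5 := Real.log_nonneg (by norm_num)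
  refine ⟨max 2 (Real.exp (a⁻¹ + Real.log 5)), le_max_left _ _, ?_⟩
  intro u e hu he
  obtain ⟨γ, γ', hγ, hγ', hγb, hγ1, hγ0, hγe⟩ := sphere_curve u e hu he
  let q : E → ℝ := fun x => a * (Real.log (1 + ‖x‖ ^ 2) - Real.log 5)
  let W : E → E := fun x => γ (Real.smoothTransition (q x))
  have hpos : ∀ x : E, 0 < 1 + ‖x‖ ^ 2 := fun x => by positivity
  have hq : ContDiff ℝ (⊤ : ℕ∞) q := by
    refine contDiff_const.mul (ContDiff.sub ?_ contDiff_const)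
    exact (contDiff_const.add (contDiff_norm_sq ℝ)).log (fun x => (hpos x).ne')
  have hW : ContDiff ℝ (⊤ : ℕ∞) W := hγ.comp (Real.smoothTransition.contDiff.comp hq)
  have hW1 : ∀ x, ‖W x‖ = 1 := fun x => hγ1 _
  have hWn : ∀ x y, ‖x‖ = ‖y‖ → W x = W y := by
    intro x y h; simp only [W, q, h]
  let F : E → E := fun x => refl (W x) x
  have hFn : ∀ x, ‖F x‖ = ‖x‖ := fun x => norm_refl _ _ (hW1 x)
  have hFF : ∀ x, F (F x) = x := by
    intro x
    change refl (W (F x)) (refl (W x) x) = x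
    rw [hWn _ _ (hFn x), refl_refl _ _ (hW1 x)]
  have hF : ContDiff ℝ (⊤ : ℕ∞) F :=
    contDiff_id.sub ((contDiff_const.mul (hW.inner ℝ contDiff_id)).smul hW)
  -- derivative of W
  have hWd : ∀ x v, ‖fderiv ℝ W x v‖ * ‖x‖ ≤ (κ - 1) / 4 * ‖v‖ := by
    intro x v
    have h1 : HasFDerivAt (fun x : E => ‖x‖ ^ 2) (2 • (innerSL ℝ x)) x :=
      (hasStrictFDerivAt_norm_sq x).hasFDerivAt
    have h2 : HasFDerivAt q (a • ((1 + ‖x‖ ^ 2)⁻¹ • (2 • (innerSL ℝ x)))) x :=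
      (((h1.const_add 1).log (hpos x).ne').sub_const _).const_mul a
    have h3 : HasDerivAt Real.smoothTransition (deriv Real.smoothTransition (q x)) (q x) :=
      (((Real.smoothTransition.contDiff (n := 1)).differentiable (by simp)) _).hasDerivAt
    have h4 : HasFDerivAt (fun x => Real.smoothTransition (q x)) _ x := h3.comp_hasFDerivAt x h2
    have h5 : HasFDerivAt W _ x := (hγ' (Real.smoothTransition (q x))).hasFDerivAt.comp x h4
    rw [h5.fderiv]
    simp only [ContinuousLinearMap.comp_apply, smul_apply, innerSL_apply_apply,
      ContinuousLinearMap.toSpanSingleton_apply, smul_eq_mul, norm_smul, norm_mul, Real.norm_eq_abs, nsmul_eq_mul]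
    have b1 := hC (q x)
    have b2 := hγb (Real.smoothTransition (q x))
    have b3 := abs_real_inner_le_norm x v
    have b4 : ‖x‖ * ‖x‖ * |(1 + ‖x‖ ^ 2)⁻¹| ≤ 1 := by
      rw [abs_of_pos (inv_pos.mpr (hpos x)), ← div_eq_mul_inv, div_le_one (hpos x)]
      nlinarith
    rw [abs_of_pos ha0]
    have b5 : |(2 : ℝ)| = 2 := by norm_num
    push_cast
    rw [b5]
    calc _ ≤ C * (a * (|(1 + ‖x‖ ^ 2)⁻¹| * (2 * (‖x‖ * ‖v‖)))) * 8 * ‖x‖ := by gcongr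
      _ = (16 * C * a * ‖v‖) * (‖x‖ * ‖x‖ * |(1 + ‖x‖ ^ 2)⁻¹|) := by ring
      _ ≤ (16 * C * a * ‖v‖) * 1 := by gcongr
      _ = _ := by rw [ha]; field_simp; ring
  have hκ0 : 0 ≤ κ := by linarith
  lift κ to NNReal using hκ0
  have hlip : LipschitzWith κ F := by
    apply lipschitzWith_of_nnnorm_fderiv_le (𝕜 := ℝ) (hF.differentiable (by simp))
    intro x
    rw [← NNReal.coe_le_coe]
    refine ContinuousLinearMap.opNorm_le_bound _ κ.2 (fun v => ?_)
    have hw : HasFDerivAt W (fderiv ℝ W x) x := ((hW.differentiable (by simp)) x).hasFDerivAt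
    have h1 : HasFDerivAt F _ x := (hasFDerivAt_id x).sub (((hw.inner ℝ (hasFDerivAt_id x)).const_mul 2).smul hw)
    rw [h1.fderiv]
    have key : ‖refl (W x) v - ((2 * inner ℝ (fderiv ℝ W x v) x) • W x + (2 * inner ℝ (W x) x) • fderiv ℝ W x v)‖
        ≤ κ * ‖v‖ := by
      refine (norm_sub_le _ _).trans ?_
      rw [norm_refl _ _ (hW1 x)]
      have n1 := norm_add_le ((2 * inner ℝ (fderiv ℝ W x v) x) • W x) ((2 * inner ℝ (W x) x) • fderiv ℝ W x v)
      rw [norm_smul, norm_smul, norm_mul, norm_mul, hW1 x] at n1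
      have b1 := abs_real_inner_le_norm (fderiv ℝ W x v) x
      have b2 := abs_real_inner_le_norm (W x) x
      rw [hW1 x, one_mul] at b2
      simp only [Real.norm_eq_abs, Nat.abs_ofNat] at n1
      have b3 := mul_le_mul_of_nonneg_right b2 (norm_nonneg (fderiv ℝ W x v))
      have b4 := hWd x v
      nlinarith
    convert key using 2
    · rfl
    simp [refl]
    module
  refine ⟨⟨F, F, hFF, hFF⟩, ⟨hF, hF, hlip.dist_le_mul, ?_⟩, hFn, ?_, ?_⟩
  · intro x y
    have := hlip.dist_le_mul (F x) (F y)
    rwa [hFF, hFF] at this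
  · intro x hx
    have : W x = u := by
      have : Real.smoothTransition (q x) = 0 := by
        apply Real.smoothTransition.zero_of_nonpos
        apply mul_nonpos_of_nonneg_of_nonpos ha0.le
        rw [sub_nonpos]
        apply Real.log_le_log (hpos x)
        nlinarith [norm_nonneg x]
      simp only [W, this, hγ0]
    change refl (W x) x = _
    rw [this]
  · intro x hx
    have hx2 : 2 ≤ ‖x‖ := (le_max_left _ _).trans hx
    have hx3 : Real.exp (a⁻¹ + Real.log 5) ≤ ‖x‖ := (le_max_right _ _).trans hx
    have : W x = γ 1 := by
      have : Real.smoothTransition (q x) = 1 := by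
        apply Real.smoothTransition.one_of_one_le
        have h1 : a⁻¹ + Real.log 5 ≤ Real.log (1 + ‖x‖ ^ 2) := by
          rw [Real.le_log_iff_exp_le (hpos x)]
          nlinarith
        calc (1 : ℝ) = a * (a⁻¹ + Real.log 5 - Real.log 5) := by field_simp; simp
          _ ≤ _ := by simp only [q]; gcongr
      simp only [W, this]
    change refl (W x) x = _
    rw [this, refl, refl, mul_smul, mul_smul, hγe]

theorem lie_mul_apply (A B : E ≃ₗᵢ[ℝ] E) (x : E) : (A * B) x = A (B x) := rfl

theorem twist_list (κ : ℝ) (hκ : 1 < κ) : ∃ R ≥ 2, ∀ e : E, ‖e‖ = 1 → ∀ l : List E, (∀ u ∈ l, ‖u‖ = 1) →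
    ∃ F : E ≃ E, Good (κ ^ l.length) F ∧ (∀ x, ‖F x‖ = ‖x‖) ∧ (∀ x, ‖x‖ ≤ 2 → F x = l.foldr refl x) ∧
      (∀ x, R ≤ ‖x‖ → F x = (refl e)^[l.length] x) := by
  obtain ⟨R, hR, h⟩ := refl_twist (E := E) κ hκ
  refine ⟨R, hR, fun e he l => ?_⟩
  induction l with
  | nil =>
    intro _
    exact ⟨Equiv.refl E, good_refl (by simp), fun _ => rfl, fun _ _ => rfl, fun _ _ => rfl⟩
  | cons u l ih =>
    intro hl
    obtain ⟨G, g1, g2, g3, g4⟩ := ih (fun v hv => hl v (List.mem_cons_of_mem _ hv))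
    obtain ⟨F, f1, f2, f3, f4⟩ := h u e (hl u List.mem_cons_self) he
    refine ⟨G.trans F, ?_, ?_, ?_, ?_⟩
    · rw [List.length_cons, pow_succ']
      exact f1.comp (by linarith) (by positivity) g1
    · intro x; simp [f2, g2]
    · intro x hx
      rw [Equiv.trans_apply, f3 _ (by rw [g2]; exact hx), g3 x hx, List.foldr_cons]
    · intro x hx
      rw [Equiv.trans_apply, f4 _ (by rw [g2]; exact hx), g4 x hx, List.length_cons, iterate_succ_apply']

theorem unit_list (l : List E) : ∃ l' : List E, l'.length ≤ l.length ∧ (∀ u ∈ l', ‖u‖ = 1) ∧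
    ∀ x, (l.map (fun v => (ℝ ∙ v)ᗮ.reflection)).prod x = l'.foldr refl x := by
  induction l with
  | nil => exact ⟨[], by simp, by simp, fun x => by simp⟩
  | cons v l ih =>
    obtain ⟨l', h1, h2, h3⟩ := ih
    by_cases hv : v = 0
    · refine ⟨l', by simp; omega, h2, fun x => ?_⟩
      rw [List.map_cons, List.prod_cons, lie_mul_apply, h3,
        Submodule.reflection_orthogonal_apply, Submodule.reflection_singleton_apply, hv]
      simp
    · have hn : ‖v‖ ≠ 0 := norm_ne_zero_iff.mpr hv
      refine ⟨(‖v‖⁻¹ • v) :: l', by simp; omega, ?_, fun x => ?_⟩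
      · intro u hu
        rcases List.mem_cons.mp hu with rfl | hu
        · rw [norm_smul, norm_inv, norm_norm, inv_mul_cancel₀ hn]
        · exact h2 u hu
      · rw [List.map_cons, List.prod_cons, lie_mul_apply, h3,
          Submodule.reflection_orthogonal_apply, Submodule.reflection_singleton_apply, List.foldr_cons, refl]
        simp only [inner_smul_left, conj_trivial, smul_smul, neg_sub, RCLike.ofReal_real_eq_id, id,
          ← Nat.cast_smul_eq_nsmul ℝ]
        congr 2
        field_simp
        push_cast
        ring

theorem refl_iter_even (e : E) (he : ‖e‖ = 1) (m : ℕ) (hm : Even m) (x : E) : (refl e)^[m] x = x := by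
  obtain ⟨k, rfl⟩ := hm
  rw [← two_mul, iterate_mul]
  have : (refl e)^[2] = id := by
    funext x; simp [refl_refl e x he]
  rw [this, iterate_id]; rfl

theorem twist (κ : ℝ) (hκ : 1 < κ) : ∃ R ≥ 2, ∀ (ι : Type) [Fintype ι] (b : ι) (y : ι → E) (A : E ≃ₗᵢ[ℝ] E),
    Fintype.card ι ≤ Module.finrank ℝ E → y b = 0 →
    ∃ (A' : E ≃ₗᵢ[ℝ] E) (F : E ≃ E), Good (κ ^ (Module.finrank ℝ E + 1)) F ∧ (∀ i, A' (y i) = A (y i)) ∧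
      (∀ x, ‖x‖ ≤ 2 → F x = A' x) ∧ (∀ x, R ≤ ‖x‖ → F x = x) := by
  obtain ⟨R, hR, h⟩ := twist_list (E := E) κ hκ
  refine ⟨R, hR, ?_⟩
  intro ι _ b y A hcard hyb
  classical
  obtain ⟨e, he, hey⟩ : ∃ e : E, ‖e‖ = 1 ∧ ∀ i, inner ℝ e (y i) = 0 := by
    set S := Submodule.span ℝ (Set.range (fun i : {i // i ≠ b} => y i)) with hS
    have hd : Module.finrank ℝ S < Module.finrank ℝ E := by
      refine (finrank_range_le_card (fun i : {i // i ≠ b} => y i)).trans_lt (lt_of_lt_of_le ?_ hcard)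
      exact Fintype.card_subtype_lt (x := b) (by simp)
    have hne : Sᗮ ≠ ⊥ := by
      intro h0
      rw [Submodule.orthogonal_eq_bot_iff] at h0
      rw [h0, finrank_top] at hd
      exact lt_irrefl _ hd
    obtain ⟨n, hn, hn0⟩ := Submodule.exists_mem_ne_zero_of_ne_bot hne
    have hnn : ‖n‖ ≠ 0 := norm_ne_zero_iff.mpr hn0
    refine ⟨‖n‖⁻¹ • n, by rw [norm_smul, norm_inv, norm_norm, inv_mul_cancel₀ hnn], fun i => ?_⟩
    by_cases hi : i = b
    · rw [hi, hyb, inner_zero_right]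
    · rw [inner_smul_left, real_inner_comm, (Submodule.mem_orthogonal S n).mp hn (y i)
        (Submodule.subset_span ⟨⟨i, hi⟩, rfl⟩), mul_zero]
  obtain ⟨l0, hl0, hA⟩ := A.reflections_generate_dim
  obtain ⟨l, hl1, hl2, hl3⟩ := unit_list l0
  have hlen : l.length ≤ Module.finrank ℝ E := hl1.trans hl0
  rw [← hA] at hl3
  rcases Nat.even_or_odd l.length with hev | hodd
  · obtain ⟨F, f1, f2, f3, f4⟩ := h e he l hl2
    refine ⟨A, F, f1.mono (pow_le_pow_right₀ hκ.le (by omega)), fun _ => rfl, ?_, ?_⟩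
    · intro x hx; rw [f3 x hx, hl3]
    · intro x hx; rw [f4 x hx, refl_iter_even e he _ hev]
  · obtain ⟨F, f1, f2, f3, f4⟩ := h e he (l ++ [e]) (by
      intro u hu
      rcases List.mem_append.mp hu with hu | hu
      · exact hl2 u hu
      · rw [List.mem_singleton.mp hu, he])
    have hr : ∀ x, (ℝ ∙ e)ᗮ.reflection x = refl e x := by
      intro x
      rw [Submodule.reflection_orthogonal_apply, Submodule.reflection_singleton_apply, refl, he]
      simp only [neg_sub, ← Nat.cast_smul_eq_nsmul ℝ, smul_smul]
      simp
    refine ⟨A * (ℝ ∙ e)ᗮ.reflection, F, f1.mono (pow_le_pow_right₀ hκ.le (by simp; omega)), ?_, ?_, ?_⟩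
    · intro i
      rw [lie_mul_apply, hr, refl, hey]; simp
    · intro x hx
      rw [f3 x hx, lie_mul_apply, hr, hl3, List.foldr_append]; rfl
    · intro x hx
      rw [f4 x hx, refl_iter_even e he]
      simpa [Nat.even_add_one] using hodd

/-- equal distances from the origin and mutual distances give a linear isometry -/
theorem exists_isometry {ι : Type} [Fintype ι] (y z : ι → E) (b : ι) (hy : y b = 0) (hz : z b = 0)
    (h : ∀ i j, dist (z i) (z j) = dist (y i) (y j)) : ∃ A : E ≃ₗᵢ[ℝ] E, ∀ i, A (y i) = z i := by
  classical
  have hn : ∀ i, ‖z i‖ = ‖y i‖ := by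
    intro i; have := h i b; rwa [hy, hz, dist_zero_right, dist_zero_right] at this
  have hin : ∀ i j, inner ℝ (z i) (z j) = inner ℝ (y i) (y j) := by
    intro i j
    have := h i j
    rw [dist_eq_norm, dist_eq_norm] at this
    rw [real_inner_eq_norm_mul_self_add_norm_mul_self_sub_norm_sub_mul_self_div_two,
      real_inner_eq_norm_mul_self_add_norm_mul_self_sub_norm_sub_mul_self_div_two, hn, hn, this]
  let T := Fintype.linearCombination ℝ y
  let S := Fintype.linearCombination ℝ z
  have hTS : ∀ c, ‖S c‖ = ‖T c‖ := by
    intro c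
    have : ‖S c‖ ^ 2 = ‖T c‖ ^ 2 := by
      rw [← real_inner_self_eq_norm_sq, ← real_inner_self_eq_norm_sq]
      simp only [S, T, Fintype.linearCombination_apply, sum_inner, inner_sum, inner_smul_left, inner_smul_right, hin]
    exact (sq_eq_sq₀ (norm_nonneg _) (norm_nonneg _)).mp this
  obtain ⟨σ, hσ⟩ := T.rangeRestrict.exists_rightInverse_of_surjective (LinearMap.range_rangeRestrict T)
  have hσ' : ∀ w, T (σ w) = w := by
    intro w
    have := congrArg Subtype.val (LinearMap.congr_fun hσ w)
    simpa using this
  let I : LinearMap.range T →ₗᵢ[ℝ] E := ⟨S ∘ₗ σ, by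
    intro w
    rw [LinearMap.comp_apply, hTS, hσ']; rfl⟩
  let A := I.extend.toLinearIsometryEquiv rfl
  refine ⟨A, fun i => ?_⟩
  have hyi : T (Pi.single i 1) = y i := by simp [T]
  have hzi : S (Pi.single i 1) = z i := by simp [S]
  have hmem : y i ∈ LinearMap.range T := ⟨_, hyi⟩
  have e1 : A (y i) = S (σ ⟨y i, hmem⟩) := by
    have := I.extend_apply ⟨y i, hmem⟩
    exact this
  have e2 : ‖S (σ ⟨y i, hmem⟩ - Pi.single i 1)‖ = 0 := by
    rw [hTS, map_sub, hσ', hyi]; simp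
  rw [norm_eq_zero, map_sub, hzi, sub_eq_zero] at e2
  rw [e1, e2]

theorem near_isom_fin (m : ℕ) (θ : ℝ) (hθ : 0 < θ) : ∃ δ > 0, ∀ (y z : Fin (m + 1) → E),
    y 0 = 0 → z 0 = 0 → (∀ i, ‖y i‖ ≤ 1) →
    (∀ i j, dist (z i) (z j) ≤ (1 + δ) * dist (y i) (y j) ∧ dist (y i) (y j) ≤ (1 + δ) * dist (z i) (z j)) →
    ∃ A : E ≃ₗᵢ[ℝ] E, ∀ i, dist (A (y i)) (z i) ≤ θ := by
  by_contra! hcon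
  have hcon' : ∀ n : ℕ, _ := fun n => hcon (1 / ((n : ℝ) + 1)) Nat.one_div_pos_of_nat
  choose y z hy hz hy1 hd hA using hcon'
  have hδ1 : ∀ n : ℕ, 1 / ((n : ℝ) + 1) ≤ 1 := fun n => by
    rw [div_le_one (by positivity)]; linarith [(Nat.cast_nonneg n : (0 : ℝ) ≤ n)]
  have hz1 : ∀ n i, ‖z n i‖ ≤ 2 := by
    intro n i
    have h1 := (hd n i 0).1
    rw [hy, hz, dist_zero_right, dist_zero_right] at h1
    have h3 := hδ1 n
    nlinarith [hy1 n i, norm_nonneg (y n i)]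
  let C : Set ((Fin (m + 1) → E) × (Fin (m + 1) → E)) := Metric.closedBall 0 2
  have hC : IsCompact C := isCompact_closedBall _ _
  have hmem : ∀ n, (y n, z n) ∈ C := by
    intro n
    rw [mem_closedBall_zero_iff, Prod.norm_def]
    refine max_le ?_ ?_
    · exact (pi_norm_le_iff_of_nonneg (by norm_num)).mpr (fun i => (hy1 n i).trans (by norm_num))
    · exact (pi_norm_le_iff_of_nonneg (by norm_num)).mpr (fun i => hz1 n i)
  obtain ⟨⟨Y, Z⟩, -, φ, hφ, hlim⟩ := hC.tendsto_subseq hmem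
  have hlim1 : ∀ i, Filter.Tendsto (fun n => y (φ n) i) Filter.atTop (nhds (Y i)) := by
    intro i
    exact ((continuous_apply i).comp continuous_fst).continuousAt.tendsto.comp hlim
  have hlim2 : ∀ i, Filter.Tendsto (fun n => z (φ n) i) Filter.atTop (nhds (Z i)) := by
    intro i
    exact ((continuous_apply i).comp continuous_snd).continuousAt.tendsto.comp hlim
  have hδ : Filter.Tendsto (fun n => 1 + 1 / ((φ n : ℝ) + 1)) Filter.atTop (nhds 1) := by
    have := (tendsto_one_div_add_atTop_nhds_zero_nat (𝕜 := ℝ)).comp hφ.tendsto_atTop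
    simpa using this.const_add 1
  have hdist : ∀ i j, dist (Z i) (Z j) = dist (Y i) (Y j) := by
    intro i j
    apply le_antisymm
    · have := le_of_tendsto_of_tendsto' ((hlim2 i).dist (hlim2 j)) (hδ.mul ((hlim1 i).dist (hlim1 j)))
        (fun n => (hd (φ n) i j).1)
      simpa using this
    · have := le_of_tendsto_of_tendsto' ((hlim1 i).dist (hlim1 j)) (hδ.mul ((hlim2 i).dist (hlim2 j)))
        (fun n => (hd (φ n) i j).2)
      simpa using this
  have hY0 : Y 0 = 0 := tendsto_nhds_unique (hlim1 0) (by simp [hy])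
  have hZ0 : Z 0 = 0 := tendsto_nhds_unique (hlim2 0) (by simp [hz])
  obtain ⟨A, hAA⟩ := exists_isometry Y Z 0 hY0 hZ0 hdist
  have hlim3 : ∀ i, Filter.Tendsto (fun n => dist (A (y (φ n) i)) (z (φ n) i)) Filter.atTop (nhds 0) := by
    intro i
    have := ((A.continuous.tendsto _).comp (hlim1 i)).dist (hlim2 i)
    rwa [hAA, dist_self] at this
  have hev : ∀ᶠ n in Filter.atTop, ∀ i, dist (A (y (φ n) i)) (z (φ n) i) < θ := by
    rw [Filter.eventually_all]
    intro i
    exact (hlim3 i).eventually_lt_const hθ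
  obtain ⟨n, hn⟩ := hev.exists
  obtain ⟨i, hi⟩ := hA (φ n) A
  exact lt_asymm hi (hn i)

theorem near_isom (m : ℕ) (θ : ℝ) (hθ : 0 < θ) : ∃ δ₀ > 0, ∀ δ, δ ≤ δ₀ → ∀ (ι : Type) [Fintype ι],
    Fintype.card ι = m + 1 → ∀ (b : ι) (y z : ι → E),
    y b = 0 → z b = 0 → (∀ i, ‖y i‖ ≤ 1) →
    (∀ i j, dist (z i) (z j) ≤ (1 + δ) * dist (y i) (y j) ∧ dist (y i) (y j) ≤ (1 + δ) * dist (z i) (z j)) →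
    ∃ A : E ≃ₗᵢ[ℝ] E, ∀ i, dist (A (y i)) (z i) ≤ θ := by
  obtain ⟨δ₀, hδ₀, h⟩ := near_isom_fin (E := E) m θ hθ
  refine ⟨δ₀, hδ₀, fun δ hδ ι _ hc b y z hy hz hy1 hd => ?_⟩
  classical
  let e0 := Fintype.equivFinOfCardEq hc
  let e := e0.trans (Equiv.swap (e0 b) 0)
  have heb : e.symm 0 = b := by
    rw [Equiv.symm_apply_eq]; simp [e]
  obtain ⟨A, hA⟩ := h (fun i => y (e.symm i)) (fun i => z (e.symm i)) (by simp [heb, hy]) (by simp [heb, hz])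
    (fun i => hy1 _) (fun i j => ⟨(hd _ _).1.trans (by gcongr), (hd _ _).2.trans (by gcongr)⟩)
  refine ⟨A, fun i => ?_⟩
  simpa using hA (e i)

/-- composing maps supported in disjoint balls -/
theorem combine {ι : Type} (κ : ℝ) (hκ : 1 ≤ κ) (p : ι → E) (ρ : ℝ) (Θ : ι → E ≃ E)
    (T : Finset ι) (hG : ∀ r ∈ T, Good κ (Θ r)) (hid : ∀ r ∈ T, ∀ x, ρ ≤ dist x (p r) → Θ r x = x)
    (hsep : ∀ r ∈ T, ∀ r' ∈ T, r ≠ r' → 2 * ρ ≤ dist (p r) (p r')) :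
    ∃ Ψ : E ≃ E, Good (κ ^ T.card) Ψ ∧ (∀ r ∈ T, ∀ x, dist x (p r) < ρ → Ψ x = Θ r x) ∧
      (∀ x, (∀ r ∈ T, ρ ≤ dist x (p r)) → Ψ x = x) := by
  classical
  induction T using Finset.induction_on with
  | empty => exact ⟨Equiv.refl E, good_refl (by simp), by simp, by simp⟩
  | insert a T ha ih =>
    obtain ⟨Ψ, h1, h2, h3⟩ := ih (fun r hr => hG r (Finset.mem_insert_of_mem hr))
      (fun r hr => hid r (Finset.mem_insert_of_mem hr))
      (fun r hr r' hr' => hsep r (Finset.mem_insert_of_mem hr) r' (Finset.mem_insert_of_mem hr'))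
    have hidr := hid
    have hpres : ∀ r ∈ insert a T, ∀ x, dist x (p r) < ρ → dist (Θ r x) (p r) < ρ := by
      intro r hr x hx
      by_contra hcon
      push Not at hcon
      have := (Θ r).injective (hid r hr _ hcon)
      rw [this] at hcon
      linarith
    have hfar : ∀ r ∈ insert a T, ∀ r' ∈ insert a T, r ≠ r' → ∀ x, dist x (p r) < ρ → ρ ≤ dist x (p r') := by
      intro r hr r' hr' hne x hx
      have := hsep r hr r' hr' hne
      have h4 := dist_triangle_left (p r) (p r') x
      linarith
    have haT : ∀ r ∈ T, a ≠ r := fun r hr h => ha (h ▸ hr)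
    refine ⟨Ψ.trans (Θ a), ?_, ?_, ?_⟩
    · rw [Finset.card_insert_of_notMem ha, pow_succ']
      exact (hG a (Finset.mem_insert_self _ _)).comp (by linarith) (by positivity) h1
    · intro r hr x hx
      rw [Equiv.trans_apply]
      rcases Finset.mem_insert.mp hr with rfl | hrT
      · rw [h3 x]
        intro r' hr'
        exact hfar r hr r' (Finset.mem_insert_of_mem hr') (haT r' hr') x hx
      · rw [h2 r hrT x hx]
        exact hid a (Finset.mem_insert_self _ _) _
          (hfar r hr a (Finset.mem_insert_self _ _) (haT r hrT).symm _ (hpres r hr x hx))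
    · intro x hx
      rw [Equiv.trans_apply, h3 x (fun r hr => hx r (Finset.mem_insert_of_mem hr))]
      exact hid a (Finset.mem_insert_self _ _) x (hx a (Finset.mem_insert_self _ _))

/-- a gap in the set of distances -/
theorem gap {ι : Type} [Fintype ι] (d : ι → ι → ℝ) (c : ℝ) (hc0 : 0 < c) (hc : c < 1) :
    ∃ l : ℕ, l ≤ Fintype.card ι * Fintype.card ι ∧ ∀ i j, d i j ≤ c * c ^ l ∨ c ^ l ≤ d i j := by
  by_contra! hcon
  have hcon' : ∀ l : Fin (Fintype.card ι * Fintype.card ι + 1), ∃ q : ι × ι,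
      c * c ^ (l : ℕ) < d q.1 q.2 ∧ d q.1 q.2 < c ^ (l : ℕ) := by
    intro l
    obtain ⟨i, j, h⟩ := hcon l (by omega)
    exact ⟨(i, j), h⟩
  choose q hq1 hq2 using hcon'
  obtain ⟨l, l', hne, heq⟩ := Fintype.exists_ne_map_eq_of_card_lt q (by simp)
  have main : ∀ l l' : Fin (Fintype.card ι * Fintype.card ι + 1), q l = q l' → ¬ l < l' := by
    intro l l' heq hlt
    have h1 := hq1 l
    have h2 := hq2 l'
    rw [heq] at h1
    have h3 : c ^ (l' : ℕ) ≤ c ^ ((l : ℕ) + 1) := pow_le_pow_of_le_one hc0.le hc.le (by exact hlt)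
    rw [pow_succ'] at h3
    linarith
  rcases lt_or_gt_of_ne hne with h | h
  · exact main _ _ heq h
  · exact main _ _ heq.symm h

theorem exists_root (K : ℝ) (hK : 1 < K) (m : ℕ) : ∃ κ > 1, κ ^ m ≤ K := by
  have hcont : Filter.Tendsto (fun x : ℝ => x ^ m) (nhdsWithin 1 (Set.Ioi 1)) (nhds 1) := by
    have : ContinuousAt (fun x : ℝ => x ^ m) 1 := (continuous_pow m).continuousAt
    have h2 := this.tendsto
    simp only [one_pow] at h2
    exact h2.mono_left nhdsWithin_le_nhds
  have h1 := hcont.eventually_lt_const hK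
  obtain ⟨κ, h2, h3⟩ := (h1.and self_mem_nhdsWithin).exists
  exact ⟨κ, h3, h2.le⟩

/-- the conclusion for a family of points -/
def Concl (K R : ℝ) {ι : Type} (b : ι) (y z : ι → E) (M : ℝ) : Prop :=
  ∃ Φ : E ≃ E, Good K Φ ∧ (∀ i, Φ (y i) = z i) ∧ ∀ x, R * M ≤ dist x (y b) → Φ x = x

/-- distances agree up to a factor `1 + δ`. -/
def Near (δ : ℝ) {ι : Type} (y z : ι → E) : Prop :=
  ∀ i j, dist (z i) (z j) ≤ (1 + δ) * dist (y i) (y j) ∧ dist (y i) (y j) ≤ (1 + δ) * dist (z i) (z j)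

theorem Near.mono {δ δ' : ℝ} {ι : Type} {y z : ι → E} (h : Near δ y z) (hd : δ ≤ δ') : Near δ' y z :=
  fun i j => ⟨(h i j).1.trans (by gcongr), (h i j).2.trans (by gcongr)⟩

theorem normalize (K R δ : ℝ) (hK : 1 ≤ K) (hR : 0 < R) (ι : Type) [Fintype ι]
    (h : ∀ (b : ι) (y z : ι → E), y b = 0 → z b = 0 → (∀ i, ‖y i‖ ≤ 1) → (∃ i, ‖y i‖ = 1) → Near δ y z →
      Concl K R b y z 1)
    (b : ι) (y z : ι → E) (M : ℝ) (hyz : y b = z b) (hM : ∀ i, dist (y i) (y b) ≤ M) (hn : Near δ y z) :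
    Concl K R b y z M := by
  have : Nonempty ι := ⟨b⟩
  obtain ⟨i0, hi0⟩ := Finite.exists_max (fun i => dist (y i) (y b))
  set m := dist (y i0) (y b) with hm
  rcases eq_or_lt_of_le (dist_nonneg : 0 ≤ m) with h0 | hpos
  · have hy : ∀ i, y i = y b := fun i => dist_le_zero.mp ((hi0 i).trans h0.symm.le)
    have hz : ∀ i, z i = z b := by
      intro i
      have := (hn i b).1
      rw [hy i, dist_self, mul_zero] at this
      exact dist_le_zero.mp this
    exact ⟨Equiv.refl E, good_refl hK, fun i => by rw [hy, hz, Equiv.refl_apply, hyz], fun x _ => rfl⟩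
  · have hd : ∀ (p : E) (u v : E), dist (m⁻¹ • (u - p)) (m⁻¹ • (v - p)) = m⁻¹ * dist u v := by
      intro p u v
      rw [dist_smul₀, dist_sub_right, Real.norm_eq_abs, abs_of_pos (by positivity)]
    have hd0 : ∀ (p : E) (u : E), ‖m⁻¹ • (u - p)‖ = m⁻¹ * dist u p := by
      intro p u
      rw [norm_smul, Real.norm_eq_abs, abs_of_pos (by positivity), dist_eq_norm]
    obtain ⟨Φ, f1, f2, f3⟩ := h b (fun i => m⁻¹ • (y i - y b)) (fun i => m⁻¹ • (z i - y b)) (by simp)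
      (by simp [hyz]) (fun i => by
        rw [hd0, inv_mul_le_iff₀ hpos, mul_one]; exact hi0 i) ⟨i0, by rw [hd0, ← hm, inv_mul_cancel₀ hpos.ne']⟩
      (fun i j => by
        rw [hd, hd]
        have h1 := mul_le_mul_of_nonneg_left (hn i j).1 (by positivity : 0 ≤ m⁻¹)
        have h2 := mul_le_mul_of_nonneg_left (hn i j).2 (by positivity : 0 ≤ m⁻¹)
        constructor <;> linarith)
    obtain ⟨Ψ, g1, g2⟩ := f1.conj (y b) hpos
    refine ⟨Ψ, g1, fun i => ?_, fun x hx => ?_⟩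
    · rw [g2, f2, smul_smul, mul_inv_cancel₀ hpos.ne', one_smul]; abel
    · rw [g2, f3, smul_smul, mul_inv_cancel₀ hpos.ne', one_smul]
      · abel
      · simp only [sub_self, smul_zero, dist_zero_right]
        rw [hd0, le_inv_mul_iff₀ hpos]
        have := hM i0
        nlinarith

/-- the inductive statement -/
def P (E : Type*) [NormedAddCommGroup E] [InnerProductSpace ℝ E] (n : ℕ) : Prop :=
  ∀ K : ℝ, 1 < K → ∃ R > 0, ∃ δ > 0, ∀ (ι : Type) [Fintype ι], Fintype.card ι ≤ n →
    ∀ (b : ι) (y z : ι → E) (M : ℝ), y b = z b → (∀ i, dist (y i) (y b) ≤ M) → Near δ y z → Concl K R b y z M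

theorem step (n : ℕ) (hn : n + 1 ≤ Module.finrank ℝ E) (ih : P E n) (K : ℝ) (hK : 1 < K) :
    ∃ R > 0, ∃ δ > 0, ∀ (ι : Type) [Fintype ι], Fintype.card ι = n + 1 → ∀ (b : ι) (y z : ι → E),
      y b = 0 → z b = 0 → (∀ i, ‖y i‖ ≤ 1) → (∃ i, ‖y i‖ = 1) → Near δ y z → Concl K R b y z 1 := by
  obtain ⟨κ, hκ1, hκK⟩ := exists_root K hK (2 * (n + 1) + (Module.finrank ℝ E + 1))
  have hκ0 : 0 < κ := by linarith
  obtain ⟨R1, hR1, δ1, hδ1, hP⟩ := ih κ hκ1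
  obtain ⟨θp, hθp, hpush⟩ := push (E := E) κ hκ1
  obtain ⟨R, hR, htw⟩ := twist (E := E) κ hκ1
  set c : ℝ := min (1 / 8) (1 / (4 * R1)) with hcdef
  have hc0 : 0 < c := lt_min (by norm_num) (by positivity)
  have hc8 : c ≤ 1 / 8 := min_le_left _ _
  have hcR : R1 * c ≤ 1 / 4 := by
    have : c ≤ 1 / (4 * R1) := min_le_right _ _
    calc R1 * c ≤ R1 * (1 / (4 * R1)) := by gcongr
      _ = 1 / 4 := by field_simp
  set τ := c ^ ((n + 1) * (n + 1)) with hτ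
  have hτ0 : 0 < τ := by positivity
  set θ := min (θp / 8) (1 / 24) * τ with hθdef
  have hθ0 : 0 < θ := mul_pos (lt_min (by positivity) (by norm_num)) hτ0
  obtain ⟨δ0, hδ0, hiso⟩ := near_isom (E := E) n θ hθ0
  refine ⟨R, by linarith, min δ1 δ0, lt_min hδ1 hδ0, ?_⟩
  intro ι _ hcard b y z hyb hzb hy1 hex hnear
  classical
  obtain ⟨A0, hA0⟩ := hiso _ (min_le_right _ _) ι hcard b y z hyb hzb hy1 hnear
  obtain ⟨A, F, hF1, hAA, hF2, hF3⟩ := htw ι b y A0 (by omega) hyb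
  have hA : ∀ i, dist (A (y i)) (z i) ≤ θ := fun i => by rw [hAA]; exact hA0 i
  obtain ⟨l, hl, hgap⟩ := gap (fun i j => dist (y i) (y j)) c hc0 (by linarith)
  set t := c ^ l with ht
  have ht0 : 0 < t := by positivity
  have ht1 : t ≤ 1 := pow_le_one₀ hc0.le (by linarith)
  have hτt : τ ≤ t := by
    rw [hcard] at hl
    exact pow_le_pow_of_le_one hc0.le (by linarith) hl
  have hθ1 : θ ≤ θp * (t / 8) := by
    calc θ ≤ (θp / 8) * t := by
          rw [hθdef]; gcongr; exact min_le_left _ _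
      _ = _ := by ring
  have hθ2 : θ ≤ t / 24 := by
    calc θ ≤ (1 / 24) * t := by
          rw [hθdef]; gcongr; exact min_le_right _ _
      _ = _ := by ring
  have hct : c * t ≤ t / 8 := by nlinarith
  -- clusters
  let S : Setoid ι := ⟨fun i j => dist (y i) (y j) ≤ c * t, ⟨fun i => by
      rw [dist_self]; positivity, fun {i j} h => by rwa [dist_comm], fun {i j k} h1 h2 => by
      rcases hgap i k with h | h
      · exact h
      · have := dist_triangle (y i) (y j) (y k)
        linarith⟩⟩
  let rep : ι → ι := fun i => (Quotient.mk S i).out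
  have hrep : ∀ i, dist (y i) (y (rep i)) ≤ c * t := fun i => by
    have : S (rep i) i := Quotient.mk_out (s := S) i
    rw [dist_comm]; exact this
  have hreprep : ∀ i, rep (rep i) = rep i := fun i => by
    simp [rep, Quotient.out_eq]
  have hrepeq : ∀ i j, dist (y i) (y j) ≤ c * t → rep i = rep j := fun i j h => by
    have : Quotient.mk S i = Quotient.mk S j := Quotient.sound h
    simp only [rep, this]
  let T : Finset ι := Finset.univ.image rep
  have hT : ∀ r ∈ T, rep r = r := by
    intro r hr
    obtain ⟨i, -, rfl⟩ := Finset.mem_image.mp hr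
    exact hreprep i
  have hTc : T.card ≤ n + 1 := by
    rw [← hcard]; exact Finset.card_le_univ _
  -- local maps
  have hloc : ∀ r, ∃ Θ : E ≃ E, r ∈ T → Good (κ * κ) Θ ∧ (∀ x, t / 3 ≤ dist x (A (y r)) → Θ x = x) ∧
      (∀ i, rep i = r → Θ (A (y i)) = z i) := by
    intro r
    by_cases hr : r ∈ T
    swap
    · exact ⟨Equiv.refl E, fun h => absurd h hr⟩
    obtain ⟨Ph, p1, p2, p3⟩ := hpush (A (y r)) (z r - A (y r)) (t / 8) (by positivity) (by
      rw [← dist_eq_norm, dist_comm]; exact (hA r).trans hθ1)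
    have hcl : Fintype.card {i // rep i = r} ≤ n := by
      have : Fintype.card {i // rep i = r} < Fintype.card ι := by
        obtain ⟨i1, hi1⟩ := hex
        by_cases hb : rep b = r
        · refine Fintype.card_subtype_lt (x := i1) (fun h => ?_)
          have h1 : dist (y i1) (y b) ≤ c * t + c * t := by
            have h2 := hrep i1
            have h3 := hrep b
            rw [h] at h2; rw [hb] at h3
            have := dist_triangle_right (y i1) (y b) (y r)
            linarith
          rw [hyb, dist_zero_right, hi1] at h1
          linarith
        · exact Fintype.card_subtype_lt (x := b) hb
      omega
    obtain ⟨Q, q1, q2, q3⟩ := hP {i // rep i = r} hcl ⟨r, hT r hr⟩ (fun i => A (y i - y r) + z r) (fun i => z i)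
      (c * t) (by simp) (fun i => by
        have := hrep i
        rw [i.2] at this
        simp only [sub_self, map_zero, dist_add_right, dist_zero_right, A.norm_map]
        rwa [← dist_eq_norm]) (fun i j => by
        have e : dist (A (y i - y r) + z r) (A (y j - y r) + z r) = dist (y i) (y j) := by
          rw [dist_add_right, A.dist_map, dist_sub_right]
        rw [e]
        exact hnear.mono (min_le_left _ _) i j)
    refine ⟨Ph.trans Q, fun _ => ⟨q1.comp hκ0.le hκ0.le p1, ?_, ?_⟩⟩
    · intro x hx
      rw [Equiv.trans_apply, p3 x (by linarith)]
      apply q3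
      have h1 : R1 * (c * t) ≤ t / 4 := by nlinarith
      have h2 := dist_triangle_right x (A (y r)) (z r)
      have h3 := hA r
      simp only [sub_self, map_zero, zero_add]
      linarith
    · intro i hi
      have h1 : dist (A (y i)) (A (y r)) ≤ t / 8 := by
        rw [A.dist_map]
        have := hrep i
        rw [hi] at this
        linarith
      have h2 := q2 ⟨i, hi⟩
      simp only at h2
      rw [Equiv.trans_apply, p2 _ h1, ← h2, map_sub]
      congr 1
      abel
  choose Θ hΘ using hloc
  obtain ⟨Ψ, g1, g2, g3⟩ := combine (κ * κ) (by nlinarith) (fun r => A (y r)) (t / 3) Θ T (fun r hr => (hΘ r hr).1)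
    (fun r hr => (hΘ r hr).2.1) (fun r hr r' hr' hne => by
      rw [A.dist_map]
      rcases hgap r r' with h | h
      · exact absurd ((hT r hr).symm.trans ((hrepeq r r' h).trans (hT r' hr'))) hne
      · linarith)
  refine ⟨F.trans Ψ, ?_, ?_, ?_⟩
  · have := g1.comp (by positivity) (by positivity) hF1
    refine this.mono (le_trans ?_ hκK)
    rw [pow_add κ (2 * (n + 1)), pow_mul, pow_two]
    have h1 : (κ * κ) ^ T.card ≤ (κ * κ) ^ (n + 1) := pow_le_pow_right₀ (by nlinarith) hTc
    gcongr
  · intro i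
    have hri : rep i ∈ T := Finset.mem_image_of_mem _ (Finset.mem_univ _)
    rw [Equiv.trans_apply, hF2 _ ((hy1 i).trans (by norm_num)), g2 (rep i) hri _ (by
      rw [A.dist_map]
      have := hrep i
      linarith)]
    exact (hΘ _ hri).2.2 i rfl
  · intro x hx
    rw [hyb, dist_zero_right, mul_one] at hx
    rw [Equiv.trans_apply, hF3 x hx]
    apply g3
    intro r _
    have h1 := norm_sub_norm_le x (A (y r))
    rw [A.norm_map, ← dist_eq_norm] at h1
    have h2 := hy1 r
    linarith

theorem P_all (n : ℕ) (hn : n ≤ Module.finrank ℝ E) : P E n := by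
  induction n with
  | zero =>
    intro K hK
    refine ⟨1, one_pos, 1, one_pos, ?_⟩
    intro ι _ hc b
    have : 0 < Fintype.card ι := Fintype.card_pos_iff.mpr ⟨b⟩
    omega
  | succ n ih =>
    intro K hK
    have ih' := ih (by omega)
    obtain ⟨R1, hR1, δ1, hδ1, h1⟩ := ih' K hK
    obtain ⟨R2, hR2, δ2, hδ2, h2⟩ := step n hn ih' K hK
    refine ⟨max R1 R2, lt_max_of_lt_left hR1, min δ1 δ2, lt_min hδ1 hδ2, ?_⟩
    intro ι _ hc b y z M hyz hM hnear
    have hM0 : 0 ≤ M := dist_nonneg.trans (hM b)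
    rcases Nat.lt_or_ge (Fintype.card ι) (n + 1) with hlt | hge
    · obtain ⟨Φ, f1, f2, f3⟩ := h1 ι (by omega) b y z M hyz hM (hnear.mono (min_le_left _ _))
      refine ⟨Φ, f1, f2, fun x hx => f3 x (le_trans ?_ hx)⟩
      gcongr
      exact le_max_left _ _
    · obtain ⟨Φ, f1, f2, f3⟩ := normalize K R2 δ2 hK.le hR2 ι (h2 ι (by omega)) b y z M hyz hM
        (hnear.mono (min_le_right _ _))
      refine ⟨Φ, f1, f2, fun x hx => f3 x (le_trans ?_ hx)⟩
      gcongr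
      exact le_max_right _ _

theorem Good.fderiv_bounds {K : ℝ} {Φ : E ≃ E} (hK : 0 ≤ K) (h : Good K Φ) (x v : E) :
    ‖v‖ ≤ K * ‖fderiv ℝ Φ x v‖ ∧ ‖fderiv ℝ Φ x v‖ ≤ K * ‖v‖ := by
  lift K to NNReal using hK
  have l1 : LipschitzWith K Φ := LipschitzWith.of_dist_le_mul h.l1
  have l2 : LipschitzWith K Φ.symm := LipschitzWith.of_dist_le_mul (fun a b => by
    simpa using h.l2 (Φ.symm a) (Φ.symm b))
  have d1 : HasFDerivAt Φ (fderiv ℝ Φ x) x := ((h.c1.differentiable (by simp)) x).hasFDerivAt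
  have d2 : HasFDerivAt Φ.symm (fderiv ℝ Φ.symm (Φ x)) (Φ x) := ((h.c2.differentiable (by simp)) _).hasFDerivAt
  constructor
  · have d3 := d2.comp x d1
    have : (Φ.symm ∘ Φ : E → E) = id := by funext a; simp
    rw [this] at d3
    have e := d3.unique (hasFDerivAt_id x)
    have e2 : fderiv ℝ Φ.symm (Φ x) (fderiv ℝ Φ x v) = v := by
      have := congrArg (fun L : E →L[ℝ] E => L v) e
      simpa using this
    conv_lhs => rw [← e2]
    exact ContinuousLinearMap.le_of_opNorm_le _ (norm_fderiv_le_of_lipschitz ℝ l2) _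
  · exact ContinuousLinearMap.le_of_opNorm_le _ (norm_fderiv_le_of_lipschitz ℝ l1) _

end DistortExt

/-- For small `ε` there exist `η, δ > 0` (depending on `ε, D`) such that
any two k-point configurations (`1 ≤ k ≤ D`, `y_1 = z_1`) with pairwise distance ratios
in `[(1+δ)⁻¹, 1+δ]` are matched by an `ε`-distorted diffeomorphism that is the identity
outside the ball of radius `η⁻¹ diam{y_1,...,y_k}` about `y_1`. -/
theorem distorted_extension_with_identity_outside
    (D : ℕ) (hD : 2 ≤ D) :
    ∃ ε₀ > (0 : ℝ), ∀ ε : ℝ, 0 < ε → ε < ε₀ →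
      ∃ η > (0 : ℝ), ∃ δ > (0 : ℝ), ∀ (k : ℕ) (hk : 1 ≤ k), k ≤ D →
        ∀ y z : Fin k → EuclideanSpace ℝ (Fin D),
          Function.Injective y → Function.Injective z →
          y ⟨0, hk⟩ = z ⟨0, hk⟩ →
          (∀ i j, i ≠ j →
            (1 + δ)⁻¹ ≤ dist (z i) (z j) / dist (y i) (y j) ∧
            dist (z i) (z j) / dist (y i) (y j) ≤ 1 + δ) →
          ∃ Φ : EuclideanSpace ℝ (Fin D) → EuclideanSpace ℝ (Fin D),
            IsDistorted D ε Φ ∧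
            (∀ i, Φ (y i) = z i) ∧
            (∀ x, η⁻¹ * Metric.diam (Set.range y) ≤ dist x (y ⟨0, hk⟩) → Φ x = x) := by
  refine ⟨1, one_pos, fun ε hε _ => ?_⟩
  obtain ⟨K, hK1, hK2⟩ := DistortExt.exists_root (1 + ε) (by linarith) 2
  obtain ⟨R, hR, δ, hδ, hP⟩ := DistortExt.P_all (E := EuclideanSpace ℝ (Fin D)) D (by simp) K hK1
  refine ⟨R⁻¹, inv_pos.mpr hR, δ, hδ, ?_⟩
  intro k hk hkD y z hy hz hyz hdist
  have hnear : DistortExt.Near δ y z := by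
    intro i j
    by_cases hij : i = j
    · simp [hij]
    · have hpos : 0 < dist (y i) (y j) := dist_pos.mpr (fun h => hij (hy h))
      obtain ⟨h1, h2⟩ := hdist i j hij
      rw [div_le_iff₀ hpos] at h2
      rw [le_div_iff₀ hpos, inv_mul_le_iff₀ (by linarith)] at h1
      exact ⟨h2, h1⟩
  obtain ⟨Φ, f1, f2, f3⟩ := hP (Fin k) (by simpa using hkD) ⟨0, hk⟩ y z (Metric.diam (Set.range y)) hyz
    (fun i => Metric.dist_le_diam_of_mem (Set.finite_range y).isBounded ⟨i, rfl⟩ ⟨_, rfl⟩) hnear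
  refine ⟨Φ, ⟨Φ.bijective, f1.c1, ?_, ?_⟩, f2, ?_⟩
  · have : Function.invFun Φ = Φ.symm := by
      funext x
      apply Φ.injective
      rw [Function.invFun_eq (Φ.surjective x), Equiv.apply_symm_apply]
    rw [this]
    exact f1.c2
  · intro x v
    obtain ⟨b1, b2⟩ := f1.fderiv_bounds (by linarith) x v
    constructor
    · rw [inv_mul_le_iff₀ (by linarith)]
      calc ‖v‖ ^ 2 ≤ (K * ‖fderiv ℝ Φ x v‖) ^ 2 := by gcongr
        _ = K ^ 2 * ‖fderiv ℝ Φ x v‖ ^ 2 := by ring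
        _ ≤ _ := by gcongr
    · calc ‖fderiv ℝ Φ x v‖ ^ 2 ≤ (K * ‖v‖) ^ 2 := by gcongr
        _ = K ^ 2 * ‖v‖ ^ 2 := by ring
        _ ≤ _ := by gcongr
  · intro x hx
    rw [inv_inv] at hx
    exact f3 x hx
end
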